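/- arXiv:2105.01319 — 3 statements merged into one kernel-verified Lean document; each statement's English description precedes it below -/
import Mathlib

section
/- Let F be a field of characteristic p > 0 with F^{p−1} = F, let {b_1, ..., b_r} ⊆ F be p-independent, let m_1, ..., m_r ∈ ℕ, and let E = F(b_1^{1/p^{m_1}}, ..., b_r^{1/p^{m_r}}) inside an algebraic closure of F. Then ν_n(E/F) = [dx/x | x ∈ F^p(b_1, ..., b_r)^*] ∧ ν_{n−1}(F). -/
set_option synthInstance.maxHeartbeats 1000000
set_option maxHeartbeats 1000000

open ExteriorAlgebra

noncomputable section Preamble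

variable (F : Type) [Field F] (p : ℕ)

/-- The subfield `F^{p^t}(C)` of `F` generated by the `p^t`-th powers and the set `C`. -/
def pClosureT (t : ℕ) (C : Set F) : Subfield F :=
  Subfield.closure ((Set.range fun x : F => x ^ p ^ t) ∪ C)

/-- The subfield `F^p(C)` of `F` generated by the `p`-th powers and the set `C`. -/
def pClosure (C : Set F) : Subfield F := pClosureT F p 1 C

/-- The degree `[B(A) : B]` for a subfield `B` of `F` and a subset `A ⊆ F`. -/
def relDeg (B : Subfield F) (A : Set F) : ℕ :=
  Module.finrank B (IntermediateField.adjoin B A)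

/-- `pdeg A = k`, i.e. `[F^p(A) : F^p] = p ^ k`. -/
def pDegEq (A : Set F) (k : ℕ) : Prop :=
  relDeg F (pClosure F p ∅) A = p ^ k

/-- A finite family `a : Fin n → F` is `p`-independent if `[F^p(a₁,…,aₙ) : F^p] = pⁿ`. -/
def pIndep {n : ℕ} (a : Fin n → F) : Prop :=
  pDegEq F p (Set.range a) n

/-- The exterior algebra of the absolute differential forms of `F`; the spaces `Ωⁿ(F)`
are its graded pieces and the wedge product is its multiplication. -/
abbrev ExtOmega := ExteriorAlgebra F (Ω[F⁄ℤ])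

/-- The differential `d a` of an element `a : F`, viewed in the exterior algebra. -/
def dform (a : F) : ExtOmega F :=
  ExteriorAlgebra.ι F (KaehlerDifferential.D ℤ F a)

/-- The space `Ωⁿ(F)` of `n`-differential forms, as a submodule of the exterior algebra;
it is `0` for `n < 0`. -/
def OmegaPow (n : ℤ) : Submodule F (ExtOmega F) :=
  if 0 ≤ n then ⋀[F]^(n.toNat) (Ω[F⁄ℤ]) else ⊥

/-- The wedge product `d a₁ ∧ … ∧ d aₙ` of the differentials of a family. -/
def dwedge {n : ℕ} (a : Fin n → F) : ExtOmega F :=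
  (List.ofFn fun i => dform F (a i)).prod

/-- The annihilator `annΩ^n_F(U)` of a set `U` of differential forms. -/
def annOmega (n : ℕ) (U : Set (ExtOmega F)) : Submodule F (ExtOmega F) :=
  OmegaPow F n ⊓ ⨅ u ∈ U, LinearMap.ker (LinearMap.mulRight F u)

/-- The logarithmic differential form `(dx₁/x₁) ∧ … ∧ (dxₙ/xₙ)`. -/
def logForm {n : ℕ} (x : Fin n → F) : ExtOmega F :=
  (List.ofFn fun i => ExteriorAlgebra.ι F ((x i)⁻¹ • KaehlerDifferential.D ℤ F (x i))).prod

/-- The group `ν_n(F)`, additively generated by the logarithmic differential forms;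
it is `0` for `n < 0`. -/
def nuPow (n : ℤ) : AddSubgroup (ExtOmega F) :=
  if 0 ≤ n then
    AddSubgroup.closure
      {ω | ∃ x : Fin n.toNat → F, (∀ i, x i ≠ 0) ∧ ω = logForm F x}
  else ⊥

/-- The annihilator `ann ν^n_F(U)`. -/
def annNu (n : ℕ) (U : Set (ExtOmega F)) : AddSubgroup (ExtOmega F) :=
  (annOmega F n U).toAddSubgroup ⊓ nuPow F n

/-- `η ∧ W` for a form `η` and a subspace `W`. -/
def wedgeL (η : ExtOmega F) (W : Submodule F (ExtOmega F)) : Submodule F (ExtOmega F) :=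
  W.map (LinearMap.mulLeft F η)

/-- The set `dS₁ ∧ … ∧ dSᵣ` for sets `S₁, …, Sᵣ ⊆ F`. -/
def dSet {r : ℕ} (S : Fin r → Set F) : Set (ExtOmega F) :=
  {ω | ∃ s : Fin r → F, (∀ i, s i ∈ S i) ∧ ω = dwedge F s}

/-- The additive subgroup `[dy₁/y₁ ∧ … ∧ dy_t/y_t ∣ yᵢ ∈ K^*] ∧ ν_m(F)` of `Ωⁿ(F)`
(for `n = t + m`). -/
def logWedgeNu (K : Set F) (t : ℕ) (m : ℤ) : AddSubgroup (ExtOmega F) :=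
  AddSubgroup.closure
    {ω | ∃ y : Fin t → F, (∀ i, y i ∈ K ∧ y i ≠ 0) ∧
      ∃ χ ∈ nuPow F m, ω = logForm F y * χ}

variable (E : Type) [Field E] [Algebra F E]

/-- The restriction map `Ω(F) → Ω(E)` on exterior algebras of differential forms,
induced by the inclusion `F ⊆ E`; it sends `d a` to `d a` and `x dа₁ ∧ … ∧ daₙ` to
the corresponding form over `E`. -/
def resMap : ExtOmega F →+* ExtOmega E :=
  letI : Algebra F (ExtOmega E) :=
    ((algebraMap E (ExtOmega E)).comp (algebraMap F E)).toAlgebra'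
      (fun c x => Algebra.commutes (algebraMap F E c) x)
  (ExteriorAlgebra.lift F ⟨{
      toFun := fun w =>
        ExteriorAlgebra.ι E (KaehlerDifferential.map ℤ ℤ F E w)
      map_add' := fun x y => by simp
      map_smul' := fun c x => by
        simp only [map_smul, RingHom.id_apply]
        rw [← algebraMap_smul E c (KaehlerDifferential.map ℤ ℤ F E x), map_smul,
          Algebra.smul_def, Algebra.smul_def]
        rfl },
    fun m => ExteriorAlgebra.ι_sq_zero _⟩).toRingHom

/-- The kernel `Ωⁿ(E/F)` of the restriction map `Ωⁿ(F) → Ωⁿ(E)`. -/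
def OmegaKer (n : ℕ) : Set (ExtOmega F) :=
  {ω | ω ∈ OmegaPow F n ∧ resMap F E ω = 0}

/-- The kernel `ν_n(E/F) = Ωⁿ(E/F) ∩ ν_n(F)`. -/
def nuKer (n : ℕ) : Set (ExtOmega F) :=
  OmegaKer F E n ∩ (nuPow F n : Set (ExtOmega F))

end Preamble

theorem choose_pred_prime_cast {R : Type*} [Ring R] {p : ℕ} [Fact p.Prime] [CharP R p]
    (i : ℕ) (hi : i < p) : ((p - 1).choose i : R) = (-1) ^ i := by
  have hp : p.Prime := Fact.out
  induction i with
  | zero => simp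
  | succ k ih =>
    have h1 : p.choose (k + 1) = (p - 1).choose k + (p - 1).choose (k + 1) := by
      conv_lhs => rw [show p = (p - 1) + 1 from (Nat.succ_pred_prime hp).symm]
      rw [Nat.choose_succ_succ]
    have h2 : ((p.choose (k + 1) : ℕ) : R) = 0 :=
      (CharP.cast_eq_zero_iff R p _).2 (hp.dvd_choose_self (Nat.succ_ne_zero k) hi)
    rw [h1, Nat.cast_add, ih (by omega)] at h2
    rw [pow_succ, mul_neg_one]
    exact (neg_eq_of_add_eq_zero_right h2).symm

theorem Commute.geom_sum_eq_sub_pow_pred {R : Type*} [Ring R] {p : ℕ} [Fact p.Prime] [CharP R p]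
    {x y : R} (h : Commute x y) :
    ∑ i ∈ Finset.range p, x ^ i * y ^ (p - 1 - i) = (x - y) ^ (p - 1) := by
  have hp : p.Prime := Fact.out
  rw [sub_eq_add_neg, h.neg_right.add_pow]
  rw [show p - 1 + 1 = p from Nat.succ_pred_prime hp]
  refine Finset.sum_congr rfl fun i hi => ?_
  rw [Finset.mem_range] at hi
  rw [choose_pred_prime_cast i hi, neg_pow, ((Commute.neg_one_left (y ^ (p - 1 - i))).pow_left (p - 1 - i)).eq,
    mul_assoc, mul_assoc, ← pow_add, show p - 1 - i + i = p - 1 by omega]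
  have : (-1 : R) ^ (p - 1) = 1 := by
    have := choose_pred_prime_cast (R := R) (p := p) (p - 1) (by have := hp.pos; omega)
    simpa using this.symm
  rw [this, mul_one]

open Polynomial in
theorem Polynomial.derivative_pow_noncomm {R : Type*} [Semiring R] (A : R[X]) (n : ℕ) :
    derivative (A ^ n) = ∑ i ∈ Finset.range n, A ^ i * derivative A * A ^ (n - 1 - i) := by
  induction n with
  | zero => simp
  | succ n ih =>
    rw [pow_succ, derivative_mul, ih, Finset.sum_range_succ, Finset.sum_mul]
    congr 1
    · refine Finset.sum_congr rfl fun i hi => ?_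
      rw [Finset.mem_range] at hi
      rw [mul_assoc, ← pow_succ, show n - 1 - i + 1 = n + 1 - 1 - i by omega]
    · simp

/-- Conjugation of the ring commutator by iteration: `∑ Aⁱ B A^{p-1-i} = ad(A)^{p-1} B`. -/
theorem sum_pow_mul_mul_pow {S : Type*} [Ring S] {p : ℕ} [Fact p.Prime] [CharP S p]
    (A B : S) :
    ∑ i ∈ Finset.range p, A ^ i * B * A ^ (p - 1 - i) =
      ((fun Y => A * Y - Y * A)^[p - 1]) B := by
  have hc : Commute (LinearMap.mulLeft ℤ A) (LinearMap.mulRight ℤ A) :=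
    LinearMap.commute_mulLeft_right A A
  have : CharP (Module.End ℤ S) p := by
    refine ⟨fun x => ⟨fun h => ?_, fun h => ?_⟩⟩
    · have := LinearMap.congr_fun h 1
      rw [Module.End.natCast_apply] at this
      rw [← CharP.cast_eq_zero_iff S p]
      simpa using this
    · ext y
      rw [Module.End.natCast_apply, nsmul_eq_mul, (CharP.cast_eq_zero_iff S p x).2 h]
      simp
  have key := LinearMap.congr_fun (hc.geom_sum_eq_sub_pow_pred (p := p)) B
  rw [LinearMap.sum_apply] at key
  calc _ = _ := ?_
    _ = _ := key
    _ = _ := ?_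
  · refine Finset.sum_congr rfl fun i _ => ?_
    rw [LinearMap.pow_mulLeft, LinearMap.pow_mulRight]
    simp [mul_assoc]
  · rw [Module.End.pow_apply]
    rfl

open Polynomial in
/-- Jacobson's formula for `(D + a)ᵖ` when `a` commutes with all its iterated commutators
with `D`. -/
theorem jacobson_add_pow {R : Type*} [Ring R] {p : ℕ} [Fact p.Prime] [CharP R p]
    (D a : R) (hcomm : ∀ k, Commute a ((fun y => D * y - y * D)^[k] a)) :
    (D + a) ^ p = D ^ p + a ^ p + (fun y => D * y - y * D)^[p - 1] a := by
  have hp : p.Prime := Fact.out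
  set A : R[X] := C D + X * C a with hA
  have hdA : derivative A = C a := by simp [hA, derivative_mul]
  have hiter : ∀ k, ((fun Y => A * Y - Y * A)^[k]) (C a) =
      C ((fun y => D * y - y * D)^[k] a) := by
    intro k
    induction k with
    | zero => rfl
    | succ k ih =>
      rw [Function.iterate_succ_apply', ih, Function.iterate_succ_apply']
      set y := (fun y => D * y - y * D)^[k] a
      have h1 : a * y = y * a := hcomm k
      have h2 : C y * X = X * C y := (X_mul_C y).symm
      simp only [hA, C_sub, C_mul, add_mul, mul_add]
      rw [← mul_assoc (C y) X, h2, mul_assoc, mul_assoc, ← C_mul, ← C_mul, ← C_mul, ← C_mul, h1]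
      abel
  have hder : derivative (A ^ p) = C ((fun y => D * y - y * D)^[p - 1] a) := by
    rw [derivative_pow_noncomm, hdA, sum_pow_mul_mul_pow, hiter]
  have hdeg : A.natDegree ≤ 1 := by
    refine (natDegree_add_le _ _).trans (max_le (by simp) ?_)
    rw [X_mul_C]
    exact (natDegree_C_mul_le _ _).trans natDegree_X_le
  have hdegp : (A ^ p).natDegree ≤ p := by
    simpa using natDegree_pow_le_of_le p hdeg
  have hc0 : (A ^ p).coeff 0 = D ^ p := by
    have : ∀ n : ℕ, (A ^ n).coeff 0 = D ^ n := by
      intro n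
      induction n with
      | zero => simp
      | succ n ih => rw [pow_succ, mul_coeff_zero, ih, pow_succ]; simp [hA]
    exact this p
  have hcp : (A ^ p).coeff p = a ^ p := by
    have := coeff_pow_of_natDegree_le hdeg (m := p)
    rw [mul_one] at this
    rw [this]
    congr 1
    rw [hA, X_mul_C]
    simp [coeff_C]
  have hc1 : (A ^ p).coeff 1 = (fun y => D * y - y * D)^[p - 1] a := by
    have := congrArg (fun q => coeff q 0) hder
    simpa [coeff_derivative] using this
  have hci : ∀ n, 2 ≤ n → n < p → (A ^ p).coeff n = 0 := by
    intro n h2 hn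
    have := congrArg (fun q => coeff q (n - 1)) hder
    simp only [coeff_derivative, coeff_C, show n - 1 ≠ 0 by omega, if_false,
      show n - 1 + 1 = n by omega] at this
    have hn' : ((n - 1 : ℕ) : R) + 1 = (n : R) := by
      rw [← Nat.cast_succ]; congr 1; omega
    rw [hn'] at this
    have hcop : Nat.Coprime n p := (Nat.coprime_of_lt_prime (by omega) hn hp).symm
    have hu : IsUnit ((n : ℕ) : R) := by
      obtain ⟨m, hm⟩ := (Nat.isCoprime_iff_coprime.2 hcop)
      obtain ⟨t, ht⟩ := hm
      refine ⟨⟨n, (m : R), ?_, ?_⟩, rfl⟩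
      · have := congrArg (Int.cast : ℤ → R) ht
        push_cast at this
        rw [CharP.cast_eq_zero R p, mul_zero, add_zero] at this
        rw [← this, Nat.cast_commute]
      · have := congrArg (Int.cast : ℤ → R) ht
        push_cast at this
        rwa [CharP.cast_eq_zero R p, mul_zero, add_zero] at this
    exact (IsUnit.mul_left_eq_zero hu).1 this
  have hev : (A ^ p).eval₂ (RingHom.id R) 1 = (D + a) ^ p := by
    have := map_pow (eval₂RingHom' (RingHom.id R) 1 (fun _ => Commute.one_right _)) A p
    refine this.trans ?_
    congr 1
    rw [map_add, map_mul]
    simp [eval₂RingHom']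
  rw [← hev, eval₂_eq_sum_range' _ (n := p + 1) (by omega)]
  rw [Finset.sum_range_succ]
  obtain ⟨q, rfl⟩ : ∃ q, p = q + 2 := ⟨p - 2, by have := hp.two_le; omega⟩
  rw [Finset.sum_range_succ', Finset.sum_range_succ', Finset.sum_eq_zero]
  · simp only [RingHom.id_apply, one_pow, mul_one, zero_add, hc0, hcp, hc1]
    abel
  · intro i hi
    rw [Finset.mem_range] at hi
    rw [hci _ (by omega) (by omega)]
    simp

theorem Module.End.charP_int (S : Type*) [Ring S] (p : ℕ) [CharP S p] :
    CharP (Module.End ℤ S) p := by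
  refine ⟨fun x => ⟨fun h => ?_, fun h => ?_⟩⟩
  · have := LinearMap.congr_fun h 1
    rw [Module.End.natCast_apply] at this
    rw [← CharP.cast_eq_zero_iff S p]
    simpa using this
  · ext y
    rw [Module.End.natCast_apply, nsmul_eq_mul, (CharP.cast_eq_zero_iff S p x).2 h]
    simp

section Toral

variable {L : Type*} [Field L] {p : ℕ} [Fact p.Prime] [CharP L p]

theorem iterate_commutator_mulLeft (D : Derivation ℤ L L) (a : L) (k : ℕ) :
    (fun y : Module.End ℤ L => (D : L →ₗ[ℤ] L) * y - y * (D : L →ₗ[ℤ] L))^[k]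
      (LinearMap.mulLeft ℤ a) = LinearMap.mulLeft ℤ (D^[k] a) := by
  induction k with
  | zero => rfl
  | succ k ih =>
    rw [Function.iterate_succ_apply', ih, Function.iterate_succ_apply']
    ext x
    simp
    ring

theorem Derivation.add_mulLeft_pow (D : Derivation ℤ L L) (hD : ∀ x, D^[p] x = D x) (a : L) :
    ((D : L →ₗ[ℤ] L) + LinearMap.mulLeft ℤ a : Module.End ℤ L) ^ p =
      (D : L →ₗ[ℤ] L) + LinearMap.mulLeft ℤ (a ^ p + D^[p - 1] a) := by
  have := Module.End.charP_int L p
  have hDp : ((D : L →ₗ[ℤ] L) : Module.End ℤ L) ^ p = (D : L →ₗ[ℤ] L) := by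
    ext x
    rw [Module.End.pow_apply]
    exact hD x
  have hj := jacobson_add_pow (R := Module.End ℤ L) (p := p) (D : L →ₗ[ℤ] L)
    (LinearMap.mulLeft ℤ a) (fun k => by
      rw [iterate_commutator_mulLeft]
      ext x
      simp
      ring)
  rw [iterate_commutator_mulLeft, hDp, LinearMap.pow_mulLeft] at hj
  rw [hj]
  ext x
  simp
  ring

theorem Derivation.logDeriv_eq (D : Derivation ℤ L L) (hD : ∀ x, D^[p] x = D x) (x : L)
    (hx : x ≠ 0) : D x / x = (D x / x) ^ p + D^[p - 1] (D x / x) := by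
  have h := LinearMap.congr_fun (D.add_mulLeft_pow hD (D x / x)) 1
  have hit : ∀ n (y : L), (((D : L →ₗ[ℤ] L) + LinearMap.mulLeft ℤ (D x / x) :
      Module.End ℤ L) ^ n) y = x⁻¹ * D^[n] (x * y) := by
    intro n
    induction n with
    | zero => intro y; simp [hx]
    | succ n ih =>
      intro y
      rw [pow_succ, Module.End.mul_apply, ih, Function.iterate_succ_apply]
      congr 2
      simp
      field_simp
  rw [hit] at h
  simp [hD] at h
  rw [← h]
  field_simp

open Polynomial in
theorem prod_X_sub_C_zmod : ∏ a : ZMod p, (X - C a) = (X ^ p - X : (ZMod p)[X]) := by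
  have hp : 1 < p := (Fact.out : p.Prime).one_lt
  have h := FiniteField.roots_X_pow_card_sub_X (ZMod p)
  rw [ZMod.card] at h
  have hm : (X ^ p - X : (ZMod p)[X]).Monic :=
    monic_X_pow_sub (by rw [degree_X]; exact_mod_cast hp)
  have := prod_multiset_X_sub_C_of_monic_of_roots_card_eq hm (by
    rw [h, FiniteField.X_pow_card_sub_X_natDegree_eq _ hp]
    simp)
  rw [h] at this
  exact this

/-- If `D` is a derivation with `Dᵖ = D` and `a` satisfies `D^{p-1} a = a - aᵖ`, then `a` is a
logarithmic derivative. -/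
theorem Derivation.exists_logDeriv_eq (D : Derivation ℤ L L) (hD : ∀ x, D^[p] x = D x)
    (C : Subfield L) (hC : ∀ x ∈ C, D x ∈ C) (b : L) (hb : b ≠ 0) (hbC : b ∈ C) (hDb : D b = b)
    (a : L) (ha : a ∈ C) (hDa : D^[p - 1] a = a - a ^ p) :
    ∃ c ∈ C, c ≠ 0 ∧ D c = a * c := by
  have := Module.End.charP_int L p
  have hp : p.Prime := Fact.out
  let _ : Algebra (ZMod p) (Module.End ℤ L) := ZMod.algebra _ p
  set T : Module.End ℤ L := (D : L →ₗ[ℤ] L) + LinearMap.mulLeft ℤ (-a) with hT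
  have hTa : ∀ y, T y = D y - a * y := fun y => by simp [hT, sub_eq_add_neg]
  have hTC : ∀ y ∈ C, T y ∈ C := fun y hy => by
    rw [hTa]; exact sub_mem (hC y hy) (mul_mem ha hy)
  have hTp : T ^ p = T := by
    rw [hT, D.add_mulLeft_pow hD]
    congr 2
    have h1 : (-a) ^ p = - a ^ p := by
      have := sub_pow_char (p := p) 0 a
      simpa [zero_pow hp.ne_zero] using this
    have h2 : D^[p - 1] (-a) = - D^[p - 1] a := by
      have : ∀ n, D^[n] (-a) = - D^[n] a := by
        intro n
        induction n with
        | zero => rfl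
        | succ n ih => rw [Function.iterate_succ_apply', ih, map_neg, Function.iterate_succ_apply']
      exact this _
    rw [h1, h2, hDa]
    ring
  have halg : ∀ (v : ZMod p) (y : L), (algebraMap (ZMod p) (Module.End ℤ L) v) y
      = (v.val : L) * y := by
    intro v y
    have : algebraMap (ZMod p) (Module.End ℤ L) v = ((v.val : ℕ) : Module.End ℤ L) := by
      conv_lhs => rw [← ZMod.natCast_zmod_val v]
      rw [_root_.map_natCast]
    rw [this, Module.End.natCast_apply, nsmul_eq_mul]
  have key : ∀ (s : Finset (ZMod p)) (y : L), y ∈ C → y ≠ 0 →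
      (Polynomial.aeval T (∏ v ∈ s, (Polynomial.X - Polynomial.C v))) y = 0 →
      ∃ v : ZMod p, ∃ z ∈ C, z ≠ 0 ∧ T z = (v.val : L) * z := by
    intro s
    induction s using Finset.induction_on with
    | empty => intro y _ hy h; simp at h; exact absurd h hy
    | insert v s hv ih =>
      intro y hyC hy h
      rw [Finset.prod_insert hv, mul_comm, map_mul, Module.End.mul_apply] at h
      have he : (Polynomial.aeval T (Polynomial.X - Polynomial.C v)) y = T y - (v.val : L) * y := by
        rw [map_sub, Polynomial.aeval_X, Polynomial.aeval_C, LinearMap.sub_apply, halg]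
      rw [he] at h
      by_cases h0 : T y - (v.val : L) * y = 0
      · exact ⟨v, y, hyC, hy, sub_eq_zero.1 h0⟩
      · exact ih _ (sub_mem (hTC y hyC) (mul_mem (natCast_mem C _) hyC)) h0 h
  obtain ⟨v, z, hzC, hz, hTz⟩ := key Finset.univ 1 (one_mem _) one_ne_zero (by
    rw [prod_X_sub_C_zmod, map_sub, map_pow, Polynomial.aeval_X, hTp, sub_self,
      LinearMap.zero_apply])
  have hDz : D z = (a + v.val) * z := by
    rw [hTa] at hTz
    linear_combination hTz
  refine ⟨z * b ^ (p - v.val), mul_mem hzC (pow_mem hbC _), mul_ne_zero hz (pow_ne_zero _ hb), ?_⟩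
  have hv : v.val < p := ZMod.val_lt v
  have hDbn : ∀ n : ℕ, D (b ^ n) = n * b ^ n := by
    intro n
    rw [D.leibniz_pow, hDb]
    rcases n with _ | n
    · simp
    · simp [pow_succ]
  rw [D.leibniz, hDz, hDbn, Nat.cast_sub hv.le, CharP.cast_eq_zero]
  simp only [smul_eq_mul]
  ring

end Toral

/-- A family of commuting derivations `D₀, …, D_{N-1}` with `Dᵢᵖ = Dᵢ`, together with
dual eigenvectors `bᵢ`; it models the operators `bᵢ ∂/∂bᵢ` attached to a finite `p`-basis. -/
structure IsToral {L : Type*} [Field L] (p N : ℕ) (D : ℕ → Derivation ℤ L L) (b : ℕ → L) :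
    Prop where
  comm : ∀ i j x, D i (D j x) = D j (D i x)
  iterate : ∀ i x, (D i)^[p] x = D i x
  zero : ∀ i, N ≤ i → ∀ x, D i x = 0
  ne_zero : ∀ i, i < N → b i ≠ 0
  self : ∀ i, i < N → D i (b i) = b i
  other : ∀ i j, i ≠ j → j < N → D i (b j) = 0

section

variable {L : Type*} [Field L]

/-- The field of common constants of the derivations `Dᵢ` with `i ≥ k`. -/
def constField (D : ℕ → Derivation ℤ L L) (k : ℕ) : Subfield L where
  carrier := {x | ∀ i, k ≤ i → D i x = 0}
  mul_mem' := fun ha hb i hi => by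
    rw [(D i).leibniz, ha i hi, hb i hi, smul_zero, smul_zero, add_zero]
  one_mem' := fun i _ => (D i).map_one_eq_zero
  add_mem' := fun ha hb i hi => by rw [map_add, ha i hi, hb i hi, add_zero]
  zero_mem' := fun i _ => map_zero _
  neg_mem' := fun ha i hi => by rw [map_neg, ha i hi, neg_zero]
  inv_mem' := fun x hx i hi => by rw [(D i).leibniz_inv, hx i hi, smul_zero]

theorem constField_mono (D : ℕ → Derivation ℤ L L) {k l : ℕ} (h : k ≤ l) :
    constField D k ≤ constField D l := fun _ hx i hi => hx i (h.trans hi)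

/-- The operator `1 - D_i^{p-1}`. -/
def toralP (p : ℕ) (D : ℕ → Derivation ℤ L L) (i : ℕ) : Module.End ℤ L :=
  1 - (D i : L →ₗ[ℤ] L) ^ (p - 1)

/-- The product of the operators `toralP` over the `j` largest indices below `N`. -/
def toralQAux (p N : ℕ) (D : ℕ → Derivation ℤ L L) : ℕ → Module.End ℤ L
  | 0 => 1
  | j + 1 => toralP p D (N - (j + 1)) * toralQAux p N D j

/-- The product of the operators `1 - D_i^{p-1}` over `k ≤ i < N`: the projection onto
the constants of `D_i`, `i ≥ k`. -/
def toralQ (p N : ℕ) (D : ℕ → Derivation ℤ L L) (k : ℕ) : Module.End ℤ L :=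
  toralQAux p N D (N - k)

theorem decreasing_induction_of_ge {φ : ℕ → Prop} (N : ℕ) (h0 : ∀ k, N ≤ k → φ k)
    (h1 : ∀ k, k < N → φ (k + 1) → φ k) (k : ℕ) : φ k := by
  induction h : N - k generalizing k with
  | zero => exact h0 k (by omega)
  | succ n ih => exact h1 k (by omega) (ih (k + 1) (by omega))

theorem toralP_apply (p : ℕ) (D : ℕ → Derivation ℤ L L) (i : ℕ) (x : L) :
    toralP p D i x = x - (D i)^[p - 1] x := by
  rw [toralP, LinearMap.sub_apply, Module.End.pow_apply]
  rfl

theorem toralQ_of_le (p N : ℕ) (D : ℕ → Derivation ℤ L L) {k : ℕ} (h : N ≤ k) (x : L) :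
    toralQ p N D k x = x := by
  rw [toralQ, Nat.sub_eq_zero_of_le h]
  rfl

theorem toralQ_succ (p N : ℕ) (D : ℕ → Derivation ℤ L L) {k : ℕ} (h : k < N) (x : L) :
    toralQ p N D k x = toralP p D k (toralQ p N D (k + 1) x) := by
  rw [toralQ, toralQ, show N - k = N - (k + 1) + 1 by omega, toralQAux,
    show N - (N - (k + 1) + 1) = k by omega]
  rfl

theorem derivation_iterate_const_mul (D : Derivation ℤ L L) {c : L} (hc : D c = 0) (n : ℕ)
    (x : L) : D^[n] (c * x) = c * D^[n] x := by
  induction n with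
  | zero => rfl
  | succ n ih =>
    rw [Function.iterate_succ_apply', ih, D.leibniz, hc, smul_zero, add_zero,
      Function.iterate_succ_apply', smul_eq_mul]

theorem toralP_const_mul (p : ℕ) (D : ℕ → Derivation ℤ L L) (k : ℕ) {c : L} (hc : D k c = 0)
    (x : L) : toralP p D k (c * x) = c * toralP p D k x := by
  rw [toralP_apply, toralP_apply, derivation_iterate_const_mul _ hc, mul_sub]

theorem toralQ_const_mul (p N : ℕ) (D : ℕ → Derivation ℤ L L) (k : ℕ) {c : L}
    (hc : c ∈ constField D 0) (x : L) : toralQ p N D k (c * x) = c * toralQ p N D k x := by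
  induction k using decreasing_induction_of_ge N with
  | h0 k hk => rw [toralQ_of_le _ _ _ hk, toralQ_of_le _ _ _ hk]
  | h1 k hk ih =>
    rw [toralQ_succ _ _ _ hk, ih, toralP_const_mul _ _ _ (hc k (Nat.zero_le _)),
      toralQ_succ _ _ _ hk]

variable {p : ℕ} [Fact p.Prime]

theorem derivation_iterate_of_const (D : Derivation ℤ L L) {x : L} (hx : D x = 0) :
    D^[p - 1] x = 0 := by
  have hp : p - 1 = p - 2 + 1 := by have := (Fact.out : p.Prime).two_le; omega
  rw [hp, Function.iterate_succ_apply, hx]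
  exact iterate_map_zero D _

theorem toralQ_of_mem (N : ℕ) (D : ℕ → Derivation ℤ L L) {k : ℕ} {x : L}
    (hx : x ∈ constField D k) : toralQ p N D k x = x := by
  induction k using decreasing_induction_of_ge N with
  | h0 k hk => rw [toralQ_of_le _ _ _ hk]
  | h1 k hk ih =>
    rw [toralQ_succ _ _ _ hk, ih (constField_mono D (Nat.le_succ k) hx), toralP_apply,
      derivation_iterate_of_const _ (hx k le_rfl), sub_zero]

end

namespace IsToral

variable {L : Type*} [Field L] {p N : ℕ} [Fact p.Prime]
  {D : ℕ → Derivation ℤ L L} {b : ℕ → L} (h : IsToral p N D b)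

include h

omit [Fact p.Prime] in
theorem comm_iterate (i j n : ℕ) (x : L) : D i ((D j)^[n] x) = (D j)^[n] (D i x) := by
  induction n generalizing x with
  | zero => rfl
  | succ n ih => rw [Function.iterate_succ_apply, ih, h.comm, Function.iterate_succ_apply]

omit [Fact p.Prime] in
theorem comm_P (i k : ℕ) (x : L) : D i (toralP p D k x) = toralP p D k (D i x) := by
  rw [toralP_apply, toralP_apply, map_sub, h.comm_iterate]

omit [Fact p.Prime] in
theorem comm_Q (i k : ℕ) (x : L) : D i (toralQ p N D k x) = toralQ p N D k (D i x) := by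
  induction k using decreasing_induction_of_ge N with
  | h0 k hk => rw [toralQ_of_le _ _ _ hk, toralQ_of_le _ _ _ hk]
  | h1 k hk ih => rw [toralQ_succ _ _ _ hk, h.comm_P, ih, toralQ_succ _ _ _ hk]

theorem P_apply_D (k : ℕ) (x : L) : toralP p D k (D k x) = 0 := by
  have hp : p - 1 + 1 = p := Nat.succ_pred_prime Fact.out
  rw [toralP_apply, ← Function.iterate_succ_apply, Nat.succ_eq_add_one, hp, h.iterate, sub_self]

theorem Q_apply_D {i k : ℕ} (hik : k ≤ i) (x : L) : toralQ p N D k (D i x) = 0 := by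
  induction k using decreasing_induction_of_ge N with
  | h0 k hk => rw [h.zero i (hk.trans hik), map_zero]
  | h1 k hk ih =>
    rw [toralQ_succ _ _ _ hk]
    rcases eq_or_lt_of_le hik with rfl | hlt
    · rw [← h.comm_Q, h.P_apply_D]
    · rw [ih hlt, map_zero]

theorem Q_apply_P {i k : ℕ} (hik : k ≤ i) (x : L) :
    toralQ p N D k (toralP p D i x) = toralQ p N D k x := by
  have hp : p - 1 = p - 2 + 1 := by have := (Fact.out : p.Prime).two_le; omega
  rw [toralP_apply, map_sub, hp, Function.iterate_succ_apply', h.Q_apply_D hik, sub_zero]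

theorem P_mem (k : ℕ) {x : L} (hx : x ∈ constField D (k + 1)) :
    toralP p D k x ∈ constField D k := by
  intro i hi
  rw [h.comm_P]
  rcases eq_or_lt_of_le hi with rfl | hlt
  · exact h.P_apply_D _ _
  · rw [hx i hlt, map_zero]

omit [Fact p.Prime] in
theorem D_mem (i : ℕ) {k : ℕ} {x : L} (hx : x ∈ constField D k) : D i x ∈ constField D k := by
  intro j hj
  rw [h.comm, hx j hj, map_zero]

omit [Fact p.Prime] h in
theorem pow_mem_const [CharP L p] (x : L) (k : ℕ) : x ^ p ∈ constField D k := by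
  intro i _
  rw [(D i).leibniz_pow, nsmul_eq_mul, CharP.cast_eq_zero, zero_mul]

omit h in
theorem root_mem [CharP L p] {k : ℕ} {x : L} (hx : x ^ (p - 1) ∈ constField D k) :
    x ∈ constField D k := by
  have hp : p - 1 + 1 = p := Nat.succ_pred_prime Fact.out
  by_cases h0 : x = 0
  · rw [h0]; exact zero_mem _
  have : x = x ^ p / x ^ (p - 1) := by
    rw [eq_div_iff (pow_ne_zero _ h0), ← pow_succ', hp]
  rw [this]
  exact div_mem (pow_mem_const x k) hx

/-- The arithmetic heart of Kato's argument: a coefficient satisfying the closedness and Cartier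
conditions is an integer multiple of a product of logarithmic derivatives. -/
theorem exists_prod_logDeriv [CharP L p] (hroot : ∀ x : L, ∃ y : L, y ^ (p - 1) = x)
    (I : Finset ℕ) (k : ℕ) (hk : k ≤ N) (a : L) (ha : a ∈ constField D k)
    (hI : ∀ i < k, i ∉ I → D i (toralQ p N D (i + 1) a) = 0)
    (hQ : toralQ p N D 0 a = a ^ p) :
    ∃ (c : ℕ → L) (m : ℕ), (∀ i, c i ≠ 0 ∧ c i ∈ constField D (i + 1)) ∧
      a = m * ∏ i ∈ I.filter (· < k), D i (c i) / c i := by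
  induction k generalizing a with
  | zero =>
    rw [toralQ_of_mem N D ha] at hQ
    have hbot : a ∈ (⊥ : Subfield L) := (Subfield.mem_bot_iff_pow_eq_self L p).2 hQ.symm
    obtain ⟨m, hm⟩ : ∃ m : ℕ, a = m := by
      rw [← ZMod.fieldRange_castHom_eq_bot p] at hbot
      obtain ⟨v, rfl⟩ := hbot
      refine ⟨v.val, ?_⟩
      rw [ZMod.castHom_apply, ZMod.natCast_val]
    exact ⟨fun _ => 1, m, fun i => ⟨one_ne_zero, one_mem _⟩, by simp [hm]⟩
  | succ k ih =>
    have hkN : k < N := hk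
    by_cases hkI : k ∈ I
    · by_cases ha0 : a = 0
      · exact ⟨fun _ => 1, 0, fun i => ⟨one_ne_zero, one_mem _⟩, by simp [ha0]⟩
      set a' := toralP p D k a with ha'
      have ha'k : a' ∈ constField D k := h.P_mem k ha
      have hQa' : toralQ p N D 0 a' = a ^ p := by rw [h.Q_apply_P (Nat.zero_le _), hQ]
      have ha'0 : a' ≠ 0 := by
        intro h0
        rw [h0, map_zero] at hQa'
        exact pow_ne_zero _ ha0 hQa'.symm
      obtain ⟨u, hu⟩ := hroot (a' / a ^ p)
      have huk : u ∈ constField D k := root_mem (by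
        rw [hu]; exact div_mem ha'k (pow_mem_const a k))
      have hp : p - 1 + 1 = p := Nat.succ_pred_prime Fact.out
      have hp1 : p - 1 ≠ 0 := by have := (Fact.out : p.Prime).two_le; omega
      have hap : a ^ p ≠ 0 := pow_ne_zero _ ha0
      have hu0 : u ≠ 0 := by
        rintro rfl
        rw [zero_pow hp1] at hu
        exact div_ne_zero ha'0 hap hu.symm
      have hup : u ^ p * a ^ p = u * a' := by
        rw [← hp, pow_succ' u, hu, hp]
        field_simp
      have hPau : toralP p D k (u * a) = (u * a) ^ p := by
        rw [toralP_const_mul _ _ _ (huk k le_rfl), mul_pow, hup]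
      obtain ⟨c, hcC, hc0, hDc⟩ := (D k).exists_logDeriv_eq (h.iterate k) (constField D (k + 1))
        (fun x hx => h.D_mem k hx) (b k) (h.ne_zero k hkN)
        (fun i hi => h.other i k (by omega) hkN) (h.self k hkN) (u * a)
        (mul_mem (constField_mono D (Nat.le_succ k) huk) ha) (by
          rw [← hPau, toralP_apply, sub_sub_cancel])
      have hs : u⁻¹ = (u⁻¹ / a) ^ p * a' := by
        rw [div_pow, inv_pow]
        have : u ^ p ≠ 0 := pow_ne_zero _ hu0
        field_simp
        linear_combination hup
      have hconst : (u⁻¹ / a) ^ p ∈ constField D 0 := pow_mem_const _ 0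
      obtain ⟨c', m, hc', hm⟩ := ih hkN.le u⁻¹ (inv_mem huk) (by
          intro i hi hiI
          rw [hs, toralQ_const_mul _ _ _ _ hconst, (D i).leibniz, hconst i (Nat.zero_le _),
            h.Q_apply_P hi, hI i (by omega) hiI, smul_zero, smul_zero, add_zero])
        (by
          conv_lhs => rw [hs, toralQ_const_mul _ _ _ _ hconst, hQa']
          rw [div_pow]
          field_simp)
      refine ⟨Function.update c' k c, m, ?_, ?_⟩
      · intro i
        by_cases hik : i = k
        · subst hik
          simpa using ⟨hc0, hcC⟩
        · simpa [Function.update_of_ne hik] using hc' i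
      · have hfil : I.filter (· < k + 1) = insert k (I.filter (· < k)) := by
          ext i
          simp only [Finset.mem_filter, Finset.mem_insert]
          constructor
          · rintro ⟨h1, h2⟩
            by_cases hik : i = k
            · exact Or.inl hik
            · exact Or.inr ⟨h1, by omega⟩
          · rintro (rfl | ⟨h1, h2⟩)
            · exact ⟨hkI, by omega⟩
            · exact ⟨h1, by omega⟩
        rw [hfil, Finset.prod_insert (by simp)]
        have hcongr : ∏ i ∈ I.filter (· < k), D i (Function.update c' k c i) /
            Function.update c' k c i = ∏ i ∈ I.filter (· < k), D i (c' i) / c' i := by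
          refine Finset.prod_congr rfl fun i hi => ?_
          have hik : i ≠ k := by
            have := (Finset.mem_filter.1 hi).2
            omega
          rw [Function.update_of_ne hik]
        rw [hcongr, Function.update_self, hDc, mul_div_assoc, div_self hc0, mul_one,
          mul_left_comm, ← hm]
        field_simp
    · have hak : a ∈ constField D k := by
        intro i hi
        rcases eq_or_lt_of_le hi with rfl | hlt
        · have := hI k (Nat.lt_succ_self k) hkI
          rwa [toralQ_of_mem N D ha] at this
        · exact ha i hlt
      obtain ⟨c, m, hc, hm⟩ := ih hkN.le a hak (fun i hi => hI i (by omega)) hQ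
      refine ⟨c, m, hc, ?_⟩
      have hfil : I.filter (· < k + 1) = I.filter (· < k) := by
        ext i
        simp only [Finset.mem_filter]
        constructor
        · rintro ⟨h1, h2⟩
          have : i ≠ k := fun e => hkI (e ▸ h1)
          exact ⟨h1, by omega⟩
        · rintro ⟨h1, h2⟩
          exact ⟨h1, by omega⟩
      rw [hfil, hm]

end IsToral

section

/-- The sign of the position of `i` in the finite set `J`. -/
def posSign (i : ℕ) (J : Finset ℕ) : ℤ := (-1) ^ (J.filter (· < i)).card

theorem posSign_mul_of_lt {J : Finset ℕ} {i j : ℕ} (hi : i ∈ J) (hij : i < j) :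
    posSign j J = - posSign j (J.erase i) ∧ posSign i (J.erase j) = posSign i J := by
  constructor
  · have : (J.filter (· < j)).card = ((J.erase i).filter (· < j)).card + 1 := by
      rw [Finset.filter_erase, Finset.card_erase_add_one]
      exact Finset.mem_filter.2 ⟨hi, hij⟩
    rw [posSign, posSign, this, pow_succ, mul_neg_one]
  · rw [posSign, posSign, Finset.filter_erase, Finset.erase_eq_of_notMem]
    simp [hij.le]

theorem posSign_mul_swap {J : Finset ℕ} {i j : ℕ} (hi : i ∈ J) (hj : j ∈ J) (hij : i ≠ j) :
    posSign i J * posSign j (J.erase i) = -(posSign j J * posSign i (J.erase j)) := by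
  rcases hij.lt_or_gt with h | h
  · obtain ⟨h1, h2⟩ := posSign_mul_of_lt hi h
    rw [h1, h2]; ring
  · obtain ⟨h1, h2⟩ := posSign_mul_of_lt hj h
    rw [h1, h2]; ring

theorem sum_posSign_symm {M : Type*} [AddCommGroup M] (J : Finset ℕ) (c : ℕ → ℕ → M)
    (hc : ∀ i j, i ∈ J → j ∈ J → c i j = c j i) :
    ∑ i ∈ J, ∑ j ∈ J.erase i, (posSign i J * posSign j (J.erase i)) • c i j = 0 := by
  rw [Finset.sum_sigma']
  refine Finset.sum_involution (fun a _ => ⟨a.2, a.1⟩) ?_ ?_ ?_ ?_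
  · rintro ⟨i, j⟩ ha
    simp only [Finset.mem_sigma, Finset.mem_erase] at ha
    rw [posSign_mul_swap ha.1 ha.2.2 (Ne.symm ha.2.1), hc i j ha.1 ha.2.2, neg_smul,
      neg_add_cancel]
  · rintro ⟨i, j⟩ ha _ h
    simp only [Finset.mem_sigma, Finset.mem_erase] at ha
    simp only [Sigma.mk.injEq] at h
    exact ha.2.1 h.1
  · rintro ⟨i, j⟩ ha
    simp only [Finset.mem_sigma, Finset.mem_erase] at ha ⊢
    exact ⟨ha.2.2, Ne.symm ha.2.1, ha.1⟩
  · rintro ⟨i, j⟩ _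
    rfl

variable {R M : Type*} [CommRing R] [AddCommGroup M] [Module R M]

/-- The alternating operator on families indexed by finite sets of indices given by
operators `Aᵢ`: the coordinate form of `η ↦ ∑ᵢ eᵢ ∧ Aᵢ η`. -/
def altOp (A : ℕ → M →ₗ[R] M) : (Finset ℕ → M) →ₗ[R] (Finset ℕ → M) :=
  LinearMap.pi fun J => ∑ i ∈ J, posSign i J • (A i ∘ₗ LinearMap.proj (J.erase i))

theorem altOp_apply (A : ℕ → M →ₗ[R] M) (η : Finset ℕ → M) (J : Finset ℕ) :
    altOp A η J = ∑ i ∈ J, posSign i J • A i (η (J.erase i)) := by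
  simp [altOp]

theorem altOp_altOp_apply {S : Type*} [CommRing S] [Module S M] (A : ℕ → M →ₗ[R] M)
    (B : ℕ → M →ₗ[S] M) (η : Finset ℕ → M) (J : Finset ℕ) :
    altOp A (altOp B η) J = ∑ i ∈ J, ∑ j ∈ J.erase i,
      (posSign i J * posSign j (J.erase i)) • A i (B j (η ((J.erase i).erase j))) := by
  simp only [altOp_apply, map_sum, map_zsmul, Finset.smul_sum, mul_smul]

theorem altOp_add_altOp_eq_zero {S : Type*} [CommRing S] [Module S M] (A : ℕ → M →ₗ[R] M)
    (B C : ℕ → M →ₗ[S] M) (E : ℕ → M →ₗ[R] M)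
    (hc : ∀ i j x, A i (B j x) + C i (E j x) = A j (B i x) + C j (E i x)) (η : Finset ℕ → M) :
    altOp A (altOp B η) + altOp C (altOp E η) = 0 := by
  ext J
  rw [Pi.add_apply, altOp_altOp_apply, altOp_altOp_apply, ← Finset.sum_add_distrib]
  simp only [← Finset.sum_add_distrib, ← smul_add]
  exact sum_posSign_symm J
    (fun i j => A i (B j (η ((J.erase i).erase j))) + C i (E j (η ((J.erase i).erase j))))
    (fun i j _ _ => by rw [hc, Finset.erase_right_comm])

end

section

variable {L : Type*} [CommRing L]

/-- Exterior multiplication by the form `∑ᵢ θᵢ eᵢ`, in coordinates. -/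
def wdg (θ : ℕ → L) : (Finset ℕ → L) →ₗ[L] (Finset ℕ → L) :=
  altOp fun i => LinearMap.mulLeft L (θ i)

theorem wdg_apply (θ : ℕ → L) (η : Finset ℕ → L) (J : Finset ℕ) :
    wdg θ η J = ∑ i ∈ J, posSign i J • (θ i * η (J.erase i)) := by
  simp [wdg, altOp_apply]

theorem wdg_wdg_self (θ : ℕ → L) (η : Finset ℕ → L) : wdg θ (wdg θ η) = 0 := by
  have h := altOp_add_altOp_eq_zero (fun i => LinearMap.mulLeft L (θ i))
    (fun i => LinearMap.mulLeft L (θ i)) 0 0 (fun i j x => by simp; ring) η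
  have h0 : altOp (0 : ℕ → L →ₗ[L] L) (altOp (0 : ℕ → L →ₗ[L] L) η) = 0 := by
    ext J; simp [altOp_apply]
  rwa [h0, add_zero] at h

/-- The coordinate form of the constant form `1`. -/
def oneForm (L : Type*) [CommRing L] : Finset ℕ → L := Pi.single ∅ 1

/-- The coordinate form of the exterior derivative, for commuting derivations `Dᵢ`. -/
def dd (D : ℕ → Derivation ℤ L L) : (Finset ℕ → L) →ₗ[ℤ] (Finset ℕ → L) :=
  altOp fun i => (D i : L →ₗ[ℤ] L)

theorem dd_apply (D : ℕ → Derivation ℤ L L) (η : Finset ℕ → L) (J : Finset ℕ) :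
    dd D η J = ∑ i ∈ J, posSign i J • D i (η (J.erase i)) := by
  simp [dd, altOp_apply]

theorem dd_wdg (D : ℕ → Derivation ℤ L L) (θ : ℕ → L) (hθ : ∀ i j, D i (θ j) = D j (θ i))
    (η : Finset ℕ → L) : dd D (wdg θ η) = - wdg θ (dd D η) := by
  refine eq_neg_of_add_eq_zero_left (altOp_add_altOp_eq_zero _ _ _ _ (fun i j x => ?_) η)
  simp only [LinearMap.mulLeft_apply, Derivation.coeFn_coe, Derivation.leibniz, hθ i j,
    smul_eq_mul]
  ring

end

section

variable {L : Type*} [Field L]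

/-- The coordinates of the logarithmic form `dx/x`. -/
def dl (D : ℕ → Derivation ℤ L L) (x : L) (i : ℕ) : L := D i x / x

/-- The coordinates of the logarithmic form `dx₁/x₁ ∧ … ∧ dxₙ/xₙ`. -/
def logCoord (D : ℕ → Derivation ℤ L L) (l : List L) : Finset ℕ → L :=
  l.foldr (fun x η => wdg (dl D x) η) (oneForm L)

theorem logCoord_nil (D : ℕ → Derivation ℤ L L) : logCoord D [] = oneForm L := rfl

theorem logCoord_cons (D : ℕ → Derivation ℤ L L) (x : L) (l : List L) :
    logCoord D (x :: l) = wdg (dl D x) (logCoord D l) := rfl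

/-- The closed coordinate forms fixed by the Cartier operator. -/
def cartierFixed (p N : ℕ) [Fact p.Prime] [CharP L p] (D : ℕ → Derivation ℤ L L) :
    AddSubgroup (Finset ℕ → L) where
  carrier := {η | dd D η = 0 ∧ ∀ J, toralQ p N D 0 (η J) = frobenius L p (η J)}
  add_mem' := fun ha hb => ⟨by rw [map_add, ha.1, hb.1, add_zero], fun J => by
    rw [Pi.add_apply, map_add, map_add, ha.2, hb.2]⟩
  zero_mem' := ⟨map_zero _, fun J => by rw [Pi.zero_apply, map_zero, map_zero]⟩
  neg_mem' := fun ha => ⟨by rw [map_neg, ha.1, neg_zero], fun J => by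
    rw [Pi.neg_apply, map_neg, map_neg, ha.2]⟩

namespace IsToral

variable {p N : ℕ} [Fact p.Prime] [CharP L p]
  {D : ℕ → Derivation ℤ L L} {b : ℕ → L}

omit [Fact p.Prime] [CharP L p] in
theorem D_dl (h : IsToral p N D b) (x : L) (i j : ℕ) : D i (dl D x j) = D j (dl D x i) := by
  rw [dl, dl, div_eq_mul_inv, div_eq_mul_inv, (D i).leibniz, (D j).leibniz,
    (D i).leibniz_inv, (D j).leibniz_inv, h.comm i j]
  simp only [smul_eq_mul]
  ring

theorem toralQ_dl (h : IsToral p N D b) {x : L} (hx : x ≠ 0) (k : ℕ) :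
    toralQ p N D 0 (dl D x k) = dl D x k ^ p := by
  have h1 : toralP p D k (dl D x k) = dl D x k ^ p := by
    rw [toralP_apply, dl, sub_eq_iff_eq_add]
    exact (D k).logDeriv_eq (h.iterate k) x hx
  rw [← h.Q_apply_P (Nat.zero_le k), h1, toralQ_of_mem N D (pow_mem_const _ 0)]

theorem exists_dl_eq (h : IsToral p N D b) {x : L} (hx : x ≠ 0) :
    ∃ f : L, ∀ k, dl D x k = D k f + dl D x k ^ p := by
  refine ⟨∑ i ∈ Finset.range N, (D i)^[p - 2] (toralQ p N D (i + 1) (dl D x i)), fun k => ?_⟩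
  have hp := (Fact.out : p.Prime).two_le
  have hterm : ∀ i ∈ Finset.range N, D k ((D i)^[p - 2] (toralQ p N D (i + 1) (dl D x i))) =
      toralQ p N D (i + 1) (dl D x k) - toralQ p N D i (dl D x k) := fun i hi => by
    rw [h.comm_iterate, h.comm_Q, h.D_dl, ← h.comm_Q, ← Function.iterate_succ_apply,
      toralQ_succ p N D (Finset.mem_range.1 hi), toralP_apply, sub_sub_cancel,
      show (p - 2).succ = p - 1 by omega]
  rw [map_sum, Finset.sum_congr rfl hterm,
    Finset.sum_range_sub (fun i => toralQ p N D i (dl D x k)), toralQ_of_le p N D le_rfl,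
    h.toralQ_dl hx]
  ring

theorem wdg_mem_cartierFixed (h : IsToral p N D b) {x : L} (hx : x ≠ 0)
    {η : Finset ℕ → L} (hη : η ∈ cartierFixed p N D) :
    wdg (dl D x) η ∈ cartierFixed p N D := by
  obtain ⟨hd, hQ⟩ := hη
  refine ⟨by rw [dd_wdg D _ (h.D_dl x), hd, map_zero, neg_zero], fun J => ?_⟩
  obtain ⟨f, hf⟩ := h.exists_dl_eq hx
  have h0 : ∑ i ∈ J, posSign i J • (D i (η (J.erase i))) = 0 := by
    rw [← dd_apply, hd, Pi.zero_apply]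
  have h1 : wdg (dl D x) η J = ∑ i ∈ J, posSign i J • D i (f * η (J.erase i)) +
      ∑ i ∈ J, posSign i J • (dl D x i ^ p * η (J.erase i)) := by
    have h2 : ∑ i ∈ J, posSign i J • D i (f * η (J.erase i)) =
        ∑ i ∈ J, posSign i J • (D i f * η (J.erase i)) +
          f * ∑ i ∈ J, posSign i J • (D i (η (J.erase i))) := by
      rw [Finset.mul_sum, ← Finset.sum_add_distrib]
      refine Finset.sum_congr rfl fun i _ => ?_
      rw [(D i).leibniz, smul_eq_mul, smul_eq_mul, smul_add, mul_smul_comm, add_comm,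
        mul_comm (η _)]
    rw [h2, h0, mul_zero, add_zero, ← Finset.sum_add_distrib, wdg_apply]
    refine Finset.sum_congr rfl fun i _ => ?_
    rw [← smul_add, ← add_mul, ← hf i]
  conv_lhs => rw [h1]
  rw [map_add, map_sum, map_sum, wdg_apply, map_sum]
  simp only [map_zsmul]
  rw [Finset.sum_eq_zero fun i _ => by rw [h.Q_apply_D (Nat.zero_le i), smul_zero], zero_add]
  refine Finset.sum_congr rfl fun i _ => ?_
  rw [toralQ_const_mul _ _ _ _ (pow_mem_const _ 0), hQ, map_mul, frobenius_def,
    frobenius_def]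

theorem oneForm_mem_cartierFixed : oneForm L ∈ cartierFixed p N D := by
  refine ⟨?_, fun J => ?_⟩
  · ext J
    rw [dd_apply, Pi.zero_apply]
    refine Finset.sum_eq_zero fun i _ => ?_
    by_cases hJ : J.erase i = ∅
    · rw [hJ, oneForm, Pi.single_eq_same, (D i).map_one_eq_zero, smul_zero]
    · rw [oneForm, Pi.single_eq_of_ne hJ, map_zero, smul_zero]
  · by_cases hJ : J = ∅
    · rw [hJ, oneForm, Pi.single_eq_same, toralQ_of_mem N D (one_mem _), map_one]
    · rw [oneForm, Pi.single_eq_of_ne hJ, map_zero, map_zero]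

theorem logCoord_mem_cartierFixed (h : IsToral p N D b) (l : List L) (hl : ∀ x ∈ l, x ≠ 0) :
    logCoord D l ∈ cartierFixed p N D := by
  induction l with
  | nil => exact oneForm_mem_cartierFixed
  | cons x l ih =>
    exact h.wdg_mem_cartierFixed (hl x List.mem_cons_self)
      (ih fun y hy => hl y (List.mem_cons_of_mem _ hy))

end IsToral

end

section

variable {L : Type*} [Field L]

theorem posSign_smul_eq_zero {M : Type*} [AddCommGroup M] {i : ℕ} {J : Finset ℕ} {x : M}
    (h : posSign i J • x = 0) : x = 0 := by
  rcases neg_one_pow_eq_or ℤ (J.filter (· < i)).card with h1 | h1 <;>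
    rw [posSign, h1] at h <;> simpa using h

theorem logCoord_support {N : ℕ} {D : ℕ → Derivation ℤ L L} (hD : ∀ i, N ≤ i → ∀ x, D i x = 0)
    (l : List L) (J : Finset ℕ) (hJ : logCoord D l J ≠ 0) :
    J.card = l.length ∧ J ⊆ Finset.range N := by
  induction l generalizing J with
  | nil =>
    have : J = ∅ := by
      by_contra h
      exact hJ (by rw [logCoord_nil, oneForm, Pi.single_eq_of_ne h])
    subst this
    simp
  | cons x l ih =>
    rw [logCoord_cons, wdg_apply] at hJ
    obtain ⟨i, hi, hne⟩ := Finset.exists_ne_zero_of_sum_ne_zero hJ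
    have h1 : dl D x i ≠ 0 := fun h => hne (by rw [h, zero_mul, smul_zero])
    have h2 : logCoord D l (J.erase i) ≠ 0 := fun h => hne (by rw [h, mul_zero, smul_zero])
    have hiN : i < N := by
      by_contra h
      exact h1 (by rw [dl, hD i (not_lt.1 h), zero_div])
    obtain ⟨h3, h4⟩ := ih _ h2
    refine ⟨by rw [List.length_cons, ← h3, Finset.card_erase_add_one hi], fun j hj => ?_⟩
    by_cases hji : j = i
    · subst hji; exact Finset.mem_range.2 hiN
    · exact h4 (Finset.mem_erase.2 ⟨hji, hj⟩)

theorem dl_eq_zero_of_mem_constField {D : ℕ → Derivation ℤ L L} {x : L} {k i : ℕ}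
    (hx : x ∈ constField D k) (hi : k ≤ i) : dl D x i = 0 := by
  rw [dl, hx i hi, zero_div]

theorem logCoord_sorted {D : ℕ → Derivation ℤ L L} {c : ℕ → L}
    (hc : ∀ i, c i ∈ constField D (i + 1)) (l : List ℕ) (hl : l.Pairwise (· < ·)) :
    logCoord D (l.map c) l.toFinset = ∏ i ∈ l.toFinset, dl D (c i) i ∧
      ∀ J : Finset ℕ, ∑ j ∈ l.toFinset, 2 ^ j < ∑ j ∈ J, 2 ^ j →
        logCoord D (l.map c) J = 0 := by
  induction l with
  | nil =>
    refine ⟨by simp [logCoord_nil, oneForm], fun J hJ => ?_⟩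
    rw [List.map_nil, logCoord_nil, oneForm, Pi.single_eq_of_ne]
    rintro rfl
    simp at hJ
  | cons m l ih =>
    obtain ⟨hm, hl⟩ := List.pairwise_cons.1 hl
    obtain ⟨ih1, ih2⟩ := ih hl
    have hml : m ∉ l.toFinset := fun h => lt_irrefl _ (hm m (List.mem_toFinset.1 h))
    rw [List.map_cons, logCoord_cons, List.toFinset_cons]
    refine ⟨?_, fun J hJ => ?_⟩
    · rw [wdg_apply, Finset.prod_insert hml, Finset.sum_insert hml, Finset.sum_eq_zero, add_zero,
        Finset.erase_insert hml, ih1]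
      · have : posSign m (insert m l.toFinset) = 1 := by
          rw [posSign, Finset.filter_eq_empty_iff.2, Finset.card_empty, pow_zero]
          intro x hx
          rcases Finset.mem_insert.1 hx with rfl | hx
          · exact lt_irrefl _
          · exact (hm x (List.mem_toFinset.1 hx)).not_gt
        rw [this, one_smul]
      · intro i hi
        rw [dl_eq_zero_of_mem_constField (hc m) (hm i (List.mem_toFinset.1 hi)), zero_mul,
          smul_zero]
    · rw [wdg_apply]
      refine Finset.sum_eq_zero fun i hi => ?_
      by_cases him : i ≤ m
      · rw [ih2, mul_zero, smul_zero]
        rw [Finset.sum_insert hml, ← Finset.add_sum_erase J _ hi] at hJ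
        have : 2 ^ i ≤ 2 ^ m := Nat.pow_le_pow_right two_pos him
        omega
      · rw [dl_eq_zero_of_mem_constField (hc m) (by omega), zero_mul, smul_zero]

variable {p N : ℕ} [Fact p.Prime] [CharP L p] {D : ℕ → Derivation ℤ L L} {b : ℕ → L}

omit [CharP L p] in
theorem IsToral.D_toralQ_leading (h : IsToral p N D b) {η : Finset ℕ → L} (hη : dd D η = 0)
    {I : Finset ℕ} (hI : ∀ J : Finset ℕ, ∑ j ∈ I, 2 ^ j < ∑ j ∈ J, 2 ^ j → η J = 0)
    {k : ℕ} (hk : k ∉ I) : D k (toralQ p N D (k + 1) (η I)) = 0 := by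
  have h0 : ∑ i ∈ insert k I, posSign i (insert k I) •
      D i (toralQ p N D (k + 1) (η ((insert k I).erase i))) = 0 := by
    have h1 := congrArg (toralQ p N D (k + 1)) (congrFun hη (insert k I))
    rw [dd_apply, map_sum, Pi.zero_apply, map_zero] at h1
    simpa only [map_zsmul, h.comm_Q] using h1
  rw [Finset.sum_insert hk, Finset.erase_insert hk, Finset.sum_eq_zero, add_zero] at h0
  · exact posSign_smul_eq_zero h0
  · intro i hi
    have hik : i ≠ k := fun e => hk (e ▸ hi)
    rcases hik.lt_or_gt with hlt | hgt
    · rw [hI, map_zero, map_zero, smul_zero]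
      have h2 := Finset.add_sum_erase (insert k I) (fun j => 2 ^ j) (Finset.mem_insert_of_mem hi)
      rw [Finset.sum_insert hk] at h2
      have : 2 ^ i < 2 ^ k := Nat.pow_lt_pow_right one_lt_two hlt
      omega
    · rw [h.comm_Q, h.Q_apply_D hgt, smul_zero]

/-- A closed form fixed by the Cartier operator all of whose components avoiding the first
`r` indices vanish is a sum of logarithmic forms with first entry a constant of the `Dᵢ`,
`i ≥ r`. -/
theorem IsToral.mem_closure_logCoord (h : IsToral p N D b)
    (hroot : ∀ x : L, ∃ y : L, y ^ (p - 1) = x) (n r : ℕ) (η : Finset ℕ → L)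
    (hη : η ∈ cartierFixed p N D)
    (hsupp : ∀ J, η J ≠ 0 → J.card = n ∧ J ⊆ Finset.range N)
    (hr : ∀ J, Disjoint J (Finset.range r) → η J = 0) :
    η ∈ AddSubgroup.closure {ξ | ∃ y ∈ constField D r, y ≠ 0 ∧ ∃ l : List L,
      l.length + 1 = n ∧ (∀ x ∈ l, x ≠ 0) ∧ ξ = wdg (dl D y) (logCoord D l)} := by
  set C := AddSubgroup.closure {ξ | ∃ y ∈ constField D r, y ≠ 0 ∧ ∃ l : List L,
      l.length + 1 = n ∧ (∀ x ∈ l, x ≠ 0) ∧ ξ = wdg (dl D y) (logCoord D l)} with hC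
  obtain ⟨B, hB⟩ : ∃ B : ℕ, ∀ J : Finset ℕ, B ≤ ∑ j ∈ J, 2 ^ j → η J = 0 := by
    refine ⟨∑ j ∈ Finset.range N, 2 ^ j + 1, fun J hJ => ?_⟩
    by_contra hne
    have := Finset.sum_le_sum_of_subset (f := fun j => 2 ^ j) (hsupp J hne).2
    omega
  induction B generalizing η with
  | zero =>
    have : η = 0 := funext fun J => hB J (Nat.zero_le _)
    rw [this]
    exact zero_mem _
  | succ B ih =>
    by_cases hI : ∃ I : Finset ℕ, ∑ j ∈ I, 2 ^ j = B ∧ η I ≠ 0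
    swap
    · push Not at hI
      refine ih η hη hsupp hr fun J hJ => ?_
      rcases hJ.eq_or_lt with he | hlt
      · exact hI J he.symm
      · exact hB J hlt
    obtain ⟨I, hIB, hI0⟩ := hI
    obtain ⟨hIn, hIN⟩ := hsupp I hI0
    obtain ⟨c, m, hc, hm⟩ := h.exists_prod_logDeriv hroot I N le_rfl (η I)
      (fun i hi => h.zero i hi _)
      (fun i _ hi => h.D_toralQ_leading hη.1 (fun J hJ => hB J (by omega)) hi) (hη.2 I)
    rw [Finset.filter_true_of_mem fun i hi => Finset.mem_range.1 (hIN hi)] at hm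
    obtain ⟨j, hjI, hjr⟩ : ∃ j ∈ I, j < r := by
      by_contra hcon
      push Not at hcon
      refine hI0 (hr I (Finset.disjoint_left.2 fun j hj hj' => ?_))
      exact (Finset.mem_range.1 hj').not_ge (hcon j hj)
    have hsort : (I.sort (· ≤ ·)).Pairwise (· < ·) := (Finset.sortedLT_sort I).pairwise
    have htof : (I.sort (· ≤ ·)).toFinset = I := Finset.sort_toFinset I _
    have hlen : (I.sort (· ≤ ·)).length = n := by rw [Finset.length_sort, hIn]
    have hjmem : j ∈ I.sort (· ≤ ·) := (Finset.mem_sort _).2 hjI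
    obtain ⟨i₀, l, hl⟩ : ∃ i₀ l, I.sort (· ≤ ·) = i₀ :: l :=
      List.exists_cons_of_ne_nil (List.ne_nil_of_mem hjmem)
    rw [hl] at hsort htof hlen hjmem
    have hi₀ : i₀ < r := by
      rcases List.mem_cons.1 hjmem with rfl | hj
      · exact hjr
      · exact ((List.pairwise_cons.1 hsort).1 j hj).trans hjr
    obtain ⟨h1, h2⟩ := logCoord_sorted (fun i => (hc i).2) _ hsort
    rw [htof] at h1 h2
    have hxne : ∀ x ∈ (i₀ :: l).map c, x ≠ 0 := by
      intro x hx
      obtain ⟨i, -, rfl⟩ := List.mem_map.1 hx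
      exact (hc i).1
    set ξ := logCoord D ((i₀ :: l).map c) with hξ
    have hξC : m • ξ ∈ C := by
      refine nsmul_mem ?_ m
      refine AddSubgroup.subset_closure ⟨c i₀, constField_mono D hi₀ (hc i₀).2,
        (hc i₀).1, l.map c, by simpa using hlen, fun x hx => hxne x ?_, rfl⟩
      exact List.mem_cons_of_mem _ hx
    have hξr : ∀ J, Disjoint J (Finset.range r) → ξ J = 0 := by
      intro J hJ
      rw [hξ, List.map_cons, logCoord_cons, wdg_apply]
      refine Finset.sum_eq_zero fun i hi => ?_
      have : r ≤ i := by
        by_contra hlt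
        exact Finset.disjoint_left.1 hJ hi (Finset.mem_range.2 (not_le.1 hlt))
      rw [dl_eq_zero_of_mem_constField (hc i₀).2 (by omega), zero_mul, smul_zero]
    rw [← sub_add_cancel η (m • ξ)]
    refine add_mem (ih _ (sub_mem hη (nsmul_mem (h.logCoord_mem_cartierFixed _ hxne) m)) ?_ ?_ ?_)
      hξC
    · intro J hJ
      by_cases hJη : η J = 0
      · have : ξ J ≠ 0 := fun h0 => hJ (by rw [Pi.sub_apply, Pi.smul_apply, hJη, h0, smul_zero,
          sub_zero])
        have h3 := logCoord_support h.zero _ J this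
        rwa [List.length_map, hlen] at h3
      · exact hsupp J hJη
    · intro J hJ
      rw [Pi.sub_apply, Pi.smul_apply, hr J hJ, hξr J hJ, smul_zero, sub_zero]
    · intro J hJ
      rcases hJ.eq_or_lt with he | hlt
      · obtain rfl : I = J := Finset.geomSum_injective le_rfl (hIB.trans he)
        rw [Pi.sub_apply, Pi.smul_apply, h1, hm, nsmul_eq_mul]
        exact sub_self _
      · rw [Pi.sub_apply, Pi.smul_apply, hB J hlt, h2 J (hIB ▸ hlt), smul_zero, sub_zero]

end

section

/-- The field of constants of a derivation on a field. -/
def derKer {K M : Type*} [Field K] [AddCommGroup M] [Module K M] (D : Derivation ℤ K M) :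
    Subfield K where
  carrier := {x | D x = 0}
  mul_mem' := fun {a b} ha hb => by
    rw [Set.mem_ofPred_eq, D.leibniz, ha, hb, smul_zero, smul_zero, add_zero]
  one_mem' := D.map_one_eq_zero
  add_mem' := fun {a b} ha hb => by rw [Set.mem_ofPred_eq, map_add, ha, hb, add_zero]
  zero_mem' := map_zero D
  neg_mem' := fun {a} ha => by rw [Set.mem_ofPred_eq, map_neg, ha, neg_zero]
  inv_mem' := fun x hx => by rw [Set.mem_ofPred_eq, D.leibniz_inv, hx, smul_zero]

theorem mem_derKer {K M : Type*} [Field K] [AddCommGroup M] [Module K M]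
    {D : Derivation ℤ K M} {x : K} : x ∈ derKer D ↔ D x = 0 := Iff.rfl

theorem pow_mem_derKer {K M : Type*} [Field K] [AddCommGroup M] [Module K M]
    (p : ℕ) [CharP K p] (D : Derivation ℤ K M) (x : K) : x ^ p ∈ derKer D := by
  rw [mem_derKer, D.leibniz_pow, ← Nat.cast_smul_eq_nsmul K, CharP.cast_eq_zero, zero_smul]

variable {K : Type*} [Field K] {p : ℕ} [Fact p.Prime] [CharP K p]

open Polynomial in
theorem minpoly_eq_X_pow_sub_C_of_pow_mem {k : Subfield K} {h : K} (hp : h ^ p ∈ k) (hk : h ∉ k) :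
    minpoly k h = X ^ p - C ⟨h ^ p, hp⟩ := by
  have hp0 : p ≠ 0 := (Fact.out : p.Prime).ne_zero
  symm
  refine minpoly.eq_of_irreducible_of_monic
    (X_pow_sub_C_irreducible_of_prime Fact.out fun c hc => hk ?_) ?_ (monic_X_pow_sub_C _ hp0)
  · have h1 : (c : K) ^ p = h ^ p := congrArg Subtype.val hc
    rw [← frobenius_inj K p h1]
    exact c.2
  · simp only [map_sub, map_pow, aeval_X, aeval_C]
    exact sub_self _

omit [CharP K p] in
theorem isIntegral_of_pow_mem {k : Subfield K} {h : K} (hp : h ^ p ∈ k) : IsIntegral k h :=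
  IsIntegral.of_pow (Fact.out : p.Prime).pos (isIntegral_algebraMap (x := (⟨h ^ p, hp⟩ : k)))

theorem mem_adjoin_iff_mem_closure {k : Subfield K} {S : Set K} {x : K} :
    x ∈ IntermediateField.adjoin k S ↔ x ∈ Subfield.closure ((k : Set K) ∪ S) := by
  rw [← IntermediateField.mem_toSubfield, IntermediateField.adjoin_toSubfield]
  have : Set.range (algebraMap k K) = k := Subtype.range_coe
  rw [this]

/-- The exchange property for purely inseparable extensions of exponent one. -/
theorem mem_closure_exchange {k : Subfield K} {h x : K} (hp : h ^ p ∈ k)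
    (hx : x ∈ Subfield.closure ((k : Set K) ∪ {h})) (hxk : x ∉ k) :
    h ∈ Subfield.closure ((k : Set K) ∪ {x}) := by
  rw [← mem_adjoin_iff_mem_closure] at hx ⊢
  have hhk : h ∉ k := by
    intro hh
    refine hxk ?_
    have h1 : Subfield.closure ((k : Set K) ∪ {h}) ≤ k :=
      Subfield.closure_le.2 (Set.union_subset le_rfl (Set.singleton_subset_iff.2 hh))
    exact h1 (mem_adjoin_iff_mem_closure.1 hx)
  have hint := isIntegral_of_pow_mem hp
  have hfin : Module.finrank k (IntermediateField.adjoin k {h}) = p := by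
    rw [IntermediateField.adjoin.finrank hint, minpoly_eq_X_pow_sub_C_of_pow_mem hp hhk,
      Polynomial.natDegree_X_pow_sub_C]
  have hle : IntermediateField.adjoin k {x} ≤ IntermediateField.adjoin k {h} :=
    IntermediateField.adjoin_le_iff.2 (Set.singleton_subset_iff.2 hx)
  have : FiniteDimensional k (IntermediateField.adjoin k {h}) :=
    IntermediateField.adjoin.finiteDimensional hint
  have hdvd := IntermediateField.finrank_dvd_of_le_right hle
  rw [hfin] at hdvd
  rcases (Nat.dvd_prime Fact.out).1 hdvd with h1 | h1
  · rw [IntermediateField.finrank_eq_one_iff] at h1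
    have h2 : x ∈ IntermediateField.adjoin k {x} :=
      IntermediateField.mem_adjoin_simple_self k x
    rw [h1, IntermediateField.mem_bot] at h2
    obtain ⟨c, hc⟩ := h2
    exact (hxk (hc ▸ c.2)).elim
  · rw [IntermediateField.eq_of_le_of_finrank_eq hle (h1.trans hfin.symm)]
    exact IntermediateField.mem_adjoin_simple_self k h

theorem closure_union_singleton_self (k : Subfield K) {x : K} (hx : x ∈ k) :
    Subfield.closure ((k : Set K) ∪ {x}) = k :=
  le_antisymm (Subfield.closure_le.2 (Set.union_subset le_rfl (Set.singleton_subset_iff.2 hx)))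
    fun _ hy => Subfield.subset_closure (Or.inl hy)

/-- A derivation killing a subfield containing all `p`-th powers exists with prescribed
eigenvector outside of the subfield. -/
theorem exists_derivation_of_notMem (k : Subfield K) (hk : ∀ x : K, x ^ p ∈ k) {b : K}
    (hb : b ∉ k) : ∃ D : Derivation ℤ K K, (∀ x ∈ k, D x = 0) ∧ D b = b := by
  obtain ⟨k', hkk', hmax⟩ := zorn_le_nonempty₀ {k' : Subfield K | k ≤ k' ∧ b ∉ k'}
    (fun c hc hchain y hy => by
      refine ⟨sSup c, ⟨(hc hy).1.trans (le_sSup hy), fun hbc => ?_⟩, fun z hz => le_sSup hz⟩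
      obtain ⟨s, hs, hbs⟩ := (Subfield.mem_sSup_of_directedOn ⟨y, hy⟩ hchain.directedOn).1 hbc
      exact (hc hs).2 hbs) k ⟨le_rfl, hb⟩
  have hbk' : b ∉ k' := hmax.prop.2
  have hpow : ∀ x : K, x ^ p ∈ k' := fun x => hkk' (hk x)
  have htop : ∀ x : K, x ∈ Subfield.closure ((k' : Set K) ∪ {b}) := by
    intro x
    by_cases hx : x ∈ k'
    · exact Subfield.subset_closure (Or.inl hx)
    · refine mem_closure_exchange (hpow x) ?_ hbk'
      by_contra hcon
      have hle : k' ≤ Subfield.closure ((k' : Set K) ∪ {x}) :=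
        fun y hy => Subfield.subset_closure (Or.inl hy)
      exact hx (hmax.le_of_ge ⟨hkk'.trans hle, hcon⟩ hle
        (Subfield.subset_closure (Or.inr rfl)))
  have hDb : KaehlerDifferential.D k' K b ≠ 0 := by
    intro h0
    have hD0 : ∀ x, KaehlerDifferential.D k' K x = 0 := by
      let D' : Derivation ℤ K (Ω[K⁄k']) := (KaehlerDifferential.D k' K).restrictScalars ℤ
      have hle : Subfield.closure ((k' : Set K) ∪ {b}) ≤ derKer D' := by
        refine Subfield.closure_le.2 (Set.union_subset (fun y hy => ?_)
          (Set.singleton_subset_iff.2 h0))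
        exact (KaehlerDifferential.D k' K).map_algebraMap ⟨y, hy⟩
      exact fun x => hle (htop x)
    have hsub : Subsingleton (Ω[K⁄k']) := by
      refine (Submodule.subsingleton_iff K).1 (subsingleton_of_bot_eq_top ?_)
      rw [← KaehlerDifferential.span_range_derivation, eq_comm, Submodule.span_eq_bot]
      rintro _ ⟨x, rfl⟩
      exact hD0 x
    have hfu : Algebra.FormallyUnramified k' K := ⟨hsub⟩
    have hadj : IntermediateField.adjoin k' {b} = ⊤ :=
      eq_top_iff.2 fun x _ => mem_adjoin_iff_mem_closure.2 (htop x)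
    have hfd : FiniteDimensional k' K := by
      have h1 : FiniteDimensional k' (IntermediateField.adjoin k' {b}) :=
        IntermediateField.adjoin.finiteDimensional (isIntegral_of_pow_mem (hpow b))
      rw [hadj] at h1
      exact IntermediateField.topEquiv.toLinearEquiv.finiteDimensional
    have hsepK : Algebra.IsSeparable k' K :=
      (Algebra.FormallyUnramified.iff_isSeparable k' K).1 hfu
    have hsep := Algebra.IsSeparable.isSeparable k' b
    rw [IsSeparable, minpoly_eq_X_pow_sub_C_of_pow_mem (hpow b) hbk'] at hsep
    have h4 := (Polynomial.separable_iff_derivative_ne_zero (by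
      rw [← minpoly_eq_X_pow_sub_C_of_pow_mem (hpow b) hbk']
      exact minpoly.irreducible (isIntegral_of_pow_mem (hpow b)))).1 hsep
    have hpk : (p : k') = 0 := Subtype.ext (CharP.cast_eq_zero K p)
    refine h4 ?_
    rw [Polynomial.derivative_sub, Polynomial.derivative_C, Polynomial.derivative_X_pow, hpk,
      map_zero, zero_mul, sub_zero]
  obtain ⟨φ, hφ⟩ : ∃ φ : Module.Dual K (Ω[K⁄k']), φ (KaehlerDifferential.D k' K b) ≠ 0 := by
    by_contra hcon
    push Not at hcon
    exact hDb ((Module.forall_dual_apply_eq_zero_iff K _).1 hcon)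
  refine ⟨(b / φ (KaehlerDifferential.D k' K b)) •
    (φ.compDer (KaehlerDifferential.D k' K)).restrictScalars ℤ, fun x hx => ?_, ?_⟩
  · have : KaehlerDifferential.D k' K x = 0 :=
      (KaehlerDifferential.D k' K).map_algebraMap ⟨x, hkk' hx⟩
    simp [this]
  · simp [hφ]

end

section

variable {K : Type*} [Field K] {p N : ℕ}

/-- The elements `g₀, …, g_{N-1}` are `p`-independent over the `p`-th powers of `k`. -/
def PIndepFam (p N : ℕ) (k : Subfield K) (g : ℕ → K) : Prop :=
  ∀ i < N, g i ∉ Subfield.closure ((· ^ p) '' (k : Set K) ∪ g '' {j | j < N ∧ j ≠ i})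

theorem pIndepFam_map_iff {M : Type*} [Field M] (φ : K →+* M) (g : ℕ → K) :
    PIndepFam p N φ.fieldRange (φ ∘ g) ↔ PIndepFam p N ⊤ g := by
  refine forall₂_congr fun i _ => not_congr ?_
  have h1 : (· ^ p) '' (φ.fieldRange : Set M) ∪ (φ ∘ g) '' {j | j < N ∧ j ≠ i} =
      φ '' ((· ^ p) '' ((⊤ : Subfield K) : Set K) ∪ g '' {j | j < N ∧ j ≠ i}) := by
    rw [Set.image_union, Set.image_comp, RingHom.coe_fieldRange, Subfield.coe_top,
      Set.image_univ, ← Set.range_comp, ← Set.range_comp]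
    congr 2
    ext x
    simp
  rw [h1, ← RingHom.map_field_closure, Subfield.mem_map]
  exact ⟨fun ⟨y, hy, h⟩ => φ.injective h ▸ hy, fun h => ⟨_, h, rfl⟩⟩

theorem PIndepFam.exists_derivation [Fact p.Prime] [CharP K p] {g : ℕ → K}
    (hg : PIndepFam p N ⊤ g) : ∃ D : ℕ → Derivation ℤ K K, (∀ i, N ≤ i → D i = 0) ∧
      (∀ i < N, D i (g i) = g i) ∧ ∀ i j, i ≠ j → j < N → D i (g j) = 0 := by
  have key : ∀ i, ∃ D : Derivation ℤ K K, (N ≤ i → D = 0) ∧ (i < N → D (g i) = g i) ∧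
      ∀ j, i ≠ j → j < N → D (g j) = 0 := by
    intro i
    by_cases hi : i < N
    · obtain ⟨D, h1, h2⟩ := exists_derivation_of_notMem (p := p)
        (Subfield.closure ((· ^ p) '' ((⊤ : Subfield K) : Set K) ∪ g '' {j | j < N ∧ j ≠ i}))
        (fun x => Subfield.subset_closure (Or.inl ⟨x, Subfield.mem_top x, rfl⟩)) (hg i hi)
      exact ⟨D, fun h => absurd hi h.not_gt, fun _ => h2, fun j hij hj =>
        h1 _ (Subfield.subset_closure (Or.inr ⟨j, ⟨hj, hij.symm⟩, rfl⟩))⟩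
    · exact ⟨0, fun _ => rfl, fun h => absurd h hi, fun _ _ _ => rfl⟩
  choose D h1 h2 h3 using key
  exact ⟨D, h1, h2, h3⟩

theorem PIndepFam.exists_extension [Fact p.Prime] [CharP K p] {g : ℕ → K}
    (hg : PIndepFam p N ⊤ g) (X : Finset K) : ∃ M ≥ N, ∃ g' : ℕ → K, (∀ j < N, g' j = g j) ∧
      PIndepFam p M ⊤ g' ∧ ∀ x ∈ X, x ∈ Subfield.closure
        ((· ^ p) '' ((⊤ : Subfield K) : Set K) ∪ g' '' {j | j < M}) := by
  classical
  induction X using Finset.induction_on with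
  | empty => exact ⟨N, le_rfl, g, fun _ _ => rfl, hg, by simp⟩
  | insert x X _ ih =>
    obtain ⟨M, hM, g', hg', hind, hX⟩ := ih
    by_cases hx : x ∈ Subfield.closure ((· ^ p) '' ((⊤ : Subfield K) : Set K) ∪ g' '' {j | j < M})
    · exact ⟨M, hM, g', hg', hind, fun y hy => (Finset.mem_insert.1 hy).elim (fun h => h ▸ hx)
        (hX y)⟩
    have hupd : ∀ j < M, Function.update g' M x j = g' j := fun j hj =>
      Function.update_of_ne hj.ne _ _
    refine ⟨M + 1, by omega, Function.update g' M x, fun j hj => ?_, fun i hi => ?_,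
      fun y hy => ?_⟩
    · rw [hupd j (by omega), hg' j hj]
    · rcases Nat.lt_succ_iff_lt_or_eq.1 hi with hi | rfl
      · rw [hupd i hi]
        intro hcon
        set k := Subfield.closure ((· ^ p) '' ((⊤ : Subfield K) : Set K) ∪
          g' '' {j | j < M ∧ j ≠ i}) with hk
        have hle : Subfield.closure ((k : Set K) ∪ {g' i}) ≤ Subfield.closure
            ((· ^ p) '' ((⊤ : Subfield K) : Set K) ∪ g' '' {j | j < M}) := by
          refine Subfield.closure_le.2 (Set.union_subset ?_ ?_)
          · refine Subfield.closure_mono (Set.union_subset_union_right _ ?_)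
            exact Set.image_mono fun j hj => hj.1
          · rintro _ rfl
            exact Subfield.subset_closure (Or.inr ⟨i, hi, rfl⟩)
        refine hx (hle (mem_closure_exchange (p := p) (h := x) ?_ ?_ (hind i hi)))
        · exact Subfield.subset_closure (Or.inl ⟨x, Subfield.mem_top x, rfl⟩)
        · refine Subfield.closure_le.2 (Set.union_subset ?_ ?_) hcon
          · exact fun y hy => Subfield.subset_closure (Or.inl (Subfield.subset_closure (Or.inl hy)))
          · rintro _ ⟨j, ⟨hj, hji⟩, rfl⟩
            rcases Nat.lt_succ_iff_lt_or_eq.1 hj with hj | rfl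
            · rw [hupd j hj]
              exact Subfield.subset_closure
                (Or.inl (Subfield.subset_closure (Or.inr ⟨j, ⟨hj, hji⟩, rfl⟩)))
            · rw [Function.update_self]
              exact Subfield.subset_closure (Or.inr rfl)
      · rw [Function.update_self]
        intro hcon
        refine hx (Subfield.closure_mono (Set.union_subset_union_right _ ?_) hcon)
        rintro _ ⟨j, ⟨hj, hji⟩, rfl⟩
        have hj' : j < i := by omega
        exact ⟨j, hj', (hupd j hj').symm⟩
    · rcases Finset.mem_insert.1 hy with rfl | hy
      · exact Subfield.subset_closure (Or.inr ⟨M, Nat.lt_succ_self M, Function.update_self ..⟩)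
      · refine Subfield.closure_mono (Set.union_subset_union_right _ ?_) (hX y hy)
        rintro _ ⟨j, hj, rfl⟩
        exact ⟨j, Nat.lt_succ_of_lt hj, hupd j hj⟩

theorem PIndepFam.adjoin_pth_root [Fact p.Prime] [CharP K p] {k : Subfield K} {g : ℕ → K}
    (hg : PIndepFam p N k g) (hgk : ∀ i < N, g i ∈ k) {j : ℕ} (hj : j < N) {h : K}
    (hh : h ^ p = g j) :
    PIndepFam p N (Subfield.closure ((k : Set K) ∪ {h})) (Function.update g j h) := by
  have hhk : h ∉ k := fun hcon => hg j hj (Subfield.subset_closure (Or.inl ⟨h, hcon, hh⟩))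
  have hpowk : ∀ x ∈ k, x ^ p ∈ k := fun x hx => pow_mem hx p
  have hpow : ∀ x ∈ Subfield.closure ((k : Set K) ∪ {h}),
      x ^ p ∈ Subfield.closure ((· ^ p) '' (k : Set K) ∪ {g j}) := by
    intro x hx
    have hle : Subfield.closure ((k : Set K) ∪ {h}) ≤
        (Subfield.closure ((· ^ p) '' (k : Set K) ∪ {g j})).comap (frobenius K p) := by
      refine Subfield.closure_le.2 (Set.union_subset (fun y hy => ?_) ?_)
      · exact Subfield.subset_closure (Or.inl ⟨y, hy, rfl⟩)
      · rintro _ rfl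
        exact Subfield.subset_closure (Or.inr hh)
    exact hle hx
  have hsub : ∀ i, Subfield.closure ((· ^ p) '' (k : Set K) ∪ g '' {l | l < N ∧ l ≠ i}) ≤ k := by
    intro i
    refine Subfield.closure_le.2 (Set.union_subset ?_ ?_)
    · rintro _ ⟨y, hy, rfl⟩
      exact hpowk y hy
    · rintro _ ⟨l, hl, rfl⟩
      exact hgk l hl.1
  intro i hi hcon
  by_cases hij : i = j
  · subst hij
    rw [Function.update_self] at hcon
    refine hhk (Subfield.closure_le.2 (Set.union_subset ?_ ?_) hcon)
    · rintro _ ⟨y, hy, rfl⟩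
      refine Subfield.closure_le.2 (Set.union_subset ?_ ?_) (hpow y hy)
      · rintro _ ⟨z, hz, rfl⟩
        exact hpowk z hz
      · rintro _ rfl
        exact hgk i hi
    · rintro _ ⟨l, ⟨hl, hli⟩, rfl⟩
      rw [Function.update_of_ne hli]
      exact hgk l hl
  · rw [Function.update_of_ne hij] at hcon
    have hgj : g j ∈ Subfield.closure ((· ^ p) '' (k : Set K) ∪ g '' {l | l < N ∧ l ≠ i}) :=
      Subfield.subset_closure (Or.inr ⟨j, ⟨hj, Ne.symm hij⟩, rfl⟩)
    refine hhk (Subfield.closure_le.2 (Set.union_subset (hsub i)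
        (Set.singleton_subset_iff.2 (hgk i hi)))
      (mem_closure_exchange (p := p) (h := h) (by rw [hh]; exact hgj) ?_ (hg i hi)))
    · refine Subfield.closure_le.2 (Set.union_subset ?_ ?_) hcon
      · rintro _ ⟨y, hy, rfl⟩
        refine Subfield.subset_closure (Or.inl ?_)
        refine Subfield.closure_le.2 (Set.union_subset ?_ ?_) (hpow y hy)
        · exact fun z hz => Subfield.subset_closure (Or.inl hz)
        · rintro _ rfl
          exact hgj
      · rintro _ ⟨l, ⟨hl, hli⟩, rfl⟩
        by_cases hlj : l = j
        · subst hlj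
          rw [Function.update_self]
          exact Subfield.subset_closure (Or.inr rfl)
        · rw [Function.update_of_ne hlj]
          exact Subfield.subset_closure
            (Or.inl (Subfield.subset_closure (Or.inr ⟨l, ⟨hl, hli⟩, rfl⟩)))

theorem PIndepFam.adjoin_root [Fact p.Prime] [CharP K p] (m : ℕ) {k : Subfield K} {g : ℕ → K}
    (hg : PIndepFam p N k g) (hgk : ∀ i < N, g i ∈ k) {j : ℕ} (hj : j < N) {h : K}
    (hh : h ^ p ^ m = g j) :
    PIndepFam p N (Subfield.closure ((k : Set K) ∪ {h})) (Function.update g j h) := by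
  induction m generalizing k g with
  | zero =>
    rw [pow_zero, pow_one] at hh
    subst hh
    rwa [Function.update_eq_self, closure_union_singleton_self k (hgk j hj)]
  | succ m ih =>
    have h1 := hg.adjoin_pth_root hgk hj (h := h ^ p ^ m) (by rw [← pow_mul, ← pow_succ, hh])
    have h2 := ih h1 (fun i hi => ?_) (by rw [Function.update_self])
    · rw [Function.update_idem] at h2
      convert h2 using 1
      refine le_antisymm (Subfield.closure_mono (Set.union_subset_union_left _
        fun x hx => Subfield.subset_closure (Or.inl hx))) (Subfield.closure_le.2
          (Set.union_subset ?_ fun x hx => Subfield.subset_closure (Or.inr hx)))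
      refine Subfield.closure_le.2 (Set.union_subset
        (fun x hx => Subfield.subset_closure (Or.inl hx)) ?_)
      rintro _ rfl
      exact pow_mem (Subfield.subset_closure (Or.inr rfl) :
        h ∈ Subfield.closure ((k : Set K) ∪ {h})) _
    · by_cases hij : i = j
      · subst hij
        rw [Function.update_self]
        exact Subfield.subset_closure (Or.inr rfl)
      · rw [Function.update_of_ne hij]
        exact Subfield.subset_closure (Or.inl (hgk i hi))

theorem PIndepFam.adjoin_roots [Fact p.Prime] [CharP K p] {k : Subfield K} {g : ℕ → K}
    (hg : PIndepFam p N k g) (hgk : ∀ i < N, g i ∈ k) (m : ℕ → ℕ) (β : ℕ → K) (r : ℕ)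
    (hr : r ≤ N) (hβ : ∀ j < r, β j ^ p ^ m j = g j) :
    PIndepFam p N (Subfield.closure ((k : Set K) ∪ β '' {j | j < r}))
      (fun j => if j < r then β j else g j) := by
  induction r with
  | zero =>
    have : Subfield.closure ((k : Set K) ∪ β '' {j | j < 0}) = k := by
      simp
    rw [this]
    simpa using hg
  | succ r ih =>
    have h1 := ih (by omega) fun j hj => hβ j (by omega)
    have h2 := h1.adjoin_root (m r) (fun i hi => ?_) (j := r) (by omega) (h := β r) (by
      rw [if_neg (lt_irrefl r)]; exact hβ r (Nat.lt_succ_self r))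
    · convert h2 using 1
      · refine le_antisymm (Subfield.closure_le.2 (Set.union_subset
          (fun x hx => Subfield.subset_closure (Or.inl (Subfield.subset_closure (Or.inl hx)))) ?_))
          (Subfield.closure_le.2 (Set.union_subset ?_ ?_))
        · rintro _ ⟨j, hj, rfl⟩
          rcases Nat.lt_succ_iff_lt_or_eq.1 hj with hj | rfl
          · exact Subfield.subset_closure
              (Or.inl (Subfield.subset_closure (Or.inr ⟨j, hj, rfl⟩)))
          · exact Subfield.subset_closure (Or.inr rfl)
        · exact Subfield.closure_mono (Set.union_subset_union_right _
            (Set.image_mono fun j hj => Nat.lt_succ_of_lt hj))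
        · rintro _ rfl
          exact Subfield.subset_closure (Or.inr ⟨r, Nat.lt_succ_self r, rfl⟩)
      · ext j
        by_cases hj : j = r
        · subst hj; simp
        · rw [Function.update_of_ne hj]
          have : j < r + 1 ↔ j < r := by omega
          simp only [this]
    · by_cases hir : i < r
      · simp only [if_pos hir]
        exact Subfield.subset_closure (Or.inr ⟨i, hir, rfl⟩)
      · simp only [if_neg hir]
        exact Subfield.subset_closure (Or.inl (hgk i hi))

end

section

variable {K : Type*} [Field K] {p N : ℕ} [Fact p.Prime] [CharP K p]

theorem Derivation.iterate_char_leibniz (D : Derivation ℤ K K) (a b : K) :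
    D^[p] (a * b) = a * D^[p] b + b * D^[p] a := by
  have h1 := Module.End.charP_int K p
  have h2 := Module.End.charP_int (Module.End ℤ K) p
  let T : Module.End ℤ K := (D : K →ₗ[ℤ] K)
  have hT : ∀ y, (T ^ p) y = D^[p] y := fun y => Module.End.pow_apply T p y
  have h3 : (LinearMap.mulLeft ℤ T - LinearMap.mulRight ℤ T) ^ p =
      LinearMap.mulLeft ℤ (T ^ p) - LinearMap.mulRight ℤ (T ^ p) := by
    rw [sub_pow_char_of_commute (p := p) (R := Module.End ℤ (Module.End ℤ K))
      (LinearMap.commute_mulLeft_right T T), LinearMap.pow_mulLeft, LinearMap.pow_mulRight]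
  have h4 : ((LinearMap.mulLeft ℤ T - LinearMap.mulRight ℤ T) ^ p) (LinearMap.mulLeft ℤ a) =
      LinearMap.mulLeft ℤ (D^[p] a) := by
    rw [Module.End.pow_apply]
    exact iterate_commutator_mulLeft D a p
  rw [h3] at h4
  have h5 := LinearMap.congr_fun h4 b
  simp only [LinearMap.sub_apply, LinearMap.mulLeft_apply, LinearMap.mulRight_apply,
    Module.End.mul_apply, hT] at h5
  linear_combination h5

/-- The `p`-th iterate of a derivation in characteristic `p`. -/
def Derivation.iterateChar (p : ℕ) [Fact p.Prime] [CharP K p] (D : Derivation ℤ K K) :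
    Derivation ℤ K K :=
  Derivation.mk' (((D : K →ₗ[ℤ] K) : Module.End ℤ K) ^ p) fun a b => by
    simp only [Module.End.pow_apply, smul_eq_mul]
    exact D.iterate_char_leibniz a b

theorem Derivation.iterateChar_apply (D : Derivation ℤ K K) (x : K) :
    D.iterateChar p x = D^[p] x :=
  Module.End.pow_apply (D : K →ₗ[ℤ] K) p x

/-- The restriction of a derivation to a stable subfield. -/
def Derivation.restrictSubfield (D : Derivation ℤ K K) (L : Subfield K)
    (hL : ∀ x ∈ L, D x ∈ L) : Derivation ℤ L L :=
  Derivation.mk' (AddMonoidHom.toIntLinearMap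
    { toFun := fun x => ⟨D x, hL x x.2⟩
      map_zero' := Subtype.ext (map_zero D)
      map_add' := fun x y => Subtype.ext (map_add D (x : K) y) })
    fun a b => Subtype.ext (D.leibniz (a : K) b)

/-- The subfield generated by the `p`-th powers and the `gⱼ`, `j < N`. -/
def pSpan (p N : ℕ) (g : ℕ → K) : Subfield K :=
  Subfield.closure ((· ^ p) '' ((⊤ : Subfield K) : Set K) ∪ g '' {j | j < N})

omit [Fact p.Prime] [CharP K p] in
theorem pow_mem_pSpan (g : ℕ → K) (x : K) : x ^ p ∈ pSpan p N g :=
  Subfield.subset_closure (Or.inl ⟨x, Subfield.mem_top x, rfl⟩)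

omit [Fact p.Prime] [CharP K p] in
theorem mem_pSpan_of_lt (g : ℕ → K) {j : ℕ} (hj : j < N) : g j ∈ pSpan p N g :=
  Subfield.subset_closure (Or.inr ⟨j, hj, rfl⟩)

omit [Fact p.Prime] in
theorem pSpan_le_derKer {M : Type*} [AddCommGroup M] [Module K M] {g : ℕ → K}
    (D : Derivation ℤ K M) (hD : ∀ j < N, D (g j) = 0) : pSpan p N g ≤ derKer D := by
  refine Subfield.closure_le.2 (Set.union_subset ?_ ?_)
  · rintro _ ⟨x, -, rfl⟩
    exact pow_mem_derKer p D x
  · rintro _ ⟨j, hj, rfl⟩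
    exact hD j hj

omit [Fact p.Prime] [CharP K p] in
theorem PIndepFam.ne_zero {g : ℕ → K} (hg : PIndepFam p N ⊤ g) {j : ℕ} (hj : j < N) : g j ≠ 0 :=
  fun h => hg j hj (h ▸ zero_mem _)

/-- The derivations of `K` dual to the `p`-independent elements `gⱼ`. -/
structure IsDualFamily (N : ℕ) (g : ℕ → K) (D : ℕ → Derivation ℤ K K) : Prop where
  zero : ∀ i, N ≤ i → D i = 0
  self : ∀ i < N, D i (g i) = g i
  other : ∀ i j, i ≠ j → j < N → D i (g j) = 0

namespace IsDualFamily

variable {g : ℕ → K} {D : ℕ → Derivation ℤ K K} (hD : IsDualFamily N g D)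

include hD

omit [Fact p.Prime] [CharP K p] in
theorem apply_eq_ite (i : ℕ) {j : ℕ} (hj : j < N) : D i (g j) = if i = j then g j else 0 := by
  split_ifs with h
  · subst h; exact hD.self i hj
  · exact hD.other i j h hj

omit [Fact p.Prime] in
theorem apply_mem_pSpan (i : ℕ) {x : K} (hx : x ∈ pSpan p N g) : D i x ∈ pSpan p N g := by
  induction hx using Subfield.closure_induction with
  | mem x hx =>
    rcases hx with ⟨y, -, rfl⟩ | ⟨j, hj, rfl⟩
    · have : D i (y ^ p) = 0 := pow_mem_derKer p (D i) y
      simp only [this]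
      exact zero_mem _
    · rw [hD.apply_eq_ite i hj]
      split_ifs
      · exact mem_pSpan_of_lt g hj
      · exact zero_mem _
  | one => rw [(D i).map_one_eq_zero]; exact zero_mem _
  | add x y _ _ hx hy => rw [map_add]; exact add_mem hx hy
  | neg x _ hx => rw [map_neg]; exact neg_mem hx
  | inv x hx hx' =>
    rw [(D i).leibniz_inv, smul_eq_mul]
    exact mul_mem (neg_mem (pow_mem (inv_mem hx) 2)) hx'
  | mul x y hx hy hx' hy' =>
    rw [(D i).leibniz, smul_eq_mul, smul_eq_mul]
    exact add_mem (mul_mem hx hy') (mul_mem hy hx')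

omit [Fact p.Prime] in
theorem comm_apply (i j : ℕ) {x : K} (hx : x ∈ pSpan p N g) : D i (D j x) = D j (D i x) := by
  have h := pSpan_le_derKer (p := p) (g := g) (N := N) ⁅D i, D j⁆ (fun l hl => by
    rw [Derivation.commutator_apply, hD.apply_eq_ite i hl, hD.apply_eq_ite j hl]
    split_ifs with h1 h2 h2 <;> simp [*, hD.apply_eq_ite _ hl]) hx
  rwa [mem_derKer, Derivation.commutator_apply, sub_eq_zero] at h

theorem iterate_apply (i : ℕ) {x : K} (hx : x ∈ pSpan p N g) : (D i)^[p] x = D i x := by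
  have hp : p = p - 1 + 1 := (Nat.succ_pred_prime Fact.out).symm
  have h := pSpan_le_derKer (p := p) (g := g) (N := N) ((D i).iterateChar p - D i) (fun l hl => by
    rw [Derivation.sub_apply, Derivation.iterateChar_apply, sub_eq_zero]
    have h1 := hD.apply_eq_ite i hl
    split_ifs at h1 with h2
    · rw [h1]; exact Function.iterate_fixed h1 p
    · rw [h1, hp, Function.iterate_succ_apply, h1]
      exact iterate_map_zero (D i) _) hx
  rwa [mem_derKer, Derivation.sub_apply, Derivation.iterateChar_apply, sub_eq_zero] at h

/-- The restrictions of the dual derivations to the subfield `pSpan p N g`. -/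
def _root_.dualRestrict {p N : ℕ} [CharP K p] {g : ℕ → K}
    {D : ℕ → Derivation ℤ K K} (hD : IsDualFamily N g D) (i : ℕ) :
    Derivation ℤ (pSpan p N g) (pSpan p N g) :=
  (D i).restrictSubfield _ fun _ hx => hD.apply_mem_pSpan i hx

omit [Fact p.Prime] in
theorem coe_dualRestrict_apply (i : ℕ) (x : pSpan p N g) :
    (dualRestrict hD i x : K) = D i x := rfl

omit [Fact p.Prime] in
theorem coe_iterate_dualRestrict (i n : ℕ) (x : pSpan p N g) :
    ((dualRestrict hD i)^[n] x : K) = (D i)^[n] x := by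
  induction n with
  | zero => rfl
  | succ n ih => rw [Function.iterate_succ_apply', Function.iterate_succ_apply',
      hD.coe_dualRestrict_apply, ih]

theorem isToral (hg : PIndepFam p N ⊤ g) : IsToral p N (dualRestrict hD (p := p))
    (fun j => if h : j < N then ⟨g j, mem_pSpan_of_lt g h⟩ else 1) where
  comm i j x := Subtype.ext (hD.comm_apply i j x.2)
  iterate i x := Subtype.ext (by
    rw [hD.coe_iterate_dualRestrict, hD.iterate_apply i x.2, hD.coe_dualRestrict_apply])
  zero i hi x := Subtype.ext (by
    rw [hD.coe_dualRestrict_apply, hD.zero i hi, Derivation.zero_apply]; rfl)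
  ne_zero i hi := by
    rw [dif_pos hi]
    exact fun h => hg.ne_zero hi (congrArg Subtype.val h)
  self i hi := Subtype.ext (by
    rw [dif_pos hi, hD.coe_dualRestrict_apply]
    exact hD.self i hi)
  other i j hij hj := Subtype.ext (by
    rw [dif_pos hj, hD.coe_dualRestrict_apply]
    exact hD.other i j hij hj)

/-- Elements killed by the last dual derivations involve only the first generators. -/
theorem mem_pSpan_of_const {r : ℕ} (hg : PIndepFam p N ⊤ g) (hr : r ≤ N) {x : K}
    (hx : x ∈ pSpan p N g) (hc : ∀ i, r ≤ i → D i x = 0) : x ∈ pSpan p r g := by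
  have key : ∀ M, r ≤ M → M ≤ N → x ∈ pSpan p M g → x ∈ pSpan p r g := by
    intro M hM
    induction M, hM using Nat.le_induction with
    | base => exact fun _ h => h
    | succ M hM ih =>
      intro hMN hxM
      refine ih (by omega) ?_
      by_contra hcon
      have h1 : x ∈ Subfield.closure ((pSpan p M g : Set K) ∪ {g M}) := by
        refine Subfield.closure_le.2 (Set.union_subset ?_ ?_) hxM
        · rintro _ ⟨y, -, rfl⟩
          exact Subfield.subset_closure (Or.inl (pow_mem_pSpan g y))
        · rintro _ ⟨j, hj, rfl⟩
          rcases Nat.lt_succ_iff_lt_or_eq.1 hj with hj | rfl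
          · exact Subfield.subset_closure (Or.inl (mem_pSpan_of_lt g hj))
          · exact Subfield.subset_closure (Or.inr rfl)
      have h2 := mem_closure_exchange (pow_mem_pSpan g (g M)) h1 hcon
      have h3 : Subfield.closure ((pSpan p M g : Set K) ∪ {x}) ≤ derKer (D M) :=
        Subfield.closure_le.2 (Set.union_subset
          (pSpan_le_derKer (D M) fun j hj => hD.other M j hj.ne' (by omega))
          (Set.singleton_subset_iff.2 (hc M hM)))
      refine hg.ne_zero hMN ?_
      rw [← hD.self M hMN]
      exact h3 h2
  exact key N hr le_rfl hx

end IsDualFamily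

end

section

variable {F : Type} [Field F] {p : ℕ}

theorem pClosure_empty_eq : pClosure F p ∅ = Subfield.closure ((· ^ p) '' ((⊤ : Subfield F) : Set F)) := by
  rw [pClosure, pClosureT, Set.union_empty, Subfield.coe_top, Set.image_univ, pow_one]

theorem finrank_adjoin_le_pow [Fact p.Prime] {k : Subfield F} (hk : ∀ x : F, x ^ p ∈ k)
    (S : Finset F) : FiniteDimensional k (IntermediateField.adjoin k (S : Set F)) ∧
      Module.finrank k (IntermediateField.adjoin k (S : Set F)) ≤ p ^ S.card := by
  classical
  have hint : ∀ x : F, IsIntegral k x := fun x =>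
    IsIntegral.of_pow (Fact.out : p.Prime).pos (isIntegral_algebraMap (x := (⟨x ^ p, hk x⟩ : k)))
  refine ⟨IntermediateField.finiteDimensional_adjoin fun x _ => hint x, ?_⟩
  induction S using Finset.induction_on with
  | empty =>
    rw [Finset.coe_empty, IntermediateField.adjoin_empty, IntermediateField.finrank_bot,
      Finset.card_empty, pow_zero]
  | insert x S hx ih =>
    rw [Finset.coe_insert, Set.insert_eq, IntermediateField.adjoin_union,
      Finset.card_insert_of_notMem hx, pow_succ']
    refine (IntermediateField.finrank_sup_le _ _).trans (Nat.mul_le_mul ?_ ih)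
    rw [IntermediateField.adjoin.finrank (hint x)]
    have hmonic := Polynomial.monic_X_pow_sub_C (⟨x ^ p, hk x⟩ : k) (Fact.out : p.Prime).ne_zero
    refine (Polynomial.natDegree_le_of_dvd (minpoly.dvd k x ?_) hmonic.ne_zero).trans
      Polynomial.natDegree_X_pow_sub_C.le
    rw [map_sub, map_pow, Polynomial.aeval_X, Polynomial.aeval_C]
    exact sub_self _

theorem pIndepFam_of_pIndep [Fact p.Prime] {r : ℕ} {b : Fin r → F}
    (hb : pIndep F p b) {g : ℕ → F} (hg : ∀ j : Fin r, g j = b j) : PIndepFam p r ⊤ g := by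
  classical
  intro i hi hcon
  set k := pClosure F p ∅ with hk
  have hpow : ∀ x : F, x ^ p ∈ k := fun x => by
    rw [hk, pClosure_empty_eq]
    exact Subfield.subset_closure ⟨x, Subfield.mem_top x, rfl⟩
  set S : Finset F := ((Finset.range r).erase i).image g with hS
  have hle : IntermediateField.adjoin k (Set.range b) ≤
      IntermediateField.adjoin k (S : Set F) := by
    rw [IntermediateField.adjoin_le_iff]
    rintro _ ⟨j, rfl⟩
    rw [← hg]
    by_cases hji : (j : ℕ) = i
    · rw [hji]
      refine mem_adjoin_iff_mem_closure.2 (Subfield.closure_mono ?_ hcon)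
      refine Set.union_subset_union ?_ ?_
      · rintro _ ⟨x, -, rfl⟩
        exact hpow x
      · rintro _ ⟨l, hl, rfl⟩
        rw [hS]
        exact Finset.mem_coe.2 (Finset.mem_image_of_mem _
          (Finset.mem_erase.2 ⟨hl.2, Finset.mem_range.2 hl.1⟩))
    · refine IntermediateField.subset_adjoin _ _ (Finset.mem_coe.2 (Finset.mem_image_of_mem _
        (Finset.mem_erase.2 ⟨hji, Finset.mem_range.2 j.2⟩)))
  obtain ⟨hfin, hcard⟩ := finrank_adjoin_le_pow hpow S
  have h1 : Module.finrank k (IntermediateField.adjoin k (Set.range b)) = p ^ r := hb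
  have h2 := Nat.le_of_dvd Module.finrank_pos (IntermediateField.finrank_dvd_of_le_right hle)
  have h3 : S.card < r := by
    refine Finset.card_image_le.trans_lt ?_
    rw [Finset.card_erase_of_mem (Finset.mem_range.2 hi), Finset.card_range]
    omega
  have h4 := Nat.pow_lt_pow_right (Fact.out : p.Prime).one_lt h3
  omega

theorem pSpan_eq_pClosure {r : ℕ} {b : Fin r → F} {g : ℕ → F} (hg : ∀ j : Fin r, g j = b j) :
    pSpan p r g = pClosure F p (Set.range b) := by
  rw [pSpan, pClosure, pClosureT, Subfield.coe_top, Set.image_univ, pow_one]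
  congr 2
  ext x
  constructor
  · rintro ⟨j, hj, rfl⟩
    exact ⟨⟨j, hj⟩, (hg ⟨j, hj⟩).symm⟩
  · rintro ⟨j, rfl⟩
    exact ⟨j, j.2, hg j⟩

end

section

variable {A : Type*} [Ring A] (e : ℕ → A)

/-- The product of the `eⱼ`, `j ∈ J`, `j < k`, in increasing order of the indices. -/
def orderedProd (e : ℕ → A) (J : Finset ℕ) : ℕ → A
  | 0 => 1
  | k + 1 => orderedProd e J k * if k ∈ J then e k else 1

theorem orderedProd_insert_of_le (J : Finset ℕ) {i k : ℕ} (h : k ≤ i) :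
    orderedProd e (insert i J) k = orderedProd e J k := by
  induction k with
  | zero => rfl
  | succ k ih =>
    have hki : k ≠ i := by omega
    rw [orderedProd, orderedProd, ih (by omega)]
    simp [hki]

theorem filter_lt_succ_card (J : Finset ℕ) (k : ℕ) : (J.filter (· < k + 1)).card =
    (J.filter (· < k)).card + if k ∈ J then 1 else 0 := by
  have h : J.filter (· < k + 1) = if k ∈ J then insert k (J.filter (· < k)) else
      J.filter (· < k) := by
    ext x
    split_ifs with hk
    · simp only [Finset.mem_filter, Finset.mem_insert]
      constructor
      · rintro ⟨h1, h2⟩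
        rcases Nat.lt_succ_iff_lt_or_eq.1 h2 with h | h
        · exact Or.inr ⟨h1, h⟩
        · exact Or.inl h
      · rintro (rfl | ⟨h1, h2⟩)
        · exact ⟨hk, Nat.lt_succ_self _⟩
        · exact ⟨h1, by omega⟩
    · simp only [Finset.mem_filter]
      refine and_congr_right fun h1 => ?_
      have : x ≠ k := fun h => hk (h ▸ h1)
      omega
  rw [h]
  split_ifs with hk
  · rw [Finset.card_insert_of_notMem (by simp)]
  · rw [add_zero]

variable {e} (hanti : ∀ i j, e i * e j = -(e j * e i)) (hsq : ∀ i, e i * e i = 0)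

include hanti in
theorem mul_orderedProd_comm (i : ℕ) (J : Finset ℕ) (k : ℕ) :
    e i * orderedProd e J k = (-1 : ℤ) ^ (J.filter (· < k)).card • (orderedProd e J k * e i) := by
  induction k with
  | zero => simp [orderedProd]
  | succ k ih =>
    rw [orderedProd, ← mul_assoc, ih, filter_lt_succ_card, smul_mul_assoc]
    split_ifs with hk
    · rw [mul_assoc, hanti i k, mul_neg, pow_succ, mul_neg_one, neg_smul, smul_neg, mul_assoc]
    · rw [mul_one, mul_one, add_zero]

include hanti hsq in
theorem mul_orderedProd (J : Finset ℕ) {i k : ℕ} (hi : i < k) : e i * orderedProd e J k =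
    if i ∈ J then 0 else posSign i J • orderedProd e (insert i J) k := by
  induction k with
  | zero => omega
  | succ k ih =>
    rw [orderedProd, ← mul_assoc]
    rcases Nat.lt_succ_iff_lt_or_eq.1 hi with hik | rfl
    · rw [ih hik]
      split_ifs with h1 h2 h2
      · rw [zero_mul]
      · rw [zero_mul]
      · rw [orderedProd, if_pos (Finset.mem_insert_of_mem h2), smul_mul_assoc]
      · rw [orderedProd, if_neg, smul_mul_assoc]
        exact fun h => (Finset.mem_insert.1 h).elim hik.ne' h2
    · rw [mul_orderedProd_comm hanti]
      split_ifs with h1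
      · rw [smul_mul_assoc, mul_assoc, hsq, mul_zero, smul_zero]
      · rw [mul_one, orderedProd, if_pos (Finset.mem_insert_self _ _),
          orderedProd_insert_of_le e J le_rfl, posSign]

theorem posSign_erase (i : ℕ) (J : Finset ℕ) : posSign i (J.erase i) = posSign i J := by
  rw [posSign, posSign, Finset.filter_erase, Finset.erase_eq_of_notMem (by simp)]

variable {k L : Type*} [Field k] [Algebra k A] [CommRing L] (φ : L →+* k)

/-- The element `∑_J η_J e_J` attached to a family of coordinates. -/
def formOf (φ : L →+* k) (e : ℕ → A) (N : ℕ) : (Finset ℕ → L) →+ A where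
  toFun η := ∑ J ∈ (Finset.range N).powerset, φ (η J) • orderedProd e J N
  map_zero' := by simp
  map_add' η η' := by
    simp only [Pi.add_apply, map_add, add_smul, Finset.sum_add_distrib]

theorem formOf_apply (N : ℕ) (η : Finset ℕ → L) : formOf φ e N η =
    ∑ J ∈ (Finset.range N).powerset, φ (η J) • orderedProd e J N := rfl

include hanti hsq in
theorem formOf_wdg (N : ℕ) (θ : ℕ → L) (η : Finset ℕ → L) :
    formOf φ e N (wdg θ η) = (∑ i ∈ Finset.range N, φ (θ i) • e i) * formOf φ e N η := by
  have h1 : formOf φ e N (wdg θ η) = ∑ J ∈ (Finset.range N).powerset, ∑ i ∈ J,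
      φ (θ i * η (J.erase i)) • (e i * orderedProd e (J.erase i) N) := by
    rw [formOf_apply]
    refine Finset.sum_congr rfl fun J hJ => ?_
    rw [wdg_apply, map_sum, Finset.sum_smul]
    refine Finset.sum_congr rfl fun i hi => ?_
    rw [mul_orderedProd hanti hsq _ (Finset.mem_range.1 (Finset.mem_powerset.1 hJ hi)),
      if_neg (Finset.notMem_erase i J), Finset.insert_erase hi, posSign_erase, map_zsmul,
      smul_assoc, smul_comm (φ _)]
  have h2 : (∑ i ∈ Finset.range N, φ (θ i) • e i) * formOf φ e N η =
      ∑ i ∈ Finset.range N, ∑ J ∈ (Finset.range N).powerset,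
        φ (θ i * η J) • (e i * orderedProd e J N) := by
    rw [formOf_apply, Finset.sum_mul]
    refine Finset.sum_congr rfl fun i _ => ?_
    rw [Finset.mul_sum]
    refine Finset.sum_congr rfl fun J _ => ?_
    rw [smul_mul_smul_comm, map_mul]
  rw [h1, h2, Finset.sum_comm' (t' := Finset.range N)
    (s' := fun i => (Finset.range N).powerset.filter (i ∈ ·))]
  · refine Finset.sum_congr rfl fun i hi => ?_
    rw [← Finset.sum_filter_add_sum_filter_not (Finset.range N).powerset (i ∈ ·)
      (fun J => φ (θ i * η J) • (e i * orderedProd e J N)), Finset.sum_eq_zero (s :=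
        (Finset.range N).powerset.filter (i ∈ ·)) (f := fun J => φ (θ i * η J) •
          (e i * orderedProd e J N)), zero_add]
    · refine Finset.sum_nbij' (fun J => J.erase i) (fun J => insert i J) ?_ ?_ ?_ ?_ ?_
      · intro J hJ
        rw [Finset.mem_filter, Finset.mem_powerset] at hJ ⊢
        exact ⟨(Finset.erase_subset _ _).trans hJ.1, Finset.notMem_erase _ _⟩
      · intro J hJ
        rw [Finset.mem_filter, Finset.mem_powerset] at hJ ⊢
        exact ⟨Finset.insert_subset hi hJ.1, Finset.mem_insert_self _ _⟩
      · intro J hJ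
        exact Finset.insert_erase (Finset.mem_filter.1 hJ).2
      · intro J hJ
        exact Finset.erase_insert (Finset.mem_filter.1 hJ).2
      · intro J _
        rfl
    · intro J hJ
      rw [mul_orderedProd hanti hsq _ (Finset.mem_range.1 hi),
        if_pos (Finset.mem_filter.1 hJ).2, smul_zero]
  · intro J i
    rw [Finset.mem_filter]
    constructor
    · rintro ⟨hJ, hi⟩
      exact ⟨⟨hJ, hi⟩, Finset.mem_powerset.1 hJ hi⟩
    · rintro ⟨⟨hJ, hi⟩, -⟩
      exact ⟨hJ, hi⟩

theorem formOf_oneForm (N : ℕ) : formOf φ e N (oneForm L) = 1 := by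
  have h0 : ∀ k, orderedProd e ∅ k = 1 := fun k => by
    induction k with
    | zero => rfl
    | succ k ih => simp [orderedProd, ih]
  rw [formOf_apply, Finset.sum_eq_single ∅]
  · rw [oneForm, Pi.single_eq_same, map_one, one_smul, h0]
  · intro J _ hJ
    rw [oneForm, Pi.single_eq_of_ne hJ, map_zero, zero_smul]
  · intro h
    exact absurd (Finset.empty_mem_powerset _) h

end

section

variable {F : Type} [Field F]

/-- The logarithmic form attached to a list of elements. -/
noncomputable def logProd (l : List F) : ExtOmega F :=
  (l.map fun x => ExteriorAlgebra.ι F (x⁻¹ • KaehlerDifferential.D ℤ F x)).prod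

theorem logProd_cons (x : F) (l : List F) : logProd (x :: l) =
    ExteriorAlgebra.ι F (x⁻¹ • KaehlerDifferential.D ℤ F x) * logProd l := by
  rw [logProd, List.map_cons, List.prod_cons, logProd]

theorem logForm_eq_logProd {n : ℕ} (x : Fin n → F) : logForm F x = logProd (List.ofFn x) := by
  rw [logForm, logProd, List.map_ofFn]
  rfl

theorem nuPow_natCast (n : ℕ) : nuPow F n = AddSubgroup.closure
    {ω | ∃ l : List F, l.length = n ∧ (∀ x ∈ l, x ≠ 0) ∧ ω = logProd l} := by
  rw [nuPow, if_pos (Int.natCast_nonneg n)]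
  congr 1
  ext ω
  constructor
  · rintro ⟨x, hx, rfl⟩
    refine ⟨List.ofFn x, by simp, ?_, logForm_eq_logProd x⟩
    intro y hy
    obtain ⟨i, rfl⟩ := (List.mem_ofFn' _ _).1 hy
    exact hx i
  · rintro ⟨l, hl, hx, rfl⟩
    have hl' : l.length = (n : ℤ).toNat := by simpa using hl
    subst hl
    refine ⟨fun i => l.get (i.cast hl'.symm), fun i => hx _ (List.get_mem _ _), ?_⟩
    rw [logForm_eq_logProd]
    congr 1
    apply List.ext_get <;> simp

theorem logProd_mem_nuPow {l : List F} (hl : ∀ x ∈ l, x ≠ 0) : logProd l ∈ nuPow F l.length := by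
  rw [nuPow_natCast]
  exact AddSubgroup.subset_closure ⟨l, rfl, hl, rfl⟩

theorem logProd_mem_omegaPow (l : List F) : logProd l ∈ OmegaPow F l.length := by
  rw [OmegaPow, if_pos (Int.natCast_nonneg _), Int.toNat_natCast]
  induction l with
  | nil => simp [logProd, Submodule.one_eq_range, exteriorPower]
  | cons x l ih =>
    rw [logProd_cons, List.length_cons, exteriorPower, pow_succ']
    exact Submodule.mul_mem_mul (LinearMap.mem_range_self _ _) ih

theorem exists_finset_of_mem_nuPow {n : ℕ} {ω : ExtOmega F} (hω : ω ∈ nuPow F n) :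
    ∃ X : Finset F, ω ∈ AddSubgroup.closure {ω | ∃ l : List F, l.length = n ∧
      (∀ x ∈ l, x ≠ 0) ∧ (∀ x ∈ l, x ∈ X) ∧ ω = logProd l} := by
  classical
  have hmono : ∀ X Y : Finset F, X ⊆ Y → AddSubgroup.closure {ω | ∃ l : List F, l.length = n ∧
      (∀ x ∈ l, x ≠ 0) ∧ (∀ x ∈ l, x ∈ X) ∧ ω = logProd l} ≤
      AddSubgroup.closure {ω | ∃ l : List F, l.length = n ∧
      (∀ x ∈ l, x ≠ 0) ∧ (∀ x ∈ l, x ∈ Y) ∧ ω = logProd l} := by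
    intro X Y h
    refine AddSubgroup.closure_mono ?_
    rintro _ ⟨l, h1, h2, h3, rfl⟩
    exact ⟨l, h1, h2, fun x hx => h (h3 x hx), rfl⟩
  rw [nuPow_natCast] at hω
  induction hω using AddSubgroup.closure_induction with
  | mem ω hω =>
    obtain ⟨l, h1, h2, rfl⟩ := hω
    exact ⟨l.toFinset, AddSubgroup.subset_closure
      ⟨l, h1, h2, fun x hx => List.mem_toFinset.2 hx, rfl⟩⟩
  | zero => exact ⟨∅, zero_mem _⟩
  | add x y _ _ hx hy =>
    obtain ⟨X, hX⟩ := hx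
    obtain ⟨Y, hY⟩ := hy
    exact ⟨X ∪ Y, add_mem (hmono _ _ Finset.subset_union_left hX)
      (hmono _ _ Finset.subset_union_right hY)⟩
  | neg x _ hx =>
    obtain ⟨X, hX⟩ := hx
    exact ⟨X, neg_mem hX⟩

/-- `dx/x` in terms of the logarithmic differentials of a `p`-basis. -/
theorem IsDualFamily.sum_smul_logDeriv {p N : ℕ} [CharP F p] {g : ℕ → F}
    {D : ℕ → Derivation ℤ F F} (hD : IsDualFamily N g D) (hg : ∀ j < N, g j ≠ 0)
    {x : F} (hx : x ∈ pSpan p N g) :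
    ∑ i ∈ Finset.range N, D i x • ((g i)⁻¹ • KaehlerDifferential.D ℤ F (g i)) =
      KaehlerDifferential.D ℤ F x := by
  let Δ : Derivation ℤ F (Ω[F⁄ℤ]) := KaehlerDifferential.D ℤ F - ∑ i ∈ Finset.range N,
    (LinearMap.toSpanSingleton F (Ω[F⁄ℤ])
      ((g i)⁻¹ • KaehlerDifferential.D ℤ F (g i))).compDer (D i)
  have hΔ : ∀ y, Δ y = KaehlerDifferential.D ℤ F y - ∑ i ∈ Finset.range N,
      D i y • ((g i)⁻¹ • KaehlerDifferential.D ℤ F (g i)) := by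
    intro y
    simp only [Δ, Derivation.sub_apply]
    congr 1
    rw [← Derivation.coeFnAddMonoidHom_apply, map_sum, Finset.sum_apply]
    rfl
  have h := pSpan_le_derKer (p := p) (g := g) (N := N) Δ (fun j hj => by
    rw [hΔ, Finset.sum_eq_single j, hD.self j hj, smul_smul, mul_inv_cancel₀ (hg j hj), one_smul,
      sub_self]
    · intro i _ hij
      rw [hD.other i j hij hj, zero_smul]
    · intro h
      exact absurd (Finset.mem_range.2 hj) h) hx
  rw [mem_derKer, hΔ, sub_eq_zero] at h
  exact h.symm

theorem formOf_wdg_dl {p N : ℕ} [Fact p.Prime] [CharP F p] {g : ℕ → F}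
    {D : ℕ → Derivation ℤ F F} (hD : IsDualFamily N g D) (hg : ∀ j < N, g j ≠ 0)
    (x : pSpan p N g) (η : Finset ℕ → pSpan p N g) :
    formOf (pSpan p N g).subtype
      (fun i => ExteriorAlgebra.ι F ((g i)⁻¹ • KaehlerDifferential.D ℤ F (g i))) N
      (wdg (dl (dualRestrict hD) x) η) =
    ExteriorAlgebra.ι F ((x : F)⁻¹ • KaehlerDifferential.D ℤ F x) *
    formOf (pSpan p N g).subtype
      (fun i => ExteriorAlgebra.ι F ((g i)⁻¹ • KaehlerDifferential.D ℤ F (g i))) N η := by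
  rw [formOf_wdg (fun i j => eq_neg_of_add_eq_zero_left (ExteriorAlgebra.ι_add_mul_swap _ _))
    (fun i => ExteriorAlgebra.ι_sq_zero _)]
  congr 1
  rw [← hD.sum_smul_logDeriv hg x.2, Finset.smul_sum, map_sum]
  refine Finset.sum_congr rfl fun i _ => ?_
  rw [smul_smul, map_smul (ExteriorAlgebra.ι F) ((x : F)⁻¹ * D i x)]
  congr 1
  rw [dl, map_div₀, Subfield.coe_subtype, hD.coe_dualRestrict_apply, div_eq_inv_mul]

theorem formOf_logCoord {p N : ℕ} [Fact p.Prime] [CharP F p] {g : ℕ → F}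
    {D : ℕ → Derivation ℤ F F} (hD : IsDualFamily N g D) (hg : ∀ j < N, g j ≠ 0)
    (l : List (pSpan p N g)) :
    formOf (pSpan p N g).subtype
      (fun i => ExteriorAlgebra.ι F ((g i)⁻¹ • KaehlerDifferential.D ℤ F (g i))) N
      (logCoord (dualRestrict hD) l) = logProd (l.map (↑)) := by
  induction l with
  | nil => rw [logCoord_nil, formOf_oneForm]; rfl
  | cons x l ih => rw [logCoord_cons, formOf_wdg_dl hD hg, ih, List.map_cons, logProd_cons]

end

section

variable {F : Type} [Field F] {E : Type} [Field E] [Algebra F E]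

theorem resMap_ι (w : Ω[F⁄ℤ]) : resMap F E (ExteriorAlgebra.ι F w) =
    ExteriorAlgebra.ι E (KaehlerDifferential.map ℤ ℤ F E w) := by
  let : Algebra F (ExtOmega E) :=
    ((algebraMap E (ExtOmega E)).comp (algebraMap F E)).toAlgebra'
      (fun c x => Algebra.commutes (algebraMap F E c) x)
  exact ExteriorAlgebra.lift_ι_apply F _ _ w

theorem resMap_logDeriv (x : F) :
    resMap F E (ExteriorAlgebra.ι F (x⁻¹ • KaehlerDifferential.D ℤ F x)) =
      ExteriorAlgebra.ι E ((algebraMap F E x)⁻¹ • KaehlerDifferential.D ℤ E (algebraMap F E x)) := by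
  rw [resMap_ι, map_smul, KaehlerDifferential.map_D, ← algebraMap_smul E, map_inv₀]

theorem resMap_logProd (l : List F) :
    resMap F E (logProd l) = logProd (l.map (algebraMap F E)) := by
  induction l with
  | nil => exact map_one _
  | cons x l ih => rw [logProd_cons, map_mul, ih, resMap_logDeriv, List.map_cons, logProd_cons]

/-- The action of differential forms on families of coordinates defined by derivations. -/
noncomputable def coordHom (D : ℕ → Derivation ℤ E E) :
    ExtOmega E →ₐ[E] Module.End E (Finset ℕ → E) :=
  ExteriorAlgebra.lift E ⟨{
    toFun := fun w => wdg fun i => (D i).liftKaehlerDifferential w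
    map_add' := fun v w => LinearMap.ext fun η => funext fun J => by
      simp only [wdg_apply, LinearMap.add_apply, Pi.add_apply, map_add, add_mul, smul_add,
        Finset.sum_add_distrib]
    map_smul' := fun c w => LinearMap.ext fun η => funext fun J => by
      simp only [wdg_apply, LinearMap.smul_apply, Pi.smul_apply, map_smul, RingHom.id_apply,
        smul_eq_mul, mul_assoc, Finset.mul_sum, mul_smul_comm] },
    fun w => LinearMap.ext fun η => wdg_wdg_self _ η⟩

theorem coordHom_logDeriv (D : ℕ → Derivation ℤ E E) (x : E) :
    coordHom D (ExteriorAlgebra.ι E (x⁻¹ • KaehlerDifferential.D ℤ E x)) = wdg (dl D x) := by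
  rw [coordHom, ExteriorAlgebra.lift_ι_apply]
  change wdg _ = _
  congr 1
  ext i
  rw [map_smul, Derivation.liftKaehlerDifferential_comp_D, dl, smul_eq_mul, div_eq_inv_mul]

theorem coordHom_logProd (D : ℕ → Derivation ℤ E E) (l : List E) :
    coordHom D (logProd l) (oneForm E) = logCoord D l := by
  induction l with
  | nil => rw [logCoord_nil]; simp [logProd]
  | cons x l ih =>
    rw [logProd_cons, map_mul, coordHom_logDeriv, Module.End.mul_apply, ih, logCoord_cons]

/-- Compatibility of logarithmic coordinates with a homomorphism commuting with the derivations
of index at least `r`. -/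
theorem logCoord_map {L : Type*} [Field L] (φ : L →+* E) {r : ℕ} {D : ℕ → Derivation ℤ L L}
    {D' : ℕ → Derivation ℤ E E} (hD : ∀ i, r ≤ i → ∀ x, D' i (φ x) = φ (D i x)) (l : List L)
    {J : Finset ℕ} (hJ : Disjoint J (Finset.range r)) :
    logCoord D' (l.map φ) J = φ (logCoord D l J) := by
  induction l generalizing J with
  | nil =>
    rw [List.map_nil, logCoord_nil, logCoord_nil, oneForm, oneForm]
    by_cases h : J = ∅
    · rw [h, Pi.single_eq_same, Pi.single_eq_same, map_one]
    · rw [Pi.single_eq_of_ne h, Pi.single_eq_of_ne h, map_zero]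
  | cons x l ih =>
    rw [List.map_cons, logCoord_cons, logCoord_cons, wdg_apply, wdg_apply, map_sum]
    refine Finset.sum_congr rfl fun i hi => ?_
    have hir : r ≤ i := not_lt.1 fun h => Finset.disjoint_left.1 hJ hi (Finset.mem_range.2 h)
    rw [ih (hJ.mono_left (Finset.erase_subset i J)), dl, dl, hD i hir, map_zsmul, map_mul, map_div₀]

end

section

variable {F : Type} [Field F] {p N : ℕ} [Fact p.Prime] [CharP F p] {g : ℕ → F}

omit [CharP F p] in
theorem exists_root_mem_pSpan (hF : ∀ x : F, ∃ y : F, y ^ (p - 1) = x) (x : pSpan p N g) :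
    ∃ y : pSpan p N g, y ^ (p - 1) = x := by
  obtain ⟨u, hu⟩ := hF x
  rcases eq_or_ne u 0 with rfl | hu0
  · exact ⟨0, Subtype.ext (by rw [← hu]; rfl)⟩
  · have hp : p = p - 1 + 1 := (Nat.succ_pred_prime Fact.out).symm
    have : u = u ^ p / x := by
      rw [← hu, hp, Nat.add_sub_cancel, pow_succ, mul_div_cancel_left₀ _ (pow_ne_zero _ hu0)]
    refine ⟨⟨u, ?_⟩, Subtype.ext hu⟩
    rw [this]
    exact div_mem (pow_mem_pSpan g u) x.2

/-- Derivations of `F(β₀, …, β_{r-1})` extending the dual derivations of index at least `r`. -/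
theorem exists_derivation_adjoin (hg : PIndepFam p N ⊤ g) {D : ℕ → Derivation ℤ F F}
    (hD : IsDualFamily N g D) {r : ℕ} (hr : r ≤ N) (m : Fin r → ℕ) (hm : ∀ i, 1 ≤ m i)
    (β : Fin r → AlgebraicClosure F)
    (hβ : ∀ i, β i ^ p ^ m i = algebraMap F (AlgebraicClosure F) (g i)) :
    ∃ D' : ℕ → Derivation ℤ (IntermediateField.adjoin F (Set.range β))
      (IntermediateField.adjoin F (Set.range β)),
      ∀ i, r ≤ i → ∀ x ∈ pSpan p N g, D' i (algebraMap F _ x) = algebraMap F _ (D i x) := by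
  have : CharP (AlgebraicClosure F) p := charP_of_injective_algebraMap
    (algebraMap F (AlgebraicClosure F)).injective p
  set E := IntermediateField.adjoin F (Set.range β) with hE
  have : CharP E p := charP_of_injective_algebraMap (algebraMap F E).injective p
  let β' : ℕ → AlgebraicClosure F := fun j => if h : j < r then β ⟨j, h⟩ else 0
  let m' : ℕ → ℕ := fun j => if h : j < r then m ⟨j, h⟩ else 0
  let βE : Fin r → E := fun j => ⟨β j, IntermediateField.subset_adjoin _ _ ⟨j, rfl⟩⟩
  let gE : ℕ → E := fun j => if h : j < r then βE ⟨j, h⟩ else algebraMap F E (g j)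
  have hβE : ∀ j, βE j ^ p ^ m j = algebraMap F E (g j) := fun j => Subtype.ext (hβ j)
  have h1 := (pIndepFam_map_iff (algebraMap F (AlgebraicClosure F)) g).2 hg
  have h2 := h1.adjoin_roots (fun i _ => ⟨g i, rfl⟩) m' β' r hr (fun j hj => by
    simp only [β', m', dif_pos hj]
    exact hβ ⟨j, hj⟩)
  have h3 : Subfield.closure (((algebraMap F (AlgebraicClosure F)).fieldRange :
      Set (AlgebraicClosure F)) ∪ β' '' {j | j < r}) = (algebraMap E (AlgebraicClosure F)).fieldRange := by
    have h4 : β' '' {j | j < r} = Set.range β := by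
      ext x
      constructor
      · rintro ⟨j, hj, rfl⟩
        exact ⟨⟨j, hj⟩, (show β' j = β ⟨j, hj⟩ from dif_pos hj).symm⟩
      · rintro ⟨j, rfl⟩
        exact ⟨j, j.2, dif_pos j.2⟩
    rw [h4, RingHom.coe_fieldRange, ← IntermediateField.adjoin_toSubfield]
    ext x
    constructor
    · exact fun hx => ⟨⟨x, hx⟩, rfl⟩
    · rintro ⟨y, rfl⟩
      exact y.2
  have h5 : (fun j => if j < r then β' j else ((algebraMap F (AlgebraicClosure F)) ∘ g) j) =
      (algebraMap E (AlgebraicClosure F)) ∘ gE := by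
    ext j
    by_cases hj : j < r
    · simp only [if_pos hj, Function.comp, gE, dif_pos hj, β']
      rfl
    · simp only [if_neg hj, Function.comp, gE, dif_neg hj]
      rfl
  rw [h3, h5, pIndepFam_map_iff] at h2
  obtain ⟨D', hD0, hD1, hD2⟩ := h2.exists_derivation
  have hD' : IsDualFamily N gE D' := ⟨hD0, hD1, hD2⟩
  refine ⟨D', fun i hi x hx => ?_⟩
  let Δ : Derivation ℤ F E := (D' i).compAlgebraMap F - (Algebra.linearMap F E).compDer (D i)
  have hΔ : ∀ y, Δ y = D' i (algebraMap F E y) - algebraMap F E (D i y) := fun y => rfl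
  have h := pSpan_le_derKer (p := p) (g := g) (N := N) Δ (fun j hj => by
    rw [hΔ, sub_eq_zero]
    by_cases hjr : j < r
    · rw [hD.other i j (by omega) hj, map_zero, ← hβE ⟨j, hjr⟩]
      obtain ⟨t, ht⟩ := Nat.exists_eq_add_of_le' (hm ⟨j, hjr⟩)
      rw [ht, pow_succ, pow_mul]
      exact pow_mem_derKer p (D' i) _
    · have h6 : gE j = algebraMap F E (g j) := dif_neg hjr
      rw [← h6, hD'.apply_eq_ite i hj, hD.apply_eq_ite i hj, h6]
      split_ifs
      · rfl
      · rw [map_zero]) hx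
  rwa [mem_derKer, hΔ, sub_eq_zero] at h

end

section

variable {F : Type} [Field F] {p N : ℕ} [Fact p.Prime] [CharP F p] {g : ℕ → F}

/-- Coordinates of a logarithmic form with entries in `pSpan p N g`, and their compatibility
with the restriction to an extension field. -/
theorem exists_coord_of_mem_closure {E : Type} [Field E] [Algebra F E]
    (hg : PIndepFam p N ⊤ g) {D : ℕ → Derivation ℤ F F} (hD : IsDualFamily N g D)
    {D' : ℕ → Derivation ℤ E E} {r : ℕ}
    (hD' : ∀ i, r ≤ i → ∀ x ∈ pSpan p N g, D' i (algebraMap F E x) = algebraMap F E (D i x))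
    {n : ℕ} {ω : ExtOmega F} (hω : ω ∈ AddSubgroup.closure {ω | ∃ l : List F, l.length = n ∧
      (∀ x ∈ l, x ≠ 0) ∧ (∀ x ∈ l, x ∈ pSpan p N g) ∧ ω = logProd l}) :
    ∃ η ∈ cartierFixed p N (dualRestrict hD (p := p)),
      (∀ J, η J ≠ 0 → J.card = n ∧ J ⊆ Finset.range N) ∧
      formOf (pSpan p N g).subtype
        (fun i => ExteriorAlgebra.ι F ((g i)⁻¹ • KaehlerDifferential.D ℤ F (g i))) N η = ω ∧
      ∀ J, Disjoint J (Finset.range r) →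
        coordHom D' (resMap F E ω) (oneForm E) J = algebraMap F E (η J) := by
  have hT := hD.isToral hg
  induction hω using AddSubgroup.closure_induction with
  | mem ω hω =>
    obtain ⟨l, hl, h0, hmem, rfl⟩ := hω
    lift l to List (pSpan p N g) using hmem
    refine ⟨logCoord (dualRestrict hD) l, hT.logCoord_mem_cartierFixed l ?_, ?_, ?_, ?_⟩
    · exact fun x hx h => h0 x (List.mem_map_of_mem hx) (by rw [h]; rfl)
    · intro J hJ
      rw [← hl, List.length_map]
      exact logCoord_support hT.zero l J hJ
    · exact formOf_logCoord hD (fun j hj => hg.ne_zero hj) l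
    · intro J hJ
      rw [resMap_logProd, coordHom_logProd, List.map_map]
      exact logCoord_map ((algebraMap F E).comp (pSpan p N g).subtype)
        (fun i hi x => hD' i hi x x.2) l hJ
  | zero =>
    refine ⟨0, zero_mem _, fun J hJ => absurd rfl hJ, map_zero _, fun J _ => ?_⟩
    simp
  | add x y _ _ hx hy =>
    obtain ⟨η, h1, h2, h3, h4⟩ := hx
    obtain ⟨θ, k1, k2, k3, k4⟩ := hy
    refine ⟨η + θ, add_mem h1 k1, fun J hJ => ?_, by rw [map_add, h3, k3], fun J hJ => ?_⟩
    · by_cases h : η J = 0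
      · exact k2 J fun h' => hJ (by rw [Pi.add_apply, h, h', add_zero])
      · exact h2 J h
    · simp only [map_add, LinearMap.add_apply, Pi.add_apply, h4 J hJ, k4 J hJ, Subfield.coe_add]
  | neg x _ hx =>
    obtain ⟨η, h1, h2, h3, h4⟩ := hx
    refine ⟨-η, neg_mem h1, fun J hJ => h2 J (neg_ne_zero.1 hJ), by rw [map_neg, h3],
      fun J hJ => ?_⟩
    simp only [map_neg, LinearMap.neg_apply, Pi.neg_apply, h4 J hJ, Subfield.coe_neg]

theorem logForm_mul_mem {E : Type} [Field E] [Algebra F E] {y : Fin 1 → F} (hy : y 0 ≠ 0)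
    (hyE : KaehlerDifferential.D ℤ E (algebraMap F E (y 0)) = 0) {n : ℕ} {χ : ExtOmega F}
    (hχ : χ ∈ nuPow F ((n : ℤ) - 1)) : logForm F y * χ ∈ nuKer F E n := by
  have hy1 : logForm F y = ExteriorAlgebra.ι F ((y 0)⁻¹ • KaehlerDifferential.D ℤ F (y 0)) := by
    rw [logForm_eq_logProd]
    simp [logProd]
  have hres : resMap F E (logForm F y) = 0 := by
    rw [hy1, resMap_logDeriv, hyE, smul_zero, map_zero]
  have key : logForm F y * χ ∈ (OmegaPow F n).toAddSubgroup ⊓ nuPow F n := by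
    rcases n with _ | n
    · rw [nuPow, if_neg (by simp)] at hχ
      rw [AddSubgroup.mem_bot.1 hχ, mul_zero]
      exact zero_mem _
    · rw [Nat.cast_succ, add_sub_cancel_right, nuPow_natCast] at hχ
      induction hχ using AddSubgroup.closure_induction with
      | mem ω hω =>
        obtain ⟨l, rfl, h0, rfl⟩ := hω
        rw [hy1, ← logProd_cons]
        refine ⟨logProd_mem_omegaPow (y 0 :: l), logProd_mem_nuPow (l := y 0 :: l) ?_⟩
        rintro x hx
        rcases List.mem_cons.1 hx with rfl | hx
        · exact hy
        · exact h0 x hx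
      | zero => rw [mul_zero]; exact zero_mem _
      | add a b _ _ ha hb => rw [mul_add]; exact add_mem ha hb
      | neg a _ ha => rw [mul_neg]; exact neg_mem ha
  exact ⟨⟨key.1, by rw [map_mul, hres, zero_mul]⟩, key.2⟩

theorem logWedgeNu_subset_nuKer {E : Type} [Field E] [Algebra F E] {K : Set F}
    (hK : ∀ x ∈ K, KaehlerDifferential.D ℤ E (algebraMap F E x) = 0) (n : ℕ) :
    ((logWedgeNu F K 1 ((n : ℤ) - 1) : AddSubgroup (ExtOmega F)) : Set (ExtOmega F)) ⊆
      nuKer F E n := by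
  intro ω hω
  induction hω using AddSubgroup.closure_induction with
  | mem ω hω =>
    obtain ⟨y, hy, χ, hχ, rfl⟩ := hω
    exact logForm_mul_mem (hy 0).2 (hK _ (hy 0).1) hχ
  | zero => exact ⟨⟨zero_mem _, map_zero _⟩, zero_mem _⟩
  | add a b _ _ ha hb =>
    exact ⟨⟨add_mem ha.1.1 hb.1.1, by rw [map_add, ha.1.2, hb.1.2, add_zero]⟩, add_mem ha.2 hb.2⟩
  | neg a _ ha => exact ⟨⟨neg_mem ha.1.1, by rw [map_neg, ha.1.2, neg_zero]⟩, neg_mem ha.2⟩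

omit [Fact p.Prime] in
theorem D_algebraMap_eq_zero {E : Type} [Field E] [Algebra F E] {r : ℕ} {b : Fin r → F}
    {m : Fin r → ℕ} (hm : ∀ i, 1 ≤ m i) (β : Fin r → E)
    (hβ : ∀ i, β i ^ p ^ m i = algebraMap F E (b i)) {x : F}
    (hx : x ∈ pClosure F p (Set.range b)) :
    KaehlerDifferential.D ℤ E (algebraMap F E x) = 0 := by
  have : CharP E p := charP_of_injective_algebraMap (algebraMap F E).injective p
  have h : pClosure F p (Set.range b) ≤
      derKer ((KaehlerDifferential.D ℤ E).compAlgebraMap F) := by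
    refine Subfield.closure_le.2 (Set.union_subset ?_ ?_)
    · rintro _ ⟨y, rfl⟩
      simp only [pow_one]
      exact pow_mem_derKer p _ y
    · rintro _ ⟨i, rfl⟩
      change KaehlerDifferential.D ℤ E (algebraMap F E (b i)) = 0
      obtain ⟨t, ht⟩ := Nat.exists_eq_add_of_le' (hm i)
      rw [← hβ, ht, pow_succ, pow_mul]
      exact pow_mem_derKer p (KaehlerDifferential.D ℤ E) _
  exact h hx

theorem formOf_mem_logWedgeNu (hF : ∀ x : F, ∃ y : F, y ^ (p - 1) = x)
    (hg : PIndepFam p N ⊤ g) {D : ℕ → Derivation ℤ F F} (hD : IsDualFamily N g D)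
    {r : ℕ} (hr : r ≤ N) {n : ℕ} {η : Finset ℕ → pSpan p N g}
    (hη : η ∈ cartierFixed p N (dualRestrict hD (p := p)))
    (hsupp : ∀ J, η J ≠ 0 → J.card = n ∧ J ⊆ Finset.range N)
    (h0 : ∀ J, Disjoint J (Finset.range r) → η J = 0) :
    formOf (pSpan p N g).subtype
      (fun i => ExteriorAlgebra.ι F ((g i)⁻¹ • KaehlerDifferential.D ℤ F (g i))) N η ∈
      logWedgeNu F (pSpan p r g) 1 ((n : ℤ) - 1) := by
  have hT := hD.isToral hg
  have key := hT.mem_closure_logCoord (exists_root_mem_pSpan hF) n r η hη hsupp h0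
  clear hη hsupp h0
  induction key using AddSubgroup.closure_induction with
  | mem ξ hξ =>
    obtain ⟨y, hy, hy0, l, rfl, hl, rfl⟩ := hξ
    refine AddSubgroup.subset_closure ⟨fun _ => y, fun _ => ⟨?_, ?_⟩, logProd (l.map (↑)), ?_, ?_⟩
    · refine hD.mem_pSpan_of_const hg hr y.2 fun i hi => ?_
      have h := hy i hi
      rw [← hD.coe_dualRestrict_apply i y, h]
      rfl
    · exact fun h => hy0 (Subtype.ext h)
    · rw [Nat.cast_succ, add_sub_cancel_right, ← List.length_map (f := ((↑) : pSpan p N g → F))]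
      refine logProd_mem_nuPow fun x hx => ?_
      obtain ⟨z, hz, rfl⟩ := List.mem_map.1 hx
      exact fun h => hl z hz (Subtype.ext h)
    · rw [formOf_wdg_dl hD fun j hj => hg.ne_zero hj,
        formOf_logCoord hD fun j hj => hg.ne_zero hj, logForm_eq_logProd]
      simp [logProd]
  | zero => rw [map_zero]; exact zero_mem _
  | add a b _ _ ha hb => rw [map_add]; exact add_mem ha hb
  | neg a _ ha => rw [map_neg]; exact neg_mem ha

end

/-- Proposition 5.3, second part. Assume `F^{p−1} = F`. For a
`p`-independent family `{b₁,…,b_r} ⊆ F`, `m₁,…,m_r ≥ 1` and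
`E = F(b₁^{1/p^{m₁}}, …, b_r^{1/p^{m_r}})` inside an algebraic closure of `F`:
`ν_n(E/F) = [dx/x ∣ x ∈ F^p(b₁,…,b_r)^*] ∧ ν_{n−1}(F)`. -/
theorem stmt15 (F : Type) [Field F] (p : ℕ) [Fact p.Prime] [CharP F p]
    (hF : ∀ x : F, ∃ y : F, y ^ (p - 1) = x)
    (n r : ℕ) (b : Fin r → F) (hb : pIndep F p b)
    (m : Fin r → ℕ) (hm : ∀ i, 1 ≤ m i)
    (β : Fin r → AlgebraicClosure F)
    (hβ : ∀ i, β i ^ p ^ m i = algebraMap F (AlgebraicClosure F) (b i)) :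
    nuKer F (IntermediateField.adjoin F (Set.range β)) n =
      ((logWedgeNu F (pClosure F p (Set.range b)) 1 ((n : ℤ) - 1) :
        AddSubgroup (ExtOmega F)) : Set (ExtOmega F)) := by
  refine Set.Subset.antisymm ?_ (logWedgeNu_subset_nuKer (fun x hx => D_algebraMap_eq_zero hm
    (fun i => (⟨β i, IntermediateField.subset_adjoin _ _ ⟨i, rfl⟩⟩ :
      IntermediateField.adjoin F (Set.range β))) (fun i => Subtype.ext (hβ i)) hx) n)
  rintro ω ⟨⟨-, hres⟩, hω⟩
  let g₀ : ℕ → F := fun j => if h : j < r then b ⟨j, h⟩ else 0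
  have hg₀ : ∀ j : Fin r, g₀ j = b j := fun j => dif_pos j.2
  obtain ⟨X, hX⟩ := exists_finset_of_mem_nuPow hω
  obtain ⟨N, hr, g, hgg, hg, hgX⟩ := (pIndepFam_of_pIndep hb hg₀).exists_extension X
  have hgb : ∀ j : Fin r, g j = b j := fun j => (hgg j j.2).trans (hg₀ j)
  obtain ⟨D, hD0, hD1, hD2⟩ := hg.exists_derivation
  have hD : IsDualFamily N g D := ⟨hD0, hD1, hD2⟩
  obtain ⟨D', hD'⟩ := exists_derivation_adjoin hg hD hr m hm β fun i => by rw [hβ, hgb]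
  have hX' : ω ∈ AddSubgroup.closure {ω | ∃ l : List F, l.length = n ∧
      (∀ x ∈ l, x ≠ 0) ∧ (∀ x ∈ l, x ∈ pSpan p N g) ∧ ω = logProd l} := by
    refine AddSubgroup.closure_mono ?_ hX
    rintro _ ⟨l, h1, h2, h3, rfl⟩
    exact ⟨l, h1, h2, fun x hx => hgX x (h3 x hx), rfl⟩
  obtain ⟨η, h1, h2, rfl, h4⟩ := exists_coord_of_mem_closure hg hD hD' hX'
  rw [← pSpan_eq_pClosure hgb]
  refine formOf_mem_logWedgeNu hF hg hD hr h1 h2 fun J hJ => ?_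
  have h5 := h4 J hJ
  rw [hres, map_zero, LinearMap.zero_apply, Pi.zero_apply, eq_comm, map_eq_zero] at h5
  exact Subtype.ext h5
end

section
/- Let F be a field of characteristic p > 0, let b_1, ..., b_r, b ∈ F ∖ F^p be such that {b_1, ..., b_r} is p-independent and b ∈ F^p(b_1, ..., b_r), let m_1, ..., m_r, m ∈ ℕ with m ≤ m_1, ..., m ≤ m_r, and set E = F(b_1^{1/p^{m_1}}, ..., b_r^{1/p^{m_r}}, b^{1/p^m}) inside an algebraic closure of F. If there exists t ∈ ℕ with t ≥ m and b ∈ F^{p^t}(b_1, ..., b_r), then E = F(b_1^{1/p^{m_1}}, ..., b_r^{1/p^{m_r}}); in particular E/F is modular. -/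
set_option synthInstance.maxHeartbeats 1000000
set_option maxHeartbeats 1000000

open ExteriorAlgebra

/-- A purely inseparable extension `E/F` (inside an algebraic closure of `F`) is modular if
`E = F(c₁^{1/p^{s₁}}, …, c_q^{1/p^{s_q}})` for some `p`-independent `{c₁,…,c_q} ⊆ F`. -/
def IsModular (F : Type) [Field F] (p : ℕ)
    (E : IntermediateField F (AlgebraicClosure F)) : Prop :=
  ∃ (q : ℕ) (s : Fin q → ℕ) (c : Fin q → F) (δ : Fin q → AlgebraicClosure F),
    pIndep F p c ∧ (∀ i, δ i ^ p ^ s i = algebraMap F (AlgebraicClosure F) (c i)) ∧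
    E = IntermediateField.adjoin F (Set.range δ)

/-- If the subfield `K` contains `F` and `p^n`-th roots of all elements of `C`, and `n ≤ t`, then
it contains `p^n`-th roots of all elements of `F^{p^t}(C)`. -/
theorem exists_mem_pow_eq_of_mem_pClosureT {F L : Type} [Field F] [Field L] [Algebra F L] {p : ℕ}
    [ExpChar L p] (K : IntermediateField F L) {n t : ℕ} (hnt : n ≤ t) {C : Set F}
    (hC : ∀ c ∈ C, ∃ y ∈ K, y ^ p ^ n = algebraMap F L c) {x : F} (hx : x ∈ pClosureT F p t C) :
    ∃ y ∈ K, y ^ p ^ n = algebraMap F L x := by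
  have hsub : pClosureT F p t C ≤
      (K.toSubfield.map (iterateFrobenius L p n)).comap (algebraMap F L) := by
    refine Subfield.closure_le.mpr ?_
    rintro _ (⟨z, rfl⟩ | hc)
    · refine ⟨algebraMap F L (z ^ p ^ (t - n)), K.algebraMap_mem _, ?_⟩
      rw [iterateFrobenius_def, ← map_pow, ← pow_mul, ← pow_add, Nat.sub_add_cancel hnt]
    · exact hC _ hc
  exact hsub hx

/-- Theorem 5.4(a). Let `b₁,…,b_r, b ∈ F ∖ F^p` with `{b₁,…,b_r}`
`p`-independent and `b ∈ F^p(b₁,…,b_r)`, let `m ≤ m₁,…,m_r` and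
`E = F(b₁^{1/p^{m₁}}, …, b_r^{1/p^{m_r}}, b^{1/p^m})`. If `b ∈ F^{p^t}(b₁,…,b_r)` for some
`t ≥ m`, then `E = F(b₁^{1/p^{m₁}}, …, b_r^{1/p^{m_r}})`; in particular `E/F` is modular. -/
theorem stmt16 (F : Type) [Field F] (p : ℕ) [Fact p.Prime] [CharP F p]
    (r : ℕ) (b : Fin r → F) (b₀ : F)
    (hbF : ∀ i, b i ∉ pClosure F p ∅) (hb₀F : b₀ ∉ pClosure F p ∅)
    (hind : pIndep F p b) (hmem : b₀ ∈ pClosure F p (Set.range b))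
    (m : Fin r → ℕ) (m₀ : ℕ) (hm : ∀ i, 1 ≤ m i) (hm₀ : 1 ≤ m₀)
    (hle : ∀ i, m₀ ≤ m i)
    (β : Fin r → AlgebraicClosure F) (γ : AlgebraicClosure F)
    (hβ : ∀ i, β i ^ p ^ m i = algebraMap F (AlgebraicClosure F) (b i))
    (hγ : γ ^ p ^ m₀ = algebraMap F (AlgebraicClosure F) b₀)
    (t : ℕ) (ht : m₀ ≤ t) (htb : b₀ ∈ pClosureT F p t (Set.range b)) :
    IntermediateField.adjoin F (Set.range β ∪ {γ}) =
        IntermediateField.adjoin F (Set.range β) ∧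
      IsModular F p (IntermediateField.adjoin F (Set.range β ∪ {γ})) := by
  have : ExpChar F p := ExpChar.prime Fact.out
  have : ExpChar (AlgebraicClosure F) p :=
    expChar_of_injective_algebraMap (algebraMap F (AlgebraicClosure F)).injective p
  have hroots : ∀ c ∈ Set.range b, ∃ y ∈ IntermediateField.adjoin F (Set.range β),
      y ^ p ^ m₀ = algebraMap F (AlgebraicClosure F) c := by
    rintro _ ⟨i, rfl⟩
    refine ⟨β i ^ p ^ (m i - m₀),
      pow_mem (IntermediateField.subset_adjoin F _ (Set.mem_range_self i)) _, ?_⟩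
    rw [← pow_mul, ← pow_add, Nat.sub_add_cancel (hle i), hβ]
  obtain ⟨y, hyK, hy⟩ := exists_mem_pow_eq_of_mem_pClosureT _ ht hroots htb
  obtain rfl : y = γ := iterateFrobenius_inj (AlgebraicClosure F) p m₀ (hy.trans hγ.symm)
  have heq : IntermediateField.adjoin F (Set.range β ∪ {y}) =
      IntermediateField.adjoin F (Set.range β) := by
    refine le_antisymm (IntermediateField.adjoin_le_iff.mpr ?_)
      (IntermediateField.adjoin.mono F _ _ Set.subset_union_left)
    exact Set.union_subset (IntermediateField.subset_adjoin F _)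
      (Set.singleton_subset_iff.mpr hyK)
  exact ⟨heq, r, m, b, β, hind, hβ, heq⟩
end

section
/- Let F be a field of characteristic p > 0, let b_1, ..., b_r, b ∈ F ∖ F^p be such that {b_1, ..., b_r} is p-independent and b ∈ F^p(b_1, ..., b_r), let m_1, ..., m_r, m ∈ ℕ with m ≤ m_1, ..., m ≤ m_r, and set E = F(b_1^{1/p^{m_1}}, ..., b_r^{1/p^{m_r}}, b^{1/p^m}) inside an algebraic closure of F. Assume there is no t ≥ m with b ∈ F^{p^t}(b_1, ..., b_r), and choose t ∈ {1, ..., m−1} maximal with b ∈ F^{p^t}(b_1, ..., b_r). Write b = Σ_{i=(i_1,...,i_r) ∈ T} x_i^{p^t} b_1^{i_1} ··· b_r^{i_r} with T = {0, ..., p^t − 1}^r and x_i ∈ F, and set S := {x_i : i ∈ T}. Then Ω^n(E/F) = annΩ^n_F(d b_1 ∧ ... ∧ d b_r ∧ dS) and ν_n(E/F) = ann ν^n_F(d b_1 ∧ ... ∧ d b_r ∧ dS). -/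
set_option synthInstance.maxHeartbeats 1000000
set_option maxHeartbeats 1000000

open ExteriorAlgebra

section Helpers
open scoped TensorProduct

/-- A linear map with kernel inside the span of `e₁, …, eₙ` induces a map of exterior algebras
whose kernel is killed by right multiplication with `e₁ ∧ … ∧ eₙ`. -/
theorem mul_prod_eq_zero_of_map_eq_zero {K U W : Type*} [Field K] [AddCommGroup U] [Module K U]
    [AddCommGroup W] [Module K W] {n : ℕ} (e : Fin n → U) (f : U →ₗ[K] W)
    (hf : LinearMap.ker f ≤ Submodule.span K (Set.range e)) (x : ExteriorAlgebra K U)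
    (hx : ExteriorAlgebra.map f x = 0) : x * (List.ofFn fun i => ι K (e i)).prod = 0 := by
  set P := (List.ofFn fun i => ι K (e i)).prod with hP
  obtain ⟨s, hs⟩ := f.rangeRestrict.exists_rightInverse_of_surjective f.range_rangeRestrict
  obtain ⟨g, hg⟩ := LinearMap.exists_extend s
  have hfg : ∀ u, f (g (f u)) = f u := fun u => by
    have h1 : g (f u) = s (f.rangeRestrict u) := by rw [← hg]; rfl
    have h2 := congrArg Subtype.val (LinearMap.congr_fun hs (f.rangeRestrict u))
    rw [h1]; simpa using h2
  have hspan : ∀ u ∈ Submodule.span K (Set.range e), ι K u * P = 0 := by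
    intro u hu
    induction hu using Submodule.span_induction with
    | mem u hu => obtain ⟨i, rfl⟩ := hu; exact ι_mul_prod_list e i
    | zero => simp
    | add u v _ _ hu hv => rw [map_add, add_mul, hu, hv, add_zero]
    | smul c u _ hu => rw [map_smul, smul_mul_assoc, hu, smul_zero]
  have hkill : ∀ u ∈ LinearMap.ker f, ∀ z, ι K u * (z * P) = 0 := by
    intro u hu z
    induction z using CliffordAlgebra.left_induction with
    | algebraMap c =>
      rw [← Algebra.smul_def, mul_smul_comm, hspan u (hf hu), smul_zero]
    | add a b ha hb => rw [add_mul, mul_add, ha, hb, add_zero]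
    | ι_mul z v hz =>
      have hc : ι K u * ι K v = -(ι K v * ι K u) := eq_neg_of_add_eq_zero_left (ι_add_mul_swap u v)
      change ι K u * (ι K v * z * P) = 0
      rw [mul_assoc, ← mul_assoc, hc, neg_mul, mul_assoc, hz, mul_zero, neg_zero]
  have hmap : ∀ z, ExteriorAlgebra.map (g ∘ₗ f) z * P = z * P := by
    intro z
    induction z using CliffordAlgebra.left_induction with
    | algebraMap c => rw [AlgHom.commutes]
    | add a b ha hb => rw [map_add, add_mul, add_mul, ha, hb]
    | ι_mul z v hz =>
      change ExteriorAlgebra.map (g ∘ₗ f) (ι K v * z) * P = ι K v * z * P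
      rw [map_mul, mul_assoc, hz, map_apply_ι, mul_assoc, ← sub_eq_zero, ← sub_mul, ← map_sub]
      exact hkill _ (by simp [hfg]) _
  rw [← hmap x, ← map_comp_map, AlgHom.comp_apply, hx, map_zero, zero_mul]

/-- A linear map killing linearly independent vectors `e₁, …, eₙ` induces a map of exterior
algebras which kills the annihilator of `e₁ ∧ … ∧ eₙ`. -/
theorem map_eq_zero_of_mul_prod_eq_zero {K U W : Type*} [Field K] [AddCommGroup U] [Module K U]
    [AddCommGroup W] [Module K W] (f : U →ₗ[K] W) {n : ℕ} (e : Fin n → U)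
    (he : LinearIndependent K e) (hf : ∀ i, f (e i) = 0) (x : ExteriorAlgebra K U)
    (hx : x * (List.ofFn fun i => ι K (e i)).prod = 0) : ExteriorAlgebra.map f x = 0 := by
  induction n generalizing x with
  | zero => simp at hx; simp [hx]
  | succ n ih =>
    obtain ⟨e, v, rfl⟩ : ∃ (e' : Fin n → U) (v : U), e = Fin.snoc e' v :=
      ⟨Fin.init e, e (Fin.last n), (Fin.snoc_init_self e).symm⟩
    rw [linearIndependent_finSnoc] at he
    obtain ⟨d, hdv, hd⟩ := Submodule.exists_dual_map_eq_bot_of_notMem he.2 inferInstance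
    rw [← LinearMap.le_ker_iff_map] at hd
    have hde : ∀ i, d (e i) = 0 := fun i => hd (Submodule.subset_span ⟨i, rfl⟩)
    have hfv : f v = 0 := by simpa using hf (Fin.last n)
    have hfe : ∀ i, f (e i) = 0 := fun i => by simpa using hf i.castSucc
    let h : U →ₗ[K] U := LinearMap.id - ((d v)⁻¹ • d).smulRight v
    have hhe : ∀ i, h (e i) = e i := fun i => by simp [h, hde]
    have hhv : h v = 0 := by simp [h, hdv]
    have hfh : f ∘ₗ h = f := by ext u; simp [h, hfv]
    rw [List.ofFn_succ'] at hx
    simp only [List.concat_eq_append, List.prod_append, List.prod_singleton, Fin.snoc_castSucc,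
      Fin.snoc_last, ← mul_assoc] at hx
    have h1 := CliffordAlgebra.contractRight_mul_ι (Q := (0 : QuadraticForm K U)) d v
      (x * (List.ofFn fun i => ι K (e i)).prod)
    change CliffordAlgebra.contractRight (x * (List.ofFn fun i => ι K (e i)).prod * ι K v) d = _
      at h1
    rw [hx, map_zero, LinearMap.zero_apply, eq_comm, sub_eq_zero] at h1
    have h2 := congrArg (ExteriorAlgebra.map h) h1
    change _ = ExteriorAlgebra.map h (_ * ι K v) at h2
    rw [map_mul, map_apply_ι, hhv, map_zero, mul_zero, map_smul, smul_eq_zero_iff_right hdv,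
      map_mul, map_list_prod, List.map_ofFn] at h2
    have h3 := ih e he.1 hfe (ExteriorAlgebra.map h x) (by
      simpa [Function.comp_def, hhe] using h2)
    rwa [← AlgHom.comp_apply, map_comp_map, hfh] at h3

/-- Coefficients at linearly independent vectors of a tensor product can be compared. -/
theorem eq_zero_of_sum_tmul_eq_zero {K A M : Type*} [Field K] [AddCommGroup A] [Module K A]
    [AddCommGroup M] [Module K M] {I : Type*} [Fintype I] {v : I → A} (hv : LinearIndependent K v)
    (w : I → M) (h : ∑ i, v i ⊗ₜ[K] w i = 0) (j : I) : w j = 0 := by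
  classical
  obtain ⟨φ, hφ⟩ := LinearMap.exists_extend ((Finsupp.lapply j).comp hv.repr : _ →ₗ[K] K)
  have hφv : ∀ i, φ (v i) = Finsupp.single i (1 : K) j := fun i => by
    have := LinearMap.congr_fun hφ ⟨v i, Submodule.subset_span ⟨i, rfl⟩⟩
    simpa [hv.repr_eq_single i] using this
  have := congrArg ((TensorProduct.lid K M).toLinearMap ∘ₗ φ.rTensor M) h
  simpa [hφv, Finsupp.single_apply, ite_smul] using this

/-- The base change of `ι` squares to zero. -/
theorem baseChange_ι_mul_self (K L V : Type*) [Field K] [Field L] [Algebra K L] [AddCommGroup V]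
    [Module K V] (u : L ⊗[K] V) :
    (ι K (M := V)).baseChange L u * (ι K (M := V)).baseChange L u = 0 := by
  have hcross : ∀ u v : L ⊗[K] V, (ι K (M := V)).baseChange L u * (ι K (M := V)).baseChange L v +
      (ι K (M := V)).baseChange L v * (ι K (M := V)).baseChange L u = 0 := by
    intro u v
    induction u using TensorProduct.induction_on with
    | zero => simp
    | add a b ha hb =>
      rw [map_add, add_mul, mul_add, add_add_add_comm, ha, hb, add_zero]
    | tmul a x =>
      induction v using TensorProduct.induction_on with
      | zero => simp
      | add a b ha hb =>
        rw [map_add, add_mul, mul_add, add_add_add_comm, ha, hb, add_zero]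
      | tmul b y =>
        simp only [LinearMap.baseChange_tmul, Algebra.TensorProduct.tmul_mul_tmul]
        rw [mul_comm b a, ← TensorProduct.tmul_add, ι_add_mul_swap, TensorProduct.tmul_zero]
  induction u using TensorProduct.induction_on with
  | zero => simp
  | tmul a x => simp
  | add a b ha hb =>
    rw [map_add, add_mul, mul_add, mul_add, ha, hb, zero_add, add_zero, hcross]

section BaseChange

variable (K L V : Type*) [Field K] [Field L] [Algebra K L] [AddCommGroup V] [Module K V]

/-- Scalar extension of exterior algebras. -/
noncomputable def extScalars : ExteriorAlgebra K V →ₐ[K] ExteriorAlgebra L (L ⊗[K] V) :=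
  ExteriorAlgebra.lift K ⟨((ι L).restrictScalars K).comp (TensorProduct.mk K L V 1),
    fun _ => ι_sq_zero _⟩

/-- The comparison of the exterior algebra of a base change with the base change of the exterior
algebra. -/
noncomputable def extUnscalars : ExteriorAlgebra L (L ⊗[K] V) →ₐ[L] L ⊗[K] ExteriorAlgebra K V :=
  ExteriorAlgebra.lift L ⟨(ι K).baseChange L, baseChange_ι_mul_self K L V⟩

variable {K L V}

theorem extScalars_ι (v : V) : extScalars K L V (ι K v) = ι L (1 ⊗ₜ v) := by
  exact lift_ι_apply K _ _ v

theorem extUnscalars_ι (u : L ⊗[K] V) : extUnscalars K L V (ι L u) = (ι K).baseChange L u := by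
  exact lift_ι_apply L _ _ u

theorem extUnscalars_extScalars (x : ExteriorAlgebra K V) :
    extUnscalars K L V (extScalars K L V x) = 1 ⊗ₜ x := by
  have : ((extUnscalars K L V).restrictScalars K).comp (extScalars K L V) =
      Algebra.TensorProduct.includeRight := by
    ext v
    simp [extScalars_ι, extUnscalars_ι]
  exact DFunLike.congr_fun this x

/-- The annihilator of a scalar extension of `P` wedged with `∑ cᵢ ⊗ wᵢ`, for `cᵢ` linearly
independent. -/
theorem extScalars_mul_ι_sum_eq_zero_iff {I : Type*} [Fintype I] {c : I → L}
    (hc : LinearIndependent K c) (w : I → V) (x : ExteriorAlgebra K V) :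
    extScalars K L V x * ι L (∑ i, c i ⊗ₜ[K] w i) = 0 ↔ ∀ i, x * ι K (w i) = 0 := by
  constructor
  · intro h i
    have := congrArg (extUnscalars K L V) h
    rw [map_mul, map_zero, extUnscalars_extScalars, extUnscalars_ι, map_sum, Finset.mul_sum] at this
    simp only [LinearMap.baseChange_tmul, Algebra.TensorProduct.tmul_mul_tmul, one_mul] at this
    exact eq_zero_of_sum_tmul_eq_zero hc _ this i
  · intro h
    rw [map_sum, Finset.mul_sum]
    refine Finset.sum_eq_zero fun i _ => ?_
    have : c i ⊗ₜ[K] w i = c i • (1 ⊗ₜ[K] w i : L ⊗[K] V) := by simp [TensorProduct.smul_tmul']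
    rw [this, map_smul, mul_smul_comm, ← extScalars_ι, ← map_mul, h, map_zero, smul_zero]

end BaseChange

end Helpers

section FieldTheory

variable {F : Type} [Field F] {p : ℕ}

theorem pow_mem_pClosureT {t : ℕ} (C : Set F) (x : F) : x ^ p ^ t ∈ pClosureT F p t C :=
  Subfield.subset_closure (Or.inl ⟨x, rfl⟩)

theorem subset_pClosureT {t : ℕ} (C : Set F) : C ⊆ pClosureT F p t C :=
  fun _ hx => Subfield.subset_closure (Or.inr hx)

theorem pow_mem_pClosure (C : Set F) (x : F) : x ^ p ∈ pClosure F p C := by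
  have h := pow_mem_pClosureT (p := p) (t := 1) C x
  rw [pow_one] at h
  exact h

theorem pow_mem_pClosureT_add [Fact p.Prime] [CharP F p] {C : Set F} {x : F} (s t : ℕ)
    (hx : x ∈ pClosureT F p s C) : x ^ p ^ t ∈ pClosureT F p (s + t) C := by
  have : pClosureT F p s C ≤ (pClosureT F p (s + t) C).comap (iterateFrobenius F p t) := by
    refine Subfield.closure_le.2 ?_
    rintro _ (⟨y, rfl⟩ | h)
    · change (y ^ p ^ s) ^ p ^ t ∈ pClosureT F p (s + t) C
      rw [← pow_mul, ← pow_add]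
      exact pow_mem_pClosureT C y
    · exact pow_mem (subset_pClosureT C h) _
  exact this hx

/-- A subfield containing all `p`-th powers and avoiding `x` is contained in a maximal one, over
which `x` generates the whole field. -/
theorem exists_subfield_adjoin_eq_top [Fact p.Prime] [CharP F p] (L : Subfield F)
    (hL : ∀ y : F, y ^ p ∈ L) {x : F} (hx : x ∉ L) :
    ∃ M : Subfield F, L ≤ M ∧ x ∉ M ∧ IntermediateField.adjoin M {x} = ⊤ := by
  obtain ⟨M, hLM, hM⟩ := zorn_le_nonempty₀ {M : Subfield F | L ≤ M ∧ x ∉ M} (by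
    intro c hc hchain y hy
    refine ⟨sSup c, ⟨(hc hy).1.trans (le_sSup hy), ?_⟩, fun z hz => le_sSup hz⟩
    rw [Subfield.mem_sSup_of_directedOn ⟨y, hy⟩ hchain.directedOn]
    rintro ⟨M, hM, hxM⟩
    exact (hc hM).2 hxM) L ⟨le_rfl, hx⟩
  refine ⟨M, hM.prop.1, hM.prop.2, ?_⟩
  have hpM : ∀ y : F, y ^ p ∈ M := fun y => hM.prop.1 (hL y)
  have hint : ∀ y : F, IsIntegral M y := fun y =>
    IsIntegral.of_pow (Fact.out (p := p.Prime)).pos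
      (isIntegral_algebraMap (R := M) (A := F) (x := ⟨y ^ p, hpM y⟩))
  have hmem : ∀ y ∉ M, x ∈ IntermediateField.adjoin M {y} := by
    intro y hy
    by_contra hxy
    refine hy (hM.le_of_ge (y := (IntermediateField.adjoin M {y}).toSubfield)
      ⟨hM.prop.1.trans fun z hz => ?_, hxy⟩ (fun z hz => ?_)
      (IntermediateField.mem_adjoin_simple_self M y))
    all_goals exact (IntermediateField.adjoin M {y}).algebraMap_mem ⟨z, hz⟩
  have hdeg : ∀ y ∉ M, Module.finrank M (IntermediateField.adjoin M {y}) = p := by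
    intro y hy
    have hirr : Irreducible (Polynomial.X ^ p - Polynomial.C (⟨y ^ p, hpM y⟩ : M)) := by
      refine X_pow_sub_C_irreducible_of_prime Fact.out fun z hz => hy ?_
      have : (z : F) ^ p = y ^ p := congrArg Subtype.val hz
      rw [← frobenius_inj F p this]
      exact z.2
    rw [IntermediateField.adjoin.finrank (hint y),
      ← minpoly.eq_of_irreducible_of_monic hirr (by
        simp only [map_sub, map_pow, Polynomial.aeval_X, Polynomial.aeval_C]
        exact sub_self _)
        (Polynomial.monic_X_pow_sub_C _ (Fact.out (p := p.Prime)).ne_zero),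
      Polynomial.natDegree_X_pow_sub_C]
  rw [eq_top_iff]
  intro y _
  by_cases hy : y ∈ M
  · exact (IntermediateField.adjoin M {x}).algebraMap_mem ⟨y, hy⟩
  · have hle : IntermediateField.adjoin M {x} ≤ IntermediateField.adjoin M {y} :=
      IntermediateField.adjoin_simple_le_iff.2 (hmem y hy)
    have : FiniteDimensional M (IntermediateField.adjoin M {y}) :=
      IntermediateField.adjoin.finiteDimensional (hint y)
    rw [IntermediateField.eq_of_le_of_finrank_eq hle (by rw [hdeg y hy, hdeg x hM.prop.2])]
    exact IntermediateField.mem_adjoin_simple_self M y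

/-- A derivation separating an element from a subfield containing all `p`-th powers. -/
theorem exists_derivation_ne_zero [Fact p.Prime] [CharP F p] (L : Subfield F)
    (hL : ∀ y : F, y ^ p ∈ L) {x : F} (hx : x ∉ L) :
    ∃ D : Derivation ℤ F F, (∀ y ∈ L, D y = 0) ∧ D x ≠ 0 := by
  obtain ⟨M, hLM, hxM, htop⟩ := exists_subfield_adjoin_eq_top L hL hx
  have hint : IsIntegral M x := IsIntegral.of_pow (Fact.out (p := p.Prime)).pos
      (isIntegral_algebraMap (R := M) (A := F) (x := ⟨x ^ p, hLM (hL x)⟩))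
  have hpx : x ^ p ∈ M := hLM (hL x)
  have hadj : Algebra.adjoin M {x} = ⊤ := by
    rw [← IntermediateField.adjoin_simple_toSubalgebra_of_isAlgebraic hint.isAlgebraic, htop]
    rfl
  have hne : KaehlerDifferential.D M F x ≠ 0 := by
    intro h0
    have hsub : Subsingleton (Ω[F⁄M]) := by
      have hD : KaehlerDifferential.D M F = 0 := by
        ext y
        have : y ∈ Algebra.adjoin M {x} := hadj ▸ Algebra.mem_top
        induction this using Algebra.adjoin_induction with
        | mem y hy => rw [Set.mem_singleton_iff.1 hy]; simpa using h0
        | algebraMap y => simp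
        | add y z _ _ hy hz => simp_all
        | mul y z _ _ hy hz => simp_all
      rw [← Submodule.subsingleton_iff F, ← subsingleton_iff_bot_eq_top,
        ← KaehlerDifferential.span_range_derivation, hD, eq_comm, Submodule.span_eq_bot]
      rintro _ ⟨y, rfl⟩
      rfl
    have hfg : Algebra.FiniteType M F := ⟨⟨{x}, by simpa using hadj⟩⟩
    have hunr : Algebra.FormallyUnramified M F := ⟨hsub⟩
    have hsep : Algebra.IsSeparable M F := (Algebra.FormallyUnramified.iff_isSeparable M F).1 hunr
    have hc : CharP M p := inferInstance
    have hexp : ExpChar M p := ExpChar.prime Fact.out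
    have hbot : x ∈ (⊥ : IntermediateField M F) := by
      rw [← perfectClosure.eq_bot_of_isSeparable M F, mem_perfectClosure_iff_pow_mem p]
      exact ⟨1, ⟨x ^ p, hpx⟩, by rw [pow_one]; rfl⟩
    obtain ⟨y, rfl⟩ := IntermediateField.mem_bot.1 hbot
    exact hxM y.2
  obtain ⟨φ, hφ⟩ := Module.Projective.exists_dual_ne_zero F hne
  refine ⟨(φ.compDer (KaehlerDifferential.D M F)).restrictScalars ℤ, fun y hy => ?_, hφ⟩
  exact (φ.compDer (KaehlerDifferential.D M F)).map_algebraMap ⟨y, hLM hy⟩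

/-- If `dx` lies in the span of the `dc` for `c ∈ C`, then `x ∈ F^p(C)`. -/
theorem mem_pClosure_of_D_mem_span [Fact p.Prime] [CharP F p] (C : Set F) (x : F)
    (hx : KaehlerDifferential.D ℤ F x ∈ Submodule.span F (KaehlerDifferential.D ℤ F '' C)) :
    x ∈ pClosure F p C := by
  by_contra hxC
  obtain ⟨D, hD, hDx⟩ := exists_derivation_ne_zero (pClosure F p C) (pow_mem_pClosure C) hxC
  have hle : Submodule.span F (KaehlerDifferential.D ℤ F '' C) ≤
      LinearMap.ker D.liftKaehlerDifferential := by
    rw [Submodule.span_le]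
    rintro _ ⟨c, hc, rfl⟩
    simpa using hD c (subset_pClosureT C hc)
  exact hDx (by simpa using hle hx)

/-- The monomials with exponents less than `p` span the field generated by a family of elements
with `p`-th powers in the base. -/
theorem adjoin_toSubmodule_eq_span_monomials {k : Subfield F} {ι : Type*} [Fintype ι] (hp : 0 < p)
    {b : ι → F} (hb : ∀ j, b j ^ p ∈ k) :
    (IntermediateField.adjoin k (Set.range b)).toSubalgebra.toSubmodule =
      Submodule.span k (Set.range fun i : ι → Fin p => ∏ j, b j ^ (i j : ℕ)) := by
  classical
  have hint : ∀ y ∈ Set.range b, IsAlgebraic k y := by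
    rintro _ ⟨j, rfl⟩
    exact (IsIntegral.of_pow hp
      (isIntegral_algebraMap (R := k) (A := F) (x := ⟨b j ^ p, hb j⟩))).isAlgebraic
  apply le_antisymm
  · rw [IntermediateField.adjoin_toSubalgebra_of_isAlgebraic hint, Algebra.adjoin_eq_span,
      Submodule.span_le]
    intro y hy
    induction hy using Submonoid.closure_induction_left with
    | one => exact Submodule.subset_span ⟨fun _ => ⟨0, hp⟩, by simp⟩
    | mul_left y hy z _ hz =>
      obtain ⟨j, rfl⟩ := hy
      rename_i hzc
      clear hzc
      rw [SetLike.mem_coe] at hz ⊢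
      induction hz using Submodule.span_induction with
      | zero => simp
      | add u v _ _ hu hv => rw [mul_add]; exact add_mem hu hv
      | smul c u _ hu => rw [mul_smul_comm]; exact Submodule.smul_mem _ _ hu
      | mem u hu =>
        obtain ⟨i, rfl⟩ := hu
        dsimp only
        rw [Fintype.prod_eq_mul_prod_compl j]
        by_cases hi : (i j : ℕ) + 1 < p
        · refine Submodule.subset_span ⟨Function.update i j ⟨i j + 1, hi⟩, ?_⟩
          dsimp only
          rw [Fintype.prod_eq_mul_prod_compl j, Function.update_self, ← mul_assoc, pow_succ']
          congr 1
          refine Finset.prod_congr rfl fun l hl => ?_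
          rw [Function.update_of_ne (by simpa using hl)]
        · have hi' : (i j : ℕ) + 1 = p := by have := (i j).2; omega
          have : b j * (b j ^ (i j : ℕ) * ∏ l ∈ {j}ᶜ, b l ^ (i l : ℕ)) =
              (⟨b j ^ p, hb j⟩ : k) • ∏ l, b l ^ ((Function.update i j ⟨0, hp⟩ l : Fin p) : ℕ) := by
            rw [Fintype.prod_eq_mul_prod_compl j, Function.update_self, ← mul_assoc, ← pow_succ',
              hi', Subfield.smul_def, smul_eq_mul, pow_zero, one_mul]
            congr 1
            refine Finset.prod_congr rfl fun l hl => ?_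
            rw [Function.update_of_ne (by simpa using hl)]
          rw [this]
          exact Submodule.smul_mem _ _ (Submodule.subset_span ⟨_, rfl⟩)
  · rw [Submodule.span_le]
    rintro _ ⟨i, rfl⟩
    exact prod_mem (S := IntermediateField.adjoin k (Set.range b)) fun j _ =>
      pow_mem (IntermediateField.subset_adjoin k _ (Set.mem_range_self j)) _

theorem finrank_adjoin_le_pow_s17 {k : Subfield F} {ι : Type*} [Fintype ι] (hp : 0 < p)
    {b : ι → F} (hb : ∀ j, b j ^ p ∈ k) :
    Module.finrank k (IntermediateField.adjoin k (Set.range b)) ≤ p ^ Fintype.card ι := by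
  classical
  have h := congrArg (fun W : Submodule k F => Module.finrank k W)
    (adjoin_toSubmodule_eq_span_monomials hp hb)
  change Module.finrank k (IntermediateField.adjoin k (Set.range b)) = _ at h
  rw [h]
  refine (finrank_range_le_card _).trans ?_
  simp

/-- The differentials of a `p`-independent family are linearly independent. -/
theorem pIndep.linearIndependent_D [Fact p.Prime] [CharP F p] {r : ℕ} {b : Fin r → F}
    (hb : pIndep F p b) : LinearIndependent F fun j => KaehlerDifferential.D ℤ F (b j) := by
  have hp : p.Prime := Fact.out
  rw [linearIndependent_iff_notMem_span]
  intro j hj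
  rw [← Function.comp_def (KaehlerDifferential.D ℤ F) b, Set.image_comp] at hj
  have hmem := mem_pClosure_of_D_mem_span (p := p) _ _ hj
  set k := pClosure F p ∅
  have himg : b '' (Set.univ \ {j}) = Set.range fun l : {l // l ≠ j} => b l := by
    ext y; simp
  have hle : pClosure F p (b '' (Set.univ \ {j})) ≤
      (IntermediateField.adjoin k (b '' (Set.univ \ {j}))).toSubfield := by
    refine Subfield.closure_le.2 ?_
    rintro _ (⟨y, rfl⟩ | h)
    · exact (IntermediateField.adjoin k _).algebraMap_mem ⟨_, pow_mem_pClosureT _ y⟩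
    · exact IntermediateField.subset_adjoin k _ h
  have heq : IntermediateField.adjoin k (Set.range b) =
      IntermediateField.adjoin k (b '' (Set.univ \ {j})) := by
    refine le_antisymm (IntermediateField.adjoin_le_iff.2 ?_)
      (IntermediateField.adjoin.mono _ _ _ (Set.image_subset_range _ _))
    rintro _ ⟨l, rfl⟩
    by_cases hl : l = j
    · subst hl; exact hle hmem
    · exact IntermediateField.subset_adjoin k _ ⟨l, by simpa using hl, rfl⟩
  have hdeg : Module.finrank k (IntermediateField.adjoin k (Set.range b)) = p ^ r := hb
  have hbound := finrank_adjoin_le_pow_s17 hp.pos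
    (fun l : {l // l ≠ j} => pow_mem_pClosure (p := p) ∅ (b l))
  rw [← himg, ← heq, hdeg, Nat.pow_le_pow_iff_right hp.one_lt] at hbound
  have := j.2
  simp at hbound
  omega

/-- The monomials in a `p`-independent family with exponents less than `p ^ t` are linearly
independent over `F^{p^t}`. -/
theorem pIndep.eq_zero_of_sum_pow_mul_monomial_eq_zero [Fact p.Prime] [CharP F p] {r : ℕ}
    {b : Fin r → F} (hb : pIndep F p b) (t : ℕ) (c : (Fin r → Fin (p ^ t)) → F)
    (hc : ∑ i, c i ^ p ^ t * ∏ j, b j ^ (i j : ℕ) = 0) (i : Fin r → Fin (p ^ t)) : c i = 0 := by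
  have hp : p.Prime := Fact.out
  have hbase : ∀ c : (Fin r → Fin p) → F, ∑ i, c i ^ p * ∏ j, b j ^ (i j : ℕ) = 0 →
      ∀ i, c i = 0 := by
    have hli : LinearIndependent (pClosure F p ∅)
        fun i : Fin r → Fin p => ∏ j, b j ^ (i j : ℕ) := by
      rw [linearIndependent_iff_card_eq_finrank_span, Set.finrank,
        ← adjoin_toSubmodule_eq_span_monomials hp.pos fun j => pow_mem_pClosure ∅ (b j)]
      refine Eq.trans ?_ (Eq.symm hb)
      simp
    intro c hc i
    have := Fintype.linearIndependent_iff.1 hli (fun i => ⟨c i ^ p, pow_mem_pClosure ∅ _⟩)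
      hc i
    exact eq_zero_of_pow_eq_zero (congrArg Subtype.val this)
  induction t with
  | zero =>
    rw [Fintype.sum_eq_single i fun j hj => (hj (funext fun l =>
      Subsingleton.elim (α := Fin 1) _ _)).elim] at hc
    have : ∀ j, (i j : ℕ) = 0 := fun j => Nat.lt_one_iff.1 (i j).2
    simpa [this] using hc
  | succ t ih =>
    let e : (Fin r → Fin (p ^ t)) × (Fin r → Fin p) ≃ (Fin r → Fin (p ^ (t + 1))) :=
      (Equiv.arrowProdEquivProdArrow (Fin r) (fun _ => Fin (p ^ t)) (fun _ => Fin p)).symm.trans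
        (Equiv.piCongrRight fun _ => finProdFinEquiv)
    have he : ∀ x j, (e x j : ℕ) = x.2 j + p * x.1 j := fun x j => rfl
    rw [← e.sum_comp, Fintype.sum_prod_type_right] at hc
    have hc' : ∑ y, (∑ x, c (e (x, y)) ^ p ^ t * ∏ j, b j ^ (x j : ℕ)) ^ p *
        ∏ j, b j ^ (y j : ℕ) = 0 := by
      rw [← hc]
      refine Finset.sum_congr rfl fun y _ => ?_
      rw [sum_pow_char, Finset.sum_mul]
      refine Finset.sum_congr rfl fun x _ => ?_
      simp only [he, mul_pow, ← pow_mul, pow_add, Finset.prod_mul_distrib, ← Finset.prod_pow]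
      rw [pow_one]
      simp only [mul_comm p]
      ring
    obtain ⟨⟨x, y⟩, rfl⟩ := e.surjective i
    exact ih (fun x => c (e (x, y))) (hbase _ hc' y) x

end FieldTheory

section KaehlerKernel

open scoped TensorProduct IntermediateField

variable {F L : Type*} [Field F] [Field L] [Algebra F L]

/-- The square-zero deformation of the structure map given by a derivation. -/
noncomputable def derivationRingHom (D : Derivation ℤ F L) : F →+* DualNumber L where
  toFun x := TrivSqZeroExt.inl (algebraMap F L x) + TrivSqZeroExt.inr (D x)
  map_zero' := by simp
  map_one' := by simp
  map_add' x y := by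
    ext <;> simp
  map_mul' x y := by
    ext
    · simp
    · simp [Algebra.smul_def (A := L)]
      ring

/-- A derivation of `F` into `L` extends to `F(a)` if it is compatible with the minimal polynomial
of `a`. -/
theorem exists_derivation_extension {a : L} (ha : IsIntegral F a) (D : Derivation ℤ F L)
    (hD : ((minpoly F a).sum fun i c => a ^ i * D c) = 0) :
    ∃ D' : Derivation ℤ F⟮a⟯ L, ∀ x : F, D' (algebraMap F F⟮a⟯ x) = D x := by
  let φ := derivationRingHom D
  have hφ : (minpoly F a).eval₂ φ (TrivSqZeroExt.inl a : DualNumber L) = 0 := by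
    have h1 : (minpoly F a).eval₂ φ (TrivSqZeroExt.inl a : DualNumber L) =
        TrivSqZeroExt.inl (Polynomial.aeval a (minpoly F a)) +
          TrivSqZeroExt.inr ((minpoly F a).sum fun i c => a ^ i * D c) := by
      rw [Polynomial.aeval_def, Polynomial.eval₂_eq_sum, Polynomial.eval₂_eq_sum]
      simp only [Polynomial.sum, TrivSqZeroExt.inl_sum, TrivSqZeroExt.inr_sum]
      rw [← Finset.sum_add_distrib]
      refine Finset.sum_congr rfl fun i _ => ?_
      ext <;> simp [φ, derivationRingHom, ← TrivSqZeroExt.inl_pow, mul_comm]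
    rw [h1, minpoly.aeval, hD]
    simp
  let e := IntermediateField.adjoinRootEquivAdjoin F ha
  let ψ' : AdjoinRoot (minpoly F a) →+* DualNumber L := AdjoinRoot.lift φ (TrivSqZeroExt.inl a) hφ
  let ψ : F⟮a⟯ →+* DualNumber L := ψ'.comp e.symm.toRingEquiv.toRingHom
  have hψ : ∀ x : F, ψ (algebraMap F F⟮a⟯ x) = φ x := fun x => by
    change ψ' (e.symm (algebraMap F F⟮a⟯ x)) = _
    rw [AlgEquiv.commutes]
    exact AdjoinRoot.lift_of hφ
  have hfst : ∀ y : F⟮a⟯, (ψ y).fst = y := by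
    intro y
    obtain ⟨z, rfl⟩ := e.surjective y
    change (ψ' (e.symm (e z))).fst = _
    rw [AlgEquiv.symm_apply_apply]
    induction z using AdjoinRoot.induction_on with
    | ih q =>
      induction q using Polynomial.induction_on' with
      | add q₁ q₂ h₁ h₂ => simp only [map_add, TrivSqZeroExt.fst_add, h₁, h₂]; rfl
      | monomial n c =>
        rw [← Polynomial.C_mul_X_pow_eq_monomial, map_mul, map_pow, AdjoinRoot.mk_X,
          AdjoinRoot.mk_C, map_mul, map_pow, map_mul, map_pow,
          IntermediateField.adjoinRootEquivAdjoin_apply_root]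
        have h1 : e (AdjoinRoot.of (minpoly F a) c) = algebraMap F F⟮a⟯ c := e.commutes c
        rw [h1, AdjoinRoot.lift_root, AdjoinRoot.lift_of, TrivSqZeroExt.fst_mul, TrivSqZeroExt.fst_pow]
        simp [φ, derivationRingHom]
  refine ⟨Derivation.mk' (AddMonoidHom.toIntLinearMap
    ⟨⟨fun y => (ψ y).snd, by simp⟩, fun x y => by simp⟩) fun x y => ?_, fun x => ?_⟩
  · change (ψ (x * y)).snd = x • (ψ y).snd + y • (ψ x).snd
    rw [map_mul, TrivSqZeroExt.snd_mul, hfst, hfst, op_smul_eq_smul]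
    rfl
  · change (ψ (algebraMap F F⟮a⟯ x)).snd = D x
    rw [hψ]
    simp [φ, derivationRingHom]

/-- The comparison map of base changed differentials in a tower. -/
noncomputable def kaehlerTowerMap (F K L : Type*) [Field F] [Field K] [Field L] [Algebra F K]
    [Algebra K L] [Algebra F L] [IsScalarTower F K L] : L ⊗[F] Ω[F⁄ℤ] →ₗ[L] L ⊗[K] Ω[K⁄ℤ] :=
  LinearMap.liftBaseChange L
    (((TensorProduct.mk K L (Ω[K⁄ℤ]) 1).restrictScalars F).comp (KaehlerDifferential.map ℤ ℤ F K))

theorem kaehlerTowerMap_tmul_D {F K L : Type*} [Field F] [Field K] [Field L] [Algebra F K]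
    [Algebra K L] [Algebra F L] [IsScalarTower F K L] (y : L) (x : F) :
    kaehlerTowerMap F K L (y ⊗ₜ KaehlerDifferential.D ℤ F x) =
      y ⊗ₜ KaehlerDifferential.D ℤ K (algebraMap F K x) := by
  simp [kaehlerTowerMap, TensorProduct.smul_tmul']

theorem kaehler_linearMap_ext {F L M : Type*} [Field F] [Field L] [Algebra F L] [AddCommGroup M]
    [Module L M] {f g : L ⊗[F] Ω[F⁄ℤ] →ₗ[L] M}
    (h : ∀ x, f (1 ⊗ₜ KaehlerDifferential.D ℤ F x) = g (1 ⊗ₜ KaehlerDifferential.D ℤ F x)) :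
    f = g := by
  let : Module F M := Module.compHom M (algebraMap F L)
  have : IsScalarTower F L M := ⟨fun a b c => by
    rw [Algebra.smul_def, mul_smul]; rfl⟩
  apply TensorProduct.AlgebraTensorModule.curry_injective
  ext x
  exact h x

theorem kaehlerTowerMap_ker_le {a : L} (ha : IsIntegral F a) :
    ∃ v, LinearMap.ker (kaehlerTowerMap F F⟮a⟯ L) ≤ Submodule.span L {v} := by
  refine ⟨(minpoly F a).sum fun i c => (a ^ i) ⊗ₜ KaehlerDifferential.D ℤ F c, fun w hw => ?_⟩
  by_contra hwv
  obtain ⟨φ, hφw, hφ⟩ := Submodule.exists_dual_map_eq_bot_of_notMem hwv inferInstance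
  rw [← LinearMap.le_ker_iff_map, Submodule.span_singleton_le_iff_mem, LinearMap.mem_ker] at hφ
  let D : Derivation ℤ F L :=
    ((φ.restrictScalars F).comp (TensorProduct.mk F L (Ω[F⁄ℤ]) 1)).compDer
      (KaehlerDifferential.D ℤ F)
  have hDφ : ∀ x, D x = φ (1 ⊗ₜ KaehlerDifferential.D ℤ F x) := fun x => rfl
  obtain ⟨D', hD'⟩ := exists_derivation_extension ha D (by
    rw [← hφ, Polynomial.sum, Polynomial.sum, map_sum]
    refine Finset.sum_congr rfl fun i _ => ?_
    rw [hDφ, ← smul_eq_mul, ← map_smul, TensorProduct.smul_tmul', smul_eq_mul, mul_one])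
  have hcomp : φ = (LinearMap.liftBaseChange L D'.liftKaehlerDifferential).comp
      (kaehlerTowerMap F F⟮a⟯ L) := by
    refine kaehler_linearMap_ext fun x => ?_
    rw [LinearMap.comp_apply, kaehlerTowerMap_tmul_D, ← hDφ, ← hD']
    simp
  exact hφw (by rw [hcomp, LinearMap.comp_apply, hw, map_zero])

theorem kaehlerTowerMap_rank_ker_le {F L : Type} [Field F] [Field L] [Algebra F L] {a : L}
    (ha : IsIntegral F a) : Module.rank L (LinearMap.ker (kaehlerTowerMap F F⟮a⟯ L)) ≤ 1 := by
  obtain ⟨v, hv⟩ := kaehlerTowerMap_ker_le ha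
  exact (Submodule.rank_mono hv).trans ((rank_span_le _).trans (by simp))

theorem rank_ker_comp_le {K U V W : Type} [Field K] [AddCommGroup U] [Module K U]
    [AddCommGroup V] [Module K V] [AddCommGroup W] [Module K W] (f : U →ₗ[K] V) (g : V →ₗ[K] W) :
    Module.rank K (LinearMap.ker (g.comp f)) ≤
      Module.rank K (LinearMap.ker f) + Module.rank K (LinearMap.ker g) := by
  let φ : LinearMap.ker (g.comp f) →ₗ[K] LinearMap.ker g :=
    (f.comp (LinearMap.ker (g.comp f)).subtype).codRestrict _ fun x => x.2
  let ψ : LinearMap.ker φ →ₗ[K] LinearMap.ker f :=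
    ((LinearMap.ker (g.comp f)).subtype.comp (LinearMap.ker φ).subtype).codRestrict _ fun x =>
      congrArg Subtype.val x.2
  have hψ : Function.Injective ψ := fun x y h =>
    Subtype.ext (Subtype.ext (congrArg (fun z : LinearMap.ker f => (z : U)) h))
  rw [← LinearMap.rank_range_add_rank_ker φ, add_comm]
  exact add_le_add (LinearMap.rank_le_of_injective ψ hψ) (Submodule.rank_le _)

/-- Cartier's inequality: the kernel of the base change map on differentials of an algebraic
extension generated by `n` elements has dimension at most `n`. -/
theorem rank_ker_mapBaseChange_le (n : ℕ) {F L : Type} [Field F] [Field L] [Algebra F L]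
    [Algebra.IsAlgebraic F L] (a : Fin n → L)
    (ha : IntermediateField.adjoin F (Set.range a) = ⊤) :
    Module.rank L (LinearMap.ker (KaehlerDifferential.mapBaseChange ℤ F L)) ≤ n := by
  induction n generalizing F with
  | zero =>
    have hsurj : Function.Surjective (algebraMap F L) := fun y => by
      have : y ∈ (⊥ : IntermediateField F L) := by
        rw [← IntermediateField.adjoin_empty, ← Set.range_eq_empty a, ha]
        trivial
      exact IntermediateField.mem_bot.1 this
    let e : F ≃+* L := RingEquiv.ofBijective (algebraMap F L) ⟨(algebraMap F L).injective, hsurj⟩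
    let D : Derivation ℤ L (L ⊗[F] Ω[F⁄ℤ]) := Derivation.mk' (AddMonoidHom.toIntLinearMap
      ⟨⟨fun y => 1 ⊗ₜ KaehlerDifferential.D ℤ F (e.symm y), by simp⟩,
        fun x y => by simp [TensorProduct.tmul_add]⟩) fun x y => by
        change (1 : L) ⊗ₜ[F] KaehlerDifferential.D ℤ F (e.symm (x * y)) =
          x • (1 ⊗ₜ[F] KaehlerDifferential.D ℤ F (e.symm y)) +
            y • (1 ⊗ₜ[F] KaehlerDifferential.D ℤ F (e.symm x))
        have he : ∀ z, algebraMap F L (e.symm z) = z := e.apply_symm_apply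
        rw [map_mul, Derivation.leibniz, TensorProduct.tmul_add, TensorProduct.tmul_smul,
          TensorProduct.tmul_smul, algebra_compatible_smul L (e.symm x),
          algebra_compatible_smul L (e.symm y), he, he]
    have hid : D.liftKaehlerDifferential.comp (KaehlerDifferential.mapBaseChange ℤ F L) =
        LinearMap.id := kaehler_linearMap_ext fun x => by
      have : D (algebraMap F L x) = 1 ⊗ₜ KaehlerDifferential.D ℤ F (e.symm (e x)) := rfl
      simp [this]
    have hker : LinearMap.ker (KaehlerDifferential.mapBaseChange ℤ F L) = ⊥ :=
      LinearMap.ker_eq_bot_of_inverse hid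
    rw [hker]
    simp
  | succ n ih =>
    let K := F⟮a 0⟯
    have hint : IsIntegral F (a 0) := Algebra.IsIntegral.isIntegral _
    have htop : IntermediateField.adjoin K (Set.range (Fin.tail a)) = ⊤ := by
      apply IntermediateField.restrictScalars_injective F
      rw [IntermediateField.adjoin_adjoin_left, IntermediateField.restrictScalars_top, ← ha]
      congr 1
      rw [← Fin.cons_self_tail a, Fin.range_cons]
      rfl
    have halg : Algebra.IsAlgebraic K L := Algebra.IsAlgebraic.tower_top (K := F) K
    have hcomp : KaehlerDifferential.mapBaseChange ℤ F L =
        (KaehlerDifferential.mapBaseChange ℤ K L).comp (kaehlerTowerMap F K L) :=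
      kaehler_linearMap_ext fun x => by
        rw [LinearMap.comp_apply, kaehlerTowerMap_tmul_D]
        simp
    rw [hcomp, Nat.cast_succ, add_comm]
    exact (rank_ker_comp_le _ _).trans
      (add_le_add (kaehlerTowerMap_rank_ker_le hint) (ih (Fin.tail a) htop))

end KaehlerKernel

section Restriction

open scoped TensorProduct

variable {F L : Type} [Field F] [Field L] [Algebra F L]

theorem resMap_eq_map_extScalars (ω : ExtOmega F) :
    resMap F L ω = ExteriorAlgebra.map (KaehlerDifferential.mapBaseChange ℤ F L)
      (extScalars F L (Ω[F⁄ℤ]) ω) := by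
  induction ω using ExteriorAlgebra.induction with
  | algebraMap c =>
    rw [AlgHom.commutes, IsScalarTower.algebraMap_apply F L (ExteriorAlgebra L (L ⊗[F] Ω[F⁄ℤ])),
      AlgHom.commutes]
    exact AlgHom.commutes (R := F) _ c
  | ι v =>
    rw [extScalars_ι, map_apply_ι]
    simp only [resMap]
    refine (ExteriorAlgebra.lift_ι_apply F _ _ v).trans ?_
    simp
  | add a b ha hb => rw [map_add, map_add, map_add, ha, hb]
  | mul a b ha hb => rw [map_mul, map_mul, map_mul, ha, hb]

theorem D_eq_zero_of_pow_eq {p : ℕ} [CharP L p] (y z : L) (s : ℕ) (hs : 1 ≤ s)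
    (h : y ^ p ^ s = z) :
    KaehlerDifferential.D ℤ L z = 0 := by
  rw [← h, Derivation.leibniz_pow, ← Nat.cast_smul_eq_nsmul L, Nat.cast_pow, CharP.cast_eq_zero,
    zero_pow (by omega), zero_smul]

variable {p : ℕ} [Fact p.Prime] [CharP F p]

theorem linearIndependent_root_monomials {r : ℕ} {b : Fin r → F} (hind : pIndep F p b) {t : ℕ}
    (δ : Fin r → L) (hδ : ∀ j, δ j ^ p ^ t = algebraMap F L (b j)) :
    LinearIndependent F fun i : Fin r → Fin (p ^ t) => ∏ j, δ j ^ (i j : ℕ) := by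
  have : CharP L p := charP_of_injective_algebraMap (algebraMap F L).injective p
  rw [Fintype.linearIndependent_iff]
  intro c hc
  refine hind.eq_zero_of_sum_pow_mul_monomial_eq_zero t c ((algebraMap F L).injective ?_)
  have h := congrArg (fun z => z ^ p ^ t) hc
  rw [sum_pow_char_pow, zero_pow (pow_ne_zero _ (Fact.out (p := p.Prime)).ne_zero)] at h
  rw [map_zero, ← h, map_sum]
  refine Finset.sum_congr rfl fun i _ => ?_
  simp only [map_mul, map_prod, map_pow, Algebra.smul_def, mul_pow, ← hδ, ← Finset.prod_pow]
  congr 1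
  refine Finset.prod_congr rfl fun j _ => ?_
  exact pow_right_comm _ _ _

/-- A tensor `∑ cᵢ ⊗ dxᵢ` with `cᵢ` linearly independent is not in the span of the `1 ⊗ db_j`
unless all `xᵢ` lie in `F^p(b)`. -/
theorem mem_pClosure_of_sum_tmul_D_mem_span {r : ℕ} {b : Fin r → F} {I : Type*} [Fintype I]
    {c : I → L} (hc : LinearIndependent F c) (x : I → F)
    (h : ∑ i, c i ⊗ₜ[F] KaehlerDifferential.D ℤ F (x i) ∈
      Submodule.span L (Set.range fun j => (1 : L) ⊗ₜ[F] KaehlerDifferential.D ℤ F (b j))) (i : I) :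
    x i ∈ pClosure F p (Set.range b) := by
  apply mem_pClosure_of_D_mem_span
  set N := Submodule.span F (KaehlerDifferential.D ℤ F '' Set.range b) with hN
  have hle : Submodule.span L (Set.range fun j => (1 : L) ⊗ₜ[F] KaehlerDifferential.D ℤ F (b j)) ≤
      LinearMap.ker (N.mkQ.baseChange L) := by
    rw [Submodule.span_le]
    rintro _ ⟨j, rfl⟩
    have hz : N.mkQ (KaehlerDifferential.D ℤ F (b j)) = 0 := by
      rw [Submodule.mkQ_apply, Submodule.Quotient.mk_eq_zero]
      exact Submodule.subset_span ⟨b j, ⟨j, rfl⟩, rfl⟩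
    rw [SetLike.mem_coe, LinearMap.mem_ker, LinearMap.baseChange_tmul, hz, TensorProduct.tmul_zero]
  have h0 := hle h
  rw [LinearMap.mem_ker, map_sum] at h0
  simp only [LinearMap.baseChange_tmul] at h0
  have := eq_zero_of_sum_tmul_eq_zero hc _ h0 i
  rwa [Submodule.mkQ_apply, Submodule.Quotient.mk_eq_zero] at this

theorem le_span_of_rank_le {V : Type*} [AddCommGroup V] [Module L V] (N : Submodule L V) {n : ℕ}
    {e : Fin n → V} (he : LinearIndependent L e) (hmem : ∀ i, e i ∈ N)
    (hrank : Module.rank L N ≤ n) : N ≤ Submodule.span L (Set.range e) := by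
  have hfin : Module.Finite L N :=
    Module.rank_lt_aleph0_iff.1 (hrank.trans_lt Cardinal.natCast_lt_aleph0)
  refine (Submodule.eq_of_le_of_finrank_le (Submodule.span_le.2 ?_) ?_).ge
  · rintro _ ⟨i, rfl⟩
    exact hmem i
  · rw [finrank_span_eq_card he, Fintype.card_fin]
    exact Module.finrank_le_of_rank_le hrank

theorem resMap_eq_zero_iff [Algebra.IsAlgebraic F L] {r : ℕ} {b : Fin r → F} {b₀ : F}
    (hind : pIndep F p b) {m : Fin r → ℕ} {m₀ : ℕ} {β : Fin r → L} {γ : L}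
    (hβ : ∀ i, β i ^ p ^ m i = algebraMap F L (b i)) (hγ : γ ^ p ^ m₀ = algebraMap F L b₀)
    (htop : IntermediateField.adjoin F (Set.range β ∪ {γ}) = ⊤)
    {t : ℕ} (htm : ∀ i, t < m i) (htm₀ : t < m₀)
    (htmax : b₀ ∉ pClosureT F p (t + 1) (Set.range b)) (x : (Fin r → Fin (p ^ t)) → F)
    (hx : b₀ = ∑ i : Fin r → Fin (p ^ t), x i ^ p ^ t * ∏ j, b j ^ (i j : ℕ)) (ω : ExtOmega F) :
    resMap F L ω = 0 ↔ ∀ i, ω * (dwedge F b * dform F (x i)) = 0 := by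
  have hcharL : CharP L p := charP_of_injective_algebraMap (algebraMap F L).injective p
  let δ : Fin r → L := fun j => β j ^ p ^ (m j - t)
  have hδ : ∀ j, δ j ^ p ^ t = algebraMap F L (b j) := fun j => by
    rw [← hβ j, ← pow_mul, ← pow_add, Nat.sub_add_cancel (htm j).le]
  let c : (Fin r → Fin (p ^ t)) → L := fun i => ∏ j, δ j ^ (i j : ℕ)
  have hc : LinearIndependent F c := linearIndependent_root_monomials hind δ hδ
  let θ : L ⊗[F] Ω[F⁄ℤ] := ∑ i, c i ⊗ₜ KaehlerDifferential.D ℤ F (x i)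
  let f := KaehlerDifferential.mapBaseChange ℤ F L
  let e : Fin (r + 1) → L ⊗[F] Ω[F⁄ℤ] :=
    Fin.snoc (fun j => 1 ⊗ₜ KaehlerDifferential.D ℤ F (b j)) θ
  have he : LinearIndependent L e := by
    refine linearIndependent_finSnoc.2
      ⟨Module.Flat.linearIndependent_one_tmul hind.linearIndependent_D, fun hθ => htmax ?_⟩
    rw [hx]
    refine sum_mem fun i _ => mul_mem ?_ (prod_mem fun j _ =>
      pow_mem (subset_pClosureT _ (Set.mem_range_self j)) _)
    rw [add_comm t 1]
    exact pow_mem_pClosureT_add (C := Set.range b) 1 t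
      (mem_pClosure_of_sum_tmul_D_mem_span hc x hθ i)
  have hfb : ∀ j, f (1 ⊗ₜ KaehlerDifferential.D ℤ F (b j)) = 0 := fun j => by
    have := D_eq_zero_of_pow_eq _ _ _ (by have := htm j; omega) (hβ j)
    simpa [f] using this
  have hfθ : f θ = 0 := by
    have hcx : ∑ i, c i * algebraMap F L (x i) = γ ^ p ^ (m₀ - t) := by
      apply iterateFrobenius_inj L p t
      rw [iterateFrobenius_def, iterateFrobenius_def, ← pow_mul, ← pow_add,
        Nat.sub_add_cancel htm₀.le, hγ, hx, sum_pow_char_pow, map_sum]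
      refine Finset.sum_congr rfl fun i _ => ?_
      simp only [map_mul, map_prod, map_pow, mul_pow, ← hδ, c, ← Finset.prod_pow]
      rw [mul_comm]
      congr 1
      refine Finset.prod_congr rfl fun j _ => ?_
      exact pow_right_comm _ _ _
    have hDδ : ∀ j, KaehlerDifferential.D ℤ L (δ j) = 0 := fun j =>
      D_eq_zero_of_pow_eq (p := p) (β j) _ (m j - t) (by have := htm j; omega) rfl
    have hDc : ∀ i, KaehlerDifferential.D ℤ L (c i) = 0 := fun i => by
      refine Finset.prod_induction _ (fun z => KaehlerDifferential.D ℤ L z = 0) ?_ (by simp) ?_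
      · intro y z hy hz
        simp [hy, hz]
      · intro j _
        rw [Derivation.leibniz_pow, hDδ, smul_zero, smul_zero]
    have h0 := D_eq_zero_of_pow_eq (p := p) γ _ (m₀ - t) (by omega) rfl
    rw [← hcx, map_sum] at h0
    rw [← h0, map_sum]
    refine Finset.sum_congr rfl fun i _ => ?_
    simp [f, hDc]
  have hfe : ∀ i, f (e i) = 0 := fun i => by
    refine Fin.lastCases ?_ (fun j => ?_) i
    · simpa [e] using hfθ
    · simpa [e] using hfb j
  have hker : LinearMap.ker f ≤ Submodule.span L (Set.range e) := by
    have hrank : Module.rank L (LinearMap.ker f) ≤ (r + 1 : ℕ) := by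
      refine rank_ker_mapBaseChange_le (r + 1) (Fin.snoc β γ) ?_
      rw [← htop, Fin.range_snoc, Set.insert_eq, Set.union_comm]
    exact le_span_of_rank_le _ he hfe hrank
  have hprod : (List.ofFn fun i => ι L (e i)).prod =
      extScalars F L (Ω[F⁄ℤ]) (dwedge F b) * ι L θ := by
    rw [List.ofFn_succ', dwedge, map_list_prod, List.map_ofFn]
    simp [e, dform, Function.comp_def, extScalars_ι]
  have hiff : resMap F L ω = 0 ↔
      extScalars F L (Ω[F⁄ℤ]) ω * (List.ofFn fun i => ι L (e i)).prod = 0 := by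
    rw [resMap_eq_map_extScalars]
    exact ⟨mul_prod_eq_zero_of_map_eq_zero e f hker _,
      map_eq_zero_of_mul_prod_eq_zero f e he hfe _⟩
  rw [hiff, hprod, ← mul_assoc, ← map_mul, extScalars_mul_ι_sum_eq_zero_iff hc]
  simp only [mul_assoc, dform]

end Restriction

/-- Theorem 5.4(b). Let `b₁,…,b_r, b ∈ F ∖ F^p` with `{b₁,…,b_r}`
`p`-independent and `b ∈ F^p(b₁,…,b_r)`, `m ≤ m₁,…,m_r`,
`E = F(b₁^{1/p^{m₁}}, …, b_r^{1/p^{m_r}}, b^{1/p^m})`. Assume there is no `t ≥ m` with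
`b ∈ F^{p^t}(b₁,…,b_r)`, choose `t ∈ {1,…,m−1}` maximal with `b ∈ F^{p^t}(b₁,…,b_r)`, and
write `b = Σ_{i ∈ T} x_i^{p^t} b₁^{i₁} ⋯ b_r^{i_r}` with `T = {0,…,p^t−1}^r`; set
`S = {x_i ∣ i ∈ T}`. Then `Ωⁿ(E/F) = annΩ^n_F(d b₁ ∧ … ∧ d b_r ∧ dS)` and
`ν_n(E/F) = ann ν^n_F(d b₁ ∧ … ∧ d b_r ∧ dS)`. -/
theorem stmt17 (F : Type) [Field F] (p : ℕ) [Fact p.Prime] [CharP F p]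
    (n r : ℕ) (b : Fin r → F) (b₀ : F)
    (hbF : ∀ i, b i ∉ pClosure F p ∅) (hb₀F : b₀ ∉ pClosure F p ∅)
    (hind : pIndep F p b) (hmem : b₀ ∈ pClosure F p (Set.range b))
    (m : Fin r → ℕ) (m₀ : ℕ) (hm : ∀ i, 1 ≤ m i) (hm₀ : 1 ≤ m₀)
    (hle : ∀ i, m₀ ≤ m i)
    (β : Fin r → AlgebraicClosure F) (γ : AlgebraicClosure F)
    (hβ : ∀ i, β i ^ p ^ m i = algebraMap F (AlgebraicClosure F) (b i))
    (hγ : γ ^ p ^ m₀ = algebraMap F (AlgebraicClosure F) b₀)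
    (hno : ∀ t : ℕ, m₀ ≤ t → b₀ ∉ pClosureT F p t (Set.range b))
    (t : ℕ) (ht1 : 1 ≤ t) (ht2 : t < m₀)
    (htmem : b₀ ∈ pClosureT F p t (Set.range b))
    (htmax : ∀ t' : ℕ, t < t' → b₀ ∉ pClosureT F p t' (Set.range b))
    (x : (Fin r → Fin (p ^ t)) → F)
    (hx : b₀ = ∑ i : Fin r → Fin (p ^ t), x i ^ p ^ t * ∏ j, b j ^ (i j : ℕ)) :
    OmegaKer F (IntermediateField.adjoin F (Set.range β ∪ {γ})) n =
        ((annOmega F n {ω | ∃ s ∈ Set.range x, ω = dwedge F b * dform F s} :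
          Submodule F (ExtOmega F)) : Set (ExtOmega F)) ∧
      nuKer F (IntermediateField.adjoin F (Set.range β ∪ {γ})) n =
        ((annNu F n {ω | ∃ s ∈ Set.range x, ω = dwedge F b * dform F s} :
          AddSubgroup (ExtOmega F)) : Set (ExtOmega F)) := by
  have htop : IntermediateField.adjoin F
      (Set.range (fun i => (⟨β i, IntermediateField.subset_adjoin F _ (Or.inl ⟨i, rfl⟩)⟩ :
        IntermediateField.adjoin F (Set.range β ∪ {γ}))) ∪
        {⟨γ, IntermediateField.subset_adjoin F _ (Or.inr rfl)⟩}) = ⊤ := by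
    apply IntermediateField.lift_injective
    rw [IntermediateField.lift_adjoin, IntermediateField.lift_top, Set.image_union,
      Set.image_singleton, ← Set.range_comp]
    rfl
  have hiff := resMap_eq_zero_iff hind (fun i => Subtype.ext (hβ i)) (Subtype.ext hγ) htop
    (fun i => ht2.trans_le (hle i)) ht2 (htmax (t + 1) (Nat.lt_succ_self t)) x hx
  have hker : OmegaKer F (IntermediateField.adjoin F (Set.range β ∪ {γ})) n =
      ((annOmega F n {ω | ∃ s ∈ Set.range x, ω = dwedge F b * dform F s} :
        Submodule F (ExtOmega F)) : Set (ExtOmega F)) := by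
    ext ω
    simp only [OmegaKer, annOmega, Set.mem_ofPred_eq, SetLike.mem_coe, Submodule.mem_inf, hiff,
      Submodule.mem_iInf, LinearMap.mem_ker, LinearMap.mulRight_apply]
    refine and_congr_right fun _ => ⟨?_, fun h i => h _ ⟨x i, ⟨i, rfl⟩, rfl⟩⟩
    rintro h _ ⟨_, ⟨i, rfl⟩, rfl⟩
    exact h i
  exact ⟨hker, by rw [nuKer, hker]; rfl⟩
end
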